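/- Every planar graph G satisfies π(G) ≤ 768, i.e., every planar graph admits a nonrepetitive colouring with at most 768 colours. -/

import Mathlib

/-- A colouring `φ` of (the vertices of) `G` is *nonrepetitive* if for no path of `G`
(with vertex sequence of even length `2k`) the sequence of colours on the first half
equals the sequence of colours on the second half. -/
def SimpleGraph.IsNonrepetitiveColouring {V α : Type*} (G : SimpleGraph V) (φ : V → α) : Prop :=
  ∀ ⦃u v : V⦄ (p : G.Walk u v), p.IsPath →
    ∀ k : ℕ, p.support.length = 2 * k →
      (p.support.map φ).take k ≠ (p.support.map φ).drop k

/-- The *nonrepetitive chromatic number* `π(G)`: the least `n` such that `G` has a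
nonrepetitive colouring with `n` colours. -/
noncomputable def SimpleGraph.nonrepChromNum {V : Type*} (G : SimpleGraph V) : ℕ :=
  sInf {n : ℕ | ∃ φ : V → Fin n, G.IsNonrepetitiveColouring φ}

/-- `G` is *planar*: it has a topological embedding in the plane. Vertices are mapped to
distinct points of `ℝ²`; every edge is realised by an injective arc between the images of
its endpoints (the two orientations of an edge give the same arc); arcs meet vertex
points only at their own endpoints; and arcs of distinct edges intersect only in the
images of shared endpoints. -/
def SimpleGraph.IsPlanar {V : Type*} (G : SimpleGraph V) : Prop :=
  ∃ (f : V → ℝ × ℝ) (γ : ∀ ⦃u v : V⦄, G.Adj u v → _root_.Path (f u) (f v)),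
    Function.Injective f ∧
    (∀ ⦃u v : V⦄ (h : G.Adj u v), Function.Injective ⇑(γ h)) ∧
    (∀ ⦃u v : V⦄ (h : G.Adj u v), Set.range ⇑(γ h) = Set.range ⇑(γ h.symm)) ∧
    (∀ ⦃u v : V⦄ (h : G.Adj u v) (w : V), f w ∈ Set.range ⇑(γ h) → w = u ∨ w = v) ∧
    (∀ ⦃u v u' v' : V⦄ (h : G.Adj u v) (h' : G.Adj u' v'), s(u, v) ≠ s(u', v') →
      Set.range ⇑(γ h) ∩ Set.range ⇑(γ h') ⊆ f '' (({u, v} : Set V) ∩ {u', v'}))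

/-- The Thue–Morse sequence. -/
def thueMorse (n : ℕ) : ℤ :=
  if n = 0 then 0 else if n % 2 = 0 then thueMorse (n / 2) else 1 - thueMorse (n / 2)

lemma thueMorse_two_mul (n : ℕ) : thueMorse (2 * n) = thueMorse n := by
  rcases Nat.eq_zero_or_pos n with rfl | h
  · rfl
  · rw [thueMorse, if_neg (by omega), if_pos (by omega)]
    congr 1; omega

lemma thueMorse_two_mul_add_one (n : ℕ) : thueMorse (2 * n + 1) = 1 - thueMorse n := by
  rw [thueMorse, if_neg (by omega), if_neg (by omega)]
  congr 2; omega

lemma thueMorse_eq_zero_or_one (n : ℕ) : thueMorse n = 0 ∨ thueMorse n = 1 := by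
  induction n using Nat.strong_induction_on with
  | _ n ih =>
    rcases Nat.even_or_odd' n with ⟨m, rfl | rfl⟩
    · rcases Nat.eq_zero_or_pos m with rfl | h
      · left; simp [thueMorse]
      · rw [thueMorse_two_mul]; exact ih m (by omega)
    · rw [thueMorse_two_mul_add_one]
      rcases ih m (by omega) with h | h <;> omega

lemma thueMorse_ne_of_even {n : ℕ} (h : n % 2 = 0) : thueMorse n ≠ thueMorse (n + 1) := by
  obtain ⟨m, rfl⟩ : ∃ m, n = 2 * m := ⟨n / 2, by omega⟩
  rw [thueMorse_two_mul, thueMorse_two_mul_add_one]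
  rcases thueMorse_eq_zero_or_one m with h | h <;> omega

lemma thueMorse_not_three (n : ℕ) :
    ¬ (thueMorse n = thueMorse (n + 1) ∧ thueMorse (n + 1) = thueMorse (n + 2)) := by
  rintro ⟨h1, h2⟩
  rcases Nat.mod_two_eq_zero_or_one n with h | h
  · exact thueMorse_ne_of_even h h1
  · exact thueMorse_ne_of_even (n := n + 1) (by omega) h2

/-- The Thue–Morse sequence is overlap-free. -/
lemma thueMorse_overlapFree (k : ℕ) (hk : 0 < k) (n : ℕ) :
    ¬ ∀ i ≤ k, thueMorse (n + i) = thueMorse (n + k + i) := by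
  induction k using Nat.strong_induction_on generalizing n with
  | _ k ih =>
    intro h
    rcases Nat.even_or_odd' k with ⟨m, rfl | rfl⟩
    · refine ih m (by omega) (by omega) (n / 2) fun i hi => ?_
      have h' := h (2 * i) (by omega)
      rcases Nat.even_or_odd' n with ⟨j, rfl | rfl⟩
      · rw [show 2 * j / 2 = j by omega]
        rwa [show 2 * j + 2 * i = 2 * (j + i) by ring,
          show 2 * j + 2 * m + 2 * i = 2 * (j + m + i) by ring, thueMorse_two_mul,
          thueMorse_two_mul] at h'
      · rw [show (2 * j + 1) / 2 = j by omega]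
        rw [show 2 * j + 1 + 2 * i = 2 * (j + i) + 1 by ring,
          show 2 * j + 1 + 2 * m + 2 * i = 2 * (j + m + i) + 1 by ring,
          thueMorse_two_mul_add_one, thueMorse_two_mul_add_one] at h'
        omega
    · rcases Nat.eq_zero_or_pos m with rfl | hm
      · exact thueMorse_not_three n ⟨by simpa using h 0 (by omega), by
          simpa [add_assoc] using h 1 (by omega)⟩
      · have alt : ∀ x, n ≤ x → x < n + 2 * (2 * m + 1) → thueMorse x ≠ thueMorse (x + 1) := by
          intro x h1 h2
          rcases Nat.mod_two_eq_zero_or_one x with hx | hx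
          · exact thueMorse_ne_of_even hx
          · rcases lt_or_ge x (n + (2 * m + 1)) with hlt | hge
            · have e1 := h (x - n) (by omega)
              have e2 := h (x + 1 - n) (by omega)
              rw [show n + (x - n) = x by omega,
                show n + (2 * m + 1) + (x - n) = x + (2 * m + 1) by omega] at e1
              rw [show n + (x + 1 - n) = x + 1 by omega,
                show n + (2 * m + 1) + (x + 1 - n) = x + (2 * m + 1) + 1 by omega] at e2
              rw [e1, e2]
              exact thueMorse_ne_of_even (by omega)
            · have e1 := h (x - (2 * m + 1) - n) (by omega)
              have e2 := h (x + 1 - (2 * m + 1) - n) (by omega)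
              rw [show n + (x - (2 * m + 1) - n) = x - (2 * m + 1) by omega,
                show n + (2 * m + 1) + (x - (2 * m + 1) - n) = x by omega] at e1
              rw [show n + (x + 1 - (2 * m + 1) - n) = x - (2 * m + 1) + 1 by omega,
                show n + (2 * m + 1) + (x + 1 - (2 * m + 1) - n) = x + 1 by omega] at e2
              rw [← e1, ← e2]
              exact thueMorse_ne_of_even (by omega)
        have two : ∀ j, n ≤ 2 * j → 2 * j + 1 < n + 2 * (2 * m + 1) →
            thueMorse j = thueMorse (j + 1) := by
          intro j h1 h2
          have a1 := alt (2 * j) h1 (by omega)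
          have a2 := alt (2 * j + 1) (by omega) h2
          rw [show 2 * j + 1 + 1 = 2 * (j + 1) by ring] at a2
          rw [thueMorse_two_mul, thueMorse_two_mul_add_one] at a1
          rw [thueMorse_two_mul, thueMorse_two_mul_add_one] at a2
          rcases thueMorse_eq_zero_or_one j with h | h <;>
          rcases thueMorse_eq_zero_or_one (j + 1) with h' | h' <;> omega
        exact thueMorse_not_three ((n + 1) / 2)
          ⟨two _ (by omega) (by omega), two _ (by omega) (by omega)⟩

/-- A square-free sequence over the alphabet `{-1, 0, 1}`. -/
def ternarySeq (n : ℕ) : ℤ := thueMorse (n + 1) - thueMorse n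

lemma ternarySeq_squareFree (k : ℕ) (hk : 0 < k) (n : ℕ) :
    ¬ ∀ i < k, ternarySeq (n + i) = ternarySeq (n + k + i) := by
  intro h
  have key : ∀ i ≤ k, thueMorse (n + i) - thueMorse n
      = thueMorse (n + k + i) - thueMorse (n + k) := by
    intro i
    induction i with
    | zero => simp
    | succ i ih =>
      intro hi
      have h1 := ih (by omega)
      have h2 := h i (by omega)
      simp only [ternarySeq] at h2
      rw [← add_assoc, ← add_assoc]
      linarith
  have h3 := key k le_rfl
  refine thueMorse_overlapFree k hk n fun i hi => ?_
  have := key i hi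
  rcases thueMorse_eq_zero_or_one n with h | h <;>
  rcases thueMorse_eq_zero_or_one (n + k) with h' | h' <;>
  rcases thueMorse_eq_zero_or_one (n + k + k) with h'' | h'' <;> omega

/-- A four-letter sequence obtained from `ternarySeq` by inserting a fourth letter after every
second position; it is square-free and any three consecutive letters are distinct. -/
def pathSeq (n : ℕ) : ℤ :=
  if n % 3 = 2 then 2 else ternarySeq (2 * (n / 3) + n % 3)

lemma ternarySeq_bounds (n : ℕ) : -1 ≤ ternarySeq n ∧ ternarySeq n ≤ 1 := by
  unfold ternarySeq
  rcases thueMorse_eq_zero_or_one n with h | h <;>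
  rcases thueMorse_eq_zero_or_one (n + 1) with h' | h' <;> omega

lemma pathSeq_bounds (n : ℕ) : -1 ≤ pathSeq n ∧ pathSeq n ≤ 2 := by
  unfold pathSeq
  split_ifs
  · omega
  · have := ternarySeq_bounds (2 * (n / 3) + n % 3); omega

lemma pathSeq_eq_two_iff (n : ℕ) : pathSeq n = 2 ↔ n % 3 = 2 := by
  unfold pathSeq
  split_ifs with h
  · simp [h]
  · have := ternarySeq_bounds (2 * (n / 3) + n % 3); omega

lemma ternarySeq_ne_succ (n : ℕ) : ternarySeq n ≠ ternarySeq (n + 1) := fun h =>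
  ternarySeq_squareFree 1 one_pos n fun i hi => by
    obtain rfl : i = 0 := by omega
    simpa using h

lemma pathSeq_ne_succ (n : ℕ) : pathSeq n ≠ pathSeq (n + 1) := by
  by_cases h : n % 3 = 0
  · have e := ternarySeq_ne_succ (2 * (n / 3))
    unfold pathSeq
    rw [if_neg (by omega), if_neg (by omega)]
    convert e using 2 <;> omega
  · intro e
    have h1 := pathSeq_eq_two_iff n
    have h2 := pathSeq_eq_two_iff (n + 1)
    omega

lemma pathSeq_ne_add_two (n : ℕ) : pathSeq n ≠ pathSeq (n + 2) := by
  by_cases h : n % 3 = 1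
  · have e := ternarySeq_ne_succ (2 * (n / 3) + 1)
    unfold pathSeq
    rw [if_neg (by omega), if_neg (by omega)]
    convert e using 2 <;> omega
  · intro e
    have h1 := pathSeq_eq_two_iff n
    have h2 := pathSeq_eq_two_iff (n + 2)
    omega

lemma pathSeq_squareFree (c : ℕ) (hc : 0 < c) (n : ℕ) :
    ¬ ∀ y, n ≤ y → y < n + c → pathSeq y = pathSeq (y + c) := by
  intro h
  by_cases h1 : c = 1
  · subst h1; exact pathSeq_ne_succ n (h n le_rfl (by omega))
  by_cases h2 : c = 2
  · subst h2; exact pathSeq_ne_add_two n (h n le_rfl (by omega))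
  have h3 : c % 3 = 0 := by
    have e := h (n + (5 - n % 3) % 3) (by omega) (by omega)
    have e1 := pathSeq_eq_two_iff (n + (5 - n % 3) % 3)
    have e2 := pathSeq_eq_two_iff (n + (5 - n % 3) % 3 + c)
    omega
  obtain ⟨m, rfl⟩ : ∃ m, c = 3 * m := ⟨c / 3, by omega⟩
  refine ternarySeq_squareFree (2 * m) (by omega) (2 * (n / 3) + n % 3) fun i hi => ?_
  -- the position in `pathSeq` of the letter `j` of `ternarySeq` is `3 * (j / 2) + j % 2`
  have e := h (3 * ((2 * (n / 3) + n % 3 + i) / 2) + (2 * (n / 3) + n % 3 + i) % 2)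
    (by omega) (by omega)
  unfold pathSeq at e
  rw [if_neg (by omega), if_neg (by omega)] at e
  convert e using 2 <;> omega

lemma pathSeq_inj_of_near {y z : ℕ} (h1 : y ≤ z + 2) (h2 : z ≤ y + 2)
    (h : pathSeq y = pathSeq z) : y = z := by
  rcases lt_trichotomy y z with hlt | heq | hlt
  · rcases (show z = y + 1 ∨ z = y + 2 by omega) with rfl | rfl
    · exact absurd h (pathSeq_ne_succ y)
    · exact absurd h (pathSeq_ne_add_two y)
  · exact heq
  · rcases (show y = z + 1 ∨ y = z + 2 by omega) with rfl | rfl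
    · exact absurd h.symm (pathSeq_ne_succ z)
    · exact absurd h.symm (pathSeq_ne_add_two z)

lemma exists_eq_of_step_le_one (x : ℕ → ℕ) (n : ℕ)
    (h : ∀ i < n, x i ≤ x (i + 1) + 1 ∧ x (i + 1) ≤ x i + 1) (y : ℕ)
    (hy : x 0 ≤ y ∧ y ≤ x n ∨ x n ≤ y ∧ y ≤ x 0) : ∃ i ≤ n, x i = y := by
  induction n with
  | zero => exact ⟨0, le_rfl, by omega⟩
  | succ n ih =>
    by_cases e : x (n + 1) = y
    · exact ⟨n + 1, le_rfl, e⟩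
    · have := h n (by omega)
      obtain ⟨i, hi, hx⟩ := ih (fun i hi => h i (by omega)) (by omega)
      exact ⟨i, by omega, hx⟩

lemma lazyWalk_translate_or_reflect (t : ℕ) (x : ℕ → ℕ)
    (hstep : ∀ i, i + 1 < 2 * t → x i ≤ x (i + 1) + 1 ∧ x (i + 1) ≤ x i + 1)
    (hrep : ∀ i < t, pathSeq (x i) = pathSeq (x (i + t))) (i : ℕ) (hi : i < t) :
    (∀ j ≤ i, x j = x 0 ∧ x (j + t) = x t) ∨
    ∃ ε : ℤ, (ε = 1 ∨ ε = -1) ∧ (∃ p q : ℕ, pathSeq p = pathSeq q ∧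
      ((p : ℤ) - x i = 1 ∨ (p : ℤ) - x i = -1) ∧ (q : ℤ) - x (i + t) = ε * (p - x i)) ∧
      ∀ j ≤ i, (x (j + t) : ℤ) - x t = ε * (x j - x 0) := by
  induction i with
  | zero =>
    left; intro j hj
    obtain rfl : j = 0 := by omega
    simp
  | succ i ih =>
    have s1 := hstep i (by omega)
    have s2 := hstep (i + t) (by omega)
    rw [show i + t + 1 = i + 1 + t by ring] at s2
    have r1 := hrep i (by omega)
    have r2 := hrep (i + 1) hi
    have lazy : x i = x (i + 1) ↔ x (i + t) = x (i + 1 + t) := by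
      constructor
      · intro h
        exact pathSeq_inj_of_near (by omega) (by omega) (by rw [← r1, ← r2, h])
      · intro h
        exact pathSeq_inj_of_near (by omega) (by omega) (by rw [r1, r2, h])
    rcases ih (by omega) with h | ⟨ε, hε, ⟨p, q, hpq, hp, hq⟩, h⟩
    · have hi' := h i le_rfl
      by_cases e : x i = x (i + 1)
      · left; intro j hj
        rcases Nat.lt_or_ge i j with hlt | hle
        · obtain rfl : j = i + 1 := by omega
          have := lazy.1 e
          omega
        · exact h j hle
      · right
        have e' := mt lazy.2 e
        obtain ⟨ε, hε, he⟩ : ∃ ε : ℤ, (ε = 1 ∨ ε = -1) ∧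
            (x (i + 1 + t) : ℤ) - x (i + t) = ε * (x (i + 1) - x i) := by
          rcases (show (x (i + 1 + t) : ℤ) - x (i + t) = x (i + 1) - x i ∨
            (x (i + 1 + t) : ℤ) - x (i + t) = -(x (i + 1) - x i) by omega) with h | h
          · exact ⟨1, Or.inl rfl, by linarith⟩
          · exact ⟨-1, Or.inr rfl, by linarith⟩
        refine ⟨ε, hε, ⟨x i, x (i + t), r1, by omega, by linarith⟩, fun j hj => ?_⟩
        rcases Nat.lt_or_ge i j with hlt | hle
        · obtain rfl : j = i + 1 := by omega
          rw [← hi'.1, ← hi'.2]; exact he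
        · rw [(h j hle).1, (h j hle).2]; ring
    · right
      have key : (x (i + 1 + t) : ℤ) - x (i + t) = ε * (x (i + 1) - x i) := by
        by_cases e : x i = x (i + 1)
        · have := lazy.1 e
          rw [← e, this]; ring
        · have e' := mt lazy.2 e
          have b : p = x (i + 1) ↔ q = x (i + 1 + t) := by
            constructor
            · intro h
              refine pathSeq_inj_of_near ?_ ?_ (by rw [← hpq, ← r2, h]) <;>
              rcases hε with rfl | rfl <;> omega
            · intro h
              refine pathSeq_inj_of_near ?_ ?_ (by rw [hpq, r2, h]) <;>
              rcases hε with rfl | rfl <;> omega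
          rcases hε with rfl | rfl <;> omega
      refine ⟨ε, hε, ?_, fun j hj => ?_⟩
      · by_cases e : x i = x (i + 1)
        · have := lazy.1 e
          exact ⟨p, q, hpq, by rw [← e]; exact hp, by rw [← e, ← this]; exact hq⟩
        · exact ⟨x i, x (i + t), r1, by omega, by linarith⟩
      · rcases Nat.lt_or_ge i j with hlt | hle
        · obtain rfl : j = i + 1 := by omega
          have := h i le_rfl
          linarith
        · exact h j hle

/-- Every lazy walk of the one-way infinite path that is repetitively coloured by `pathSeq`
is boring. -/
lemma pathSeq_boring (t : ℕ) (x : ℕ → ℕ)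
    (hstep : ∀ i, i + 1 < 2 * t → x i ≤ x (i + 1) + 1 ∧ x (i + 1) ≤ x i + 1)
    (hrep : ∀ i < t, pathSeq (x i) = pathSeq (x (i + t))) (i : ℕ) (hi : i < t) :
    x i = x (i + t) := by
  obtain ⟨s, rfl⟩ : ∃ s, t = s + 1 := ⟨t - 1, by omega⟩
  have mid := hstep s (by omega)
  have ivt := exists_eq_of_step_le_one x s fun i hi => hstep i (by omega)
  have r0 := hrep 0 (by omega)
  rw [zero_add] at r0
  rcases lazyWalk_translate_or_reflect _ x hstep hrep s (by omega) with h | ⟨ε, hε, -, h⟩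
  · have := h s le_rfl
    have e := pathSeq_inj_of_near (by omega) (by omega) r0
    rw [(h i (by omega)).1, (h i (by omega)).2, e]
  · rcases hε with rfl | rfl
    · have hs := h s le_rfl
      rcases lt_trichotomy (x 0) (x (s + 1)) with hlt | heq | hlt
      · exfalso
        refine pathSeq_squareFree (x (s + 1) - x 0) (by omega) (x 0) fun y h1 h2 => ?_
        obtain ⟨j, hj, rfl⟩ := ivt y (by omega)
        have := h j hj
        rw [hrep j (by omega)]
        congr 1; omega
      · have := h i (by omega)
        omega
      · exfalso
        refine pathSeq_squareFree (x 0 - x (s + 1)) (by omega)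
          (x (s + 1) + 1 - (x 0 - x (s + 1))) fun y h1 h2 => ?_
        obtain ⟨j, hj, hy⟩ := ivt (y + (x 0 - x (s + 1))) (by omega)
        have := h j hj
        rw [← hy, hrep j (by omega)]
        congr 1; omega
    · have hs := h s le_rfl
      rcases lt_trichotomy (x 0) (x (s + 1)) with hlt | heq | hlt
      · exfalso
        obtain ⟨j, hj, hy⟩ := ivt ((x 0 + x (s + 1) - 1) / 2) (by omega)
        have := h j hj
        have := pathSeq_inj_of_near (by omega) (by omega) (hrep j (by omega))
        omega
      · by_cases all : ∀ j ≤ s, x j = x 0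
        · have := h i (by omega)
          have := all i (by omega)
          omega
        · exfalso
          push Not at all
          obtain ⟨j, hj, hne⟩ := all
          obtain ⟨l, hl, hy⟩ := exists_eq_of_step_le_one x j
            (fun i hi => hstep i (by omega)) (if x j < x 0 then x 0 - 1 else x 0 + 1)
            (by split_ifs <;> omega)
          have := h l (by omega)
          have e : x l = x 0 - 1 ∧ 0 < x 0 ∨ x l = x 0 + 1 := by split_ifs at hy <;> omega
          have := pathSeq_inj_of_near (by omega) (by omega) (hrep l (by omega))
          omega
      · exfalso
        obtain ⟨j, hj, hy⟩ := ivt ((x 0 + x (s + 1) + 2) / 2) (by omega)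
        have := h j hj
        have := pathSeq_inj_of_near (by omega) (by omega) (hrep j (by omega))
        omega

/-- Consecutive vertices of a lazy walk: equal or adjacent. -/
def SimpleGraph.LazyAdj {α : Type*} (H : SimpleGraph α) (a b : α) : Prop := a = b ∨ H.Adj a b

/-- A colouring is strongly nonrepetitive if every repetitively coloured lazy walk
`v₁, …, v₂ₜ` satisfies `vᵢ = vₜ₊ᵢ` for some `i`. The walk is given by the pairs `(vᵢ, vₜ₊ᵢ)`. -/
def SimpleGraph.IsStronglyNonrepetitive {α β : Type*} (H : SimpleGraph α) (φ : α → β) : Prop :=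
  ∀ z : List (α × α), z ≠ [] → (z.map Prod.fst ++ z.map Prod.snd).IsChain H.LazyAdj →
    (∀ p ∈ z, φ p.1 = φ p.2) → ∃ p ∈ z, p.1 = p.2

lemma pathSeq_boring_list (z : List (ℕ × ℕ))
    (hc : (z.map Prod.fst ++ z.map Prod.snd).IsChain fun a b => a ≤ b + 1 ∧ b ≤ a + 1)
    (h : ∀ p ∈ z, pathSeq p.1 = pathSeq p.2) : ∀ p ∈ z, p.1 = p.2 := by
  set l := z.map Prod.fst ++ z.map Prod.snd with hl
  have hlen : l.length = 2 * z.length := by simp [hl]; ring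
  have h1 : ∀ i (hi : i < z.length), l.getD i 0 = z[i].1 := fun i hi => by
    rw [hl, List.getD_eq_getElem _ _ (by simp; omega), List.getElem_append_left (by simpa)]
    simp
  have h2 : ∀ i (hi : i < z.length), l.getD (i + z.length) 0 = z[i].2 := fun i hi => by
    rw [hl, List.getD_eq_getElem _ _ (by simp; omega), List.getElem_append_right (by simp)]
    simp
  have := pathSeq_boring z.length (fun i => l.getD i 0)
    (fun i hi => by
      have := List.isChain_iff_getElem.1 hc i (by omega)
      rw [List.getD_eq_getElem _ _ (by omega), List.getD_eq_getElem _ _ (by omega)]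
      exact this)
    (fun i hi => by
      simp only [h1 i hi, h2 i hi]
      exact h _ (List.getElem_mem hi))
  intro p hp
  obtain ⟨i, hi, rfl⟩ := List.getElem_of_mem hp
  have e := this i hi
  simpa only [h1 i hi, h2 i hi] using e

lemma List.IsChain.filter_of_shortcut {α : Type*} {R : α → α → Prop} (q : α → Bool) (l : List α)
    (hl : l.IsChain R) (hR : ∀ a ∈ l, ∀ b ∈ l, q a → q b → ∀ c ∈ l, ∀ d ∈ l, ¬ q c → ¬ q d →
      R a c → R d b → R a b) (hone : ∀ c ∈ l, ∀ d ∈ l, ¬ q c → ¬ q d → c = d) :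
    (l.filter q).IsChain R := by
  have key : ∀ l' : List α, (∀ a ∈ l', a ∈ l) → ∀ x ∈ l, q x →
      ((x :: l').IsChain R → (x :: l'.filter q).IsChain R) ∧
      ∀ m ∈ l, ¬ q m → R x m → (m :: l').IsChain R → (x :: l'.filter q).IsChain R := by
    intro l'
    induction l' with
    | nil => intro _ x _ _; simp
    | cons y l' ih =>
      intro hsub x hx hqx
      have hy := hsub y (by simp)
      have hsub' : ∀ a ∈ l', a ∈ l := fun a ha => hsub a (by simp [ha])
      by_cases hqy : q y
      · have := (ih hsub' y hy hqy).1
        simp only [List.filter_cons_of_pos hqy, List.isChain_cons_cons]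
        exact ⟨fun h => ⟨h.1, this h.2⟩, fun m hm hqm hxm h =>
          ⟨hR x hx y hy hqx hqy m hm m hm hqm hqm hxm h.1, this h.2⟩⟩
      · simp only [List.filter_cons_of_neg hqy, List.isChain_cons_cons]
        refine ⟨fun h => (ih hsub' x hx hqx).2 y hy hqy h.1 h.2, fun m hm hqm hxm h => ?_⟩
        exact (ih hsub' x hx hqx).2 y hy hqy (hone m hm y hy hqm hqy ▸ hxm) h.2
  have key2 : ∀ l' : List α, (∀ a ∈ l', a ∈ l) → l'.IsChain R → (l'.filter q).IsChain R := by
    intro l'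
    induction l' with
    | nil => simp
    | cons y l' ih =>
      intro hsub h
      by_cases hqy : q y
      · rw [List.filter_cons_of_pos hqy]
        exact (key l' (fun a ha => hsub a (by simp [ha])) y (hsub y (by simp)) hqy).1 h
      · rw [List.filter_cons_of_neg hqy]
        exact ih (fun a ha => hsub a (by simp [ha])) h.of_cons
  exact key2 l (fun _ h => h) hl

/-- The order on `ℕ` is an elimination ordering of `H` of width at most `k`: the smaller
neighbours of each vertex form a clique with at most `k` vertices. -/
def SimpleGraph.IsElimination (H : SimpleGraph ℕ) (k : ℕ) : Prop :=
  ∀ j, (∃ s : Finset ℕ, s.card ≤ k ∧ ∀ i < j, H.Adj i j → i ∈ s) ∧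
    ∀ i < j, ∀ i' < j, H.Adj i j → H.Adj i' j → i ≠ i' → H.Adj i i'

open Classical in
/-- The layering of a graph on `ℕ` in which every vertex lies one layer above its least smaller
neighbour. -/
noncomputable def SimpleGraph.elimLayer (H : SimpleGraph ℕ) (j : ℕ) : ℕ :=
  if h : ∃ i, i < j ∧ H.Adj i j then
    H.elimLayer (sInf {i | i < j ∧ H.Adj i j}) + 1
  else 0
termination_by j
decreasing_by exact (Nat.sInf_mem (s := {i | i < j ∧ H.Adj i j}) h).1

lemma SimpleGraph.elimLayer_of_adj (H : SimpleGraph ℕ) (j : ℕ) (h : ∃ i, i < j ∧ H.Adj i j) :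
    ∃ m, m < j ∧ H.Adj m j ∧ (∀ i < j, H.Adj i j → m ≤ i) ∧
      H.elimLayer j = H.elimLayer m + 1 := by
  have hm := Nat.sInf_mem (s := {i | i < j ∧ H.Adj i j}) h
  refine ⟨_, hm.1, hm.2, fun i hi ha => Nat.sInf_le ⟨hi, ha⟩, ?_⟩
  rw [elimLayer, dif_pos h]

lemma SimpleGraph.IsElimination.elimLayer_le {H : SimpleGraph ℕ} {k : ℕ} (hH : H.IsElimination k)
    (j : ℕ) : ∀ i < j, H.Adj i j →
      H.elimLayer i ≤ H.elimLayer j ∧ H.elimLayer j ≤ H.elimLayer i + 1 := by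
  induction j using Nat.strong_induction_on with
  | _ j ih =>
    intro i hi ha
    obtain ⟨m, hm, hma, hmin, he⟩ := H.elimLayer_of_adj j ⟨i, hi, ha⟩
    rcases (hmin i hi ha).eq_or_lt with rfl | hlt
    · omega
    · have := ih i hi m hlt ((hH j).2 m hm i hi hma ha hlt.ne)
      omega

lemma SimpleGraph.IsElimination.lazyAdj_elimLayer {H : SimpleGraph ℕ} {k : ℕ}
    (hH : H.IsElimination k) {a b : ℕ} (h : H.LazyAdj a b) :
    H.elimLayer a ≤ H.elimLayer b + 1 ∧ H.elimLayer b ≤ H.elimLayer a + 1 := by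
  rcases h with rfl | h
  · omega
  · rcases h.ne.lt_or_gt with hlt | hlt
    · have := hH.elimLayer_le b a hlt h; omega
    · have := hH.elimLayer_le a b hlt h.symm; omega

/-- The subgraph of edges within a layer. -/
def SimpleGraph.sameLayer (H : SimpleGraph ℕ) : SimpleGraph ℕ where
  Adj i j := H.Adj i j ∧ H.elimLayer i = H.elimLayer j
  symm := ⟨fun _ _ h => ⟨h.1.symm, h.2.symm⟩⟩
  loopless := ⟨fun _ h => h.1.ne rfl⟩

lemma SimpleGraph.IsElimination.sameLayer {H : SimpleGraph ℕ} {k : ℕ}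
    (hH : H.IsElimination (k + 1)) : H.sameLayer.IsElimination k := by
  classical
  intro j
  refine ⟨?_, fun i hi i' hi' ha ha' hne =>
    ⟨(hH j).2 i hi i' hi' ha.1 ha'.1 hne, ha.2.trans ha'.2.symm⟩⟩
  by_cases h : ∃ i, i < j ∧ H.Adj i j
  · obtain ⟨m, hm, hma, hmin, he⟩ := H.elimLayer_of_adj j h
    obtain ⟨s, hs, hs'⟩ := (hH j).1
    refine ⟨s.erase m, ?_, fun i hi ha => Finset.mem_erase.2 ⟨?_, hs' i hi ha.1⟩⟩
    · rw [Finset.card_erase_of_mem (hs' m hm hma)]; omega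
    · rintro rfl; have := ha.2; omega
  · exact ⟨∅, by simp, fun i hi ha => absurd ⟨i, hi, ha.1⟩ h⟩

/-- Restricting a lazy walk to the vertices of its lowest layer gives a lazy walk. -/
lemma SimpleGraph.IsElimination.isChain_filter {H : SimpleGraph ℕ} {k : ℕ}
    (hH : H.IsElimination k) (l : List ℕ) (hl : l.IsChain H.LazyAdj) (d : ℕ)
    (hd : ∀ a ∈ l, d ≤ H.elimLayer a) :
    (l.filter fun a => H.elimLayer a = d).IsChain H.sameLayer.LazyAdj := by
  have down : ∀ n b, (∀ a ∈ l, a < b + n) →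
      (l.filter fun a => H.elimLayer a = d ∨ a < b).IsChain H.LazyAdj := by
    intro n
    induction n with
    | zero =>
      intro b hb
      rw [List.filter_eq_self.2 fun a ha => by simpa using Or.inr (hb a ha)]
      exact hl
    | succ n ih =>
      intro b hb
      have h1 := ih (b + 1) (fun a ha => by have := hb a ha; omega)
      have e : (l.filter fun a => H.elimLayer a = d ∨ a < b) =
          (l.filter fun a => H.elimLayer a = d ∨ a < b + 1).filter
            fun a => H.elimLayer a = d ∨ a < b := by
        rw [List.filter_filter]
        refine List.filter_congr fun a _ => ?_
        simp only [← Bool.decide_and, decide_eq_decide]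
        omega
      rw [e]
      refine List.IsChain.filter_of_shortcut _ _ h1 ?_ ?_
      · intro a ha a' ha' hqa hqa' c hc c' hc' hqc hqc' hac hca
        simp only [List.mem_filter, decide_eq_true_eq] at *
        obtain rfl : c = b := by omega
        obtain rfl : c' = c := by omega
        rcases hac with rfl | hac
        · exact hca
        rcases hca with rfl | hca
        · exact Or.inr hac
        have hlc := hd c' hc.1
        have lt : ∀ x, H.Adj x c' → (H.elimLayer x = d ∨ x < c') → x < c' := by
          intro x hx h
          rcases h with h | h
          · by_contra hge
            have := hH.elimLayer_le x c' (by have := hx.ne; omega) hx.symm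
            omega
          · exact h
        by_cases e : a = a'
        · exact Or.inl e
        · exact Or.inr ((hH c').2 a (lt a hac hqa) a' (lt a' hca.symm hqa') hac hca.symm e)
      · intro c hc c' hc' hqc hqc'
        simp only [List.mem_filter, decide_eq_true_eq] at *
        omega
  obtain ⟨n, hn⟩ : ∃ n, ∀ a ∈ l, a < n := ⟨l.sum + 1, fun a ha =>
    Nat.lt_succ_of_le (List.le_sum_of_mem ha)⟩
  have h0 := down n 0 (by simpa using hn)
  simp only [not_lt_zero, or_false] at h0
  refine h0.imp_of_mem_imp fun a b ha hb hab => ?_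
  simp only [List.mem_filter, decide_eq_true_eq] at ha hb
  rcases hab with h | h
  · exact Or.inl h
  · exact Or.inr ⟨h, ha.2.trans hb.2.symm⟩

/-- `pathSeq` as a colouring with four colours. -/
def pathColour (n : ℕ) : Fin 4 :=
  ⟨(pathSeq n + 1).toNat, by have := pathSeq_bounds n; omega⟩

lemma pathSeq_eq_of_pathColour_eq {m n : ℕ} (h : pathColour m = pathColour n) :
    pathSeq m = pathSeq n := by
  have h1 := pathSeq_bounds m
  have h2 := pathSeq_bounds n
  simp only [pathColour, Fin.mk.injEq] at h
  omega

theorem SimpleGraph.IsElimination.exists_stronglyNonrepetitive (k : ℕ) :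
    ∀ {H : SimpleGraph ℕ}, H.IsElimination k →
      ∃ φ : ℕ → Fin (4 ^ k), H.IsStronglyNonrepetitive φ := by
  induction k with
  | zero =>
    intro H hH
    refine ⟨fun _ => 0, fun z hz hc _ => ?_⟩
    have hno : ∀ a b, H.LazyAdj a b → a = b := by
      have lt : ∀ a b, a < b → ¬ H.Adj a b := fun a b hab h => by
        obtain ⟨s, hs, hs'⟩ := (hH b).1
        simpa [Finset.card_eq_zero.1 (Nat.le_zero.1 hs)] using hs' a hab h
      rintro a b (rfl | h)
      · rfl
      · rcases h.ne.lt_or_gt with hlt | hlt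
        · exact absurd h (lt _ _ hlt)
        · exact absurd h.symm (lt _ _ hlt)
    have hc' : (z.map Prod.fst ++ z.map Prod.snd).Pairwise (· = ·) :=
      List.isChain_iff_pairwise.1 (hc.imp hno)
    obtain ⟨p, hp⟩ := List.exists_mem_of_ne_nil z hz
    exact ⟨p, hp, (List.pairwise_append.1 hc').2.2 _ (List.mem_map_of_mem hp) _
      (List.mem_map_of_mem hp)⟩
  | succ k ih =>
    intro H hH
    obtain ⟨φ, hφ⟩ := ih hH.sameLayer
    refine ⟨fun a => (finProdFinEquiv (φ a, pathColour (H.elimLayer a))).cast (pow_succ _ _).symm,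
      fun z hz hc hcol => ?_⟩
    have hcol' : ∀ p ∈ z, φ p.1 = φ p.2 ∧
        pathColour (H.elimLayer p.1) = pathColour (H.elimLayer p.2) := by
      intro p hp
      simpa using hcol p hp
    have hlayer : ∀ p ∈ z, H.elimLayer p.1 = H.elimLayer p.2 := by
      have := pathSeq_boring_list (z.map fun p => (H.elimLayer p.1, H.elimLayer p.2)) (by
        have e : (z.map Prod.fst ++ z.map Prod.snd).map H.elimLayer =
          (z.map fun p => (H.elimLayer p.1, H.elimLayer p.2)).map Prod.fst ++
          (z.map fun p => (H.elimLayer p.1, H.elimLayer p.2)).map Prod.snd := by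
            simp [Function.comp_def]
        rw [← e, List.isChain_map]
        exact hc.imp fun a b h => hH.lazyAdj_elimLayer h) (by
        simp only [List.mem_map, forall_exists_index, and_imp]
        rintro _ p hp rfl
        exact pathSeq_eq_of_pathColour_eq (hcol' p hp).2)
      intro p hp
      exact this _ (List.mem_map_of_mem hp)
    obtain ⟨p₀, hp₀, hmin⟩ : ∃ p₀ ∈ z, ∀ p ∈ z, H.elimLayer p₀.1 ≤ H.elimLayer p.1 := by
      obtain ⟨p, hp, h⟩ := Finset.exists_min_image z.toFinset (fun p => H.elimLayer p.1)
        (List.toFinset_nonempty_iff z |>.2 hz)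
      exact ⟨p, by simpa using hp, fun q hq => h q (by simpa using hq)⟩
    set d := H.elimLayer p₀.1
    have hfil := hH.isChain_filter _ hc d (by
      intro a ha
      rcases List.mem_append.1 ha with ha | ha <;>
      obtain ⟨p, hp, rfl⟩ := List.mem_map.1 ha
      · exact hmin p hp
      · rw [← hlayer p hp]; exact hmin p hp)
    have e : (z.map Prod.fst ++ z.map Prod.snd).filter (fun a => H.elimLayer a = d) =
        (z.filter fun p => H.elimLayer p.1 = d).map Prod.fst ++
        (z.filter fun p => H.elimLayer p.1 = d).map Prod.snd := by
      rw [List.filter_append, List.filter_map, List.filter_map]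
      congr 2
      refine List.filter_congr fun p hp => ?_
      simp [hlayer p hp]
    rw [e] at hfil
    obtain ⟨p, hp, h⟩ := hφ _ (List.ne_nil_of_mem (a := p₀) (by simp [hp₀, d])) hfil
      fun p hp => (hcol' p (List.mem_filter.1 hp).1).1
    exact ⟨p, (List.mem_filter.1 hp).1, h⟩

/-- A set of vertices is connected in `G` if any two of its vertices are joined by a walk inside
the set. (The empty set is connected.) -/
def SimpleGraph.ConnIn {V : Type*} (G : SimpleGraph V) (s : Set V) : Prop :=
  ∀ x ∈ s, ∀ y ∈ s, ∃ p : G.Walk x y, ∀ z ∈ p.support, z ∈ s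

/-- There is an edge of `G` between `s` and `t`. -/
def SimpleGraph.SetAdj {V : Type*} (G : SimpleGraph V) (s t : Set V) : Prop :=
  ∃ x ∈ s, ∃ y ∈ t, G.Adj x y

/-- The triangular lattice on `ℤ × ℤ`. -/
def triLattice : SimpleGraph (ℤ × ℤ) where
  Adj x y := x ≠ y ∧
    ((x.1 ≤ y.1 ∧ y.1 ≤ x.1 + 1 ∧ x.2 ≤ y.2 ∧ y.2 ≤ x.2 + 1) ∨
      (y.1 ≤ x.1 ∧ x.1 ≤ y.1 + 1 ∧ y.2 ≤ x.2 ∧ x.2 ≤ y.2 + 1))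
  symm := ⟨fun _ _ h => ⟨h.1.symm, h.2.symm⟩⟩
  loopless := ⟨fun _ h => h.1 rfl⟩

/-- The faces of the triangular lattice: each unit square `[i, i+1] × [j, j+1]` is cut by its
diagonal into an upper face `((i, j), true)` and a lower face `((i, j), false)`. -/
abbrev TriFace := (ℤ × ℤ) × Bool

/-- The vertex `v` is a corner of the face `f`. -/
def TriFace.HasVertex (f : TriFace) (v : ℤ × ℤ) : Prop :=
  v = f.1 ∨ v = (f.1.1 + 1, f.1.2 + 1) ∨
    (f.2 = true ∧ v = (f.1.1, f.1.2 + 1)) ∨ (f.2 = false ∧ v = (f.1.1 + 1, f.1.2))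

/-- Indicator of the unordered pair `{a, b}`. -/
def pairInd (a b x y : ℤ × ℤ) : ZMod 2 :=
  if (a = x ∧ b = y) ∨ (a = y ∧ b = x) then 1 else 0

/-- Number (mod 2) of times that a walk uses the edge `{x, y}`. -/
def edgeCount {u v : ℤ × ℤ} (p : triLattice.Walk u v) (x y : ℤ × ℤ) : ZMod 2 :=
  (p.darts.map fun d => pairInd d.fst d.snd x y).sum

/-- The boundary (mod 2) of the set of faces with indicator `s` is the set of edges with
indicator `z`. -/
def IsFilling (z : ℤ × ℤ → ℤ × ℤ → ZMod 2) (s : TriFace → ZMod 2) : Prop :=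
  ∀ i j : ℤ, s ((i, j), false) = s ((i, j - 1), true) + z (i, j) (i + 1, j) ∧
    s ((i, j), true) = s ((i - 1, j), false) + z (i, j) (i, j + 1) ∧
    s ((i, j), true) = s ((i, j), false) + z (i, j) (i + 1, j + 1)

/-- The step from `x` to `y` crosses the ray going left from the face `f`. -/
def TriFace.CrossesRay (f : TriFace) (x y : ℤ × ℤ) : Prop :=
  (x.2 = f.1.2 ∧ y.2 = f.1.2 + 1 ∧ (if f.2 then y.1 else x.1) ≤ f.1.1) ∨
  (y.2 = f.1.2 ∧ x.2 = f.1.2 + 1 ∧ (if f.2 then x.1 else y.1) ≤ f.1.1)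

lemma zmod_two_add_self (a : ZMod 2) : a + a = 0 := CharTwo.add_self_eq_zero a

lemma sum_darts_potential {V : Type*} {G : SimpleGraph V} (τ : V → ZMod 2) {u v : V}
    (p : G.Walk u v) : (p.darts.map fun d => τ d.fst + τ d.snd).sum = τ u + τ v := by
  induction p with
  | nil => simp [zmod_two_add_self]
  | @cons u v w h p ih =>
    simp only [SimpleGraph.Walk.darts_cons, List.map_cons, List.sum_cons, ih]
    have := zmod_two_add_self (τ v)
    linear_combination this

lemma sum_darts_eq_zero {V : Type*} {G : SimpleGraph V} (τ : V → ZMod 2) (g : V → V → ZMod 2)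
    (h : ∀ x y, G.Adj x y → g x y = τ x + τ y) {u : V} (p : G.Walk u u) :
    (p.darts.map fun d => g d.fst d.snd).sum = 0 := by
  rw [← zmod_two_add_self (τ u), ← sum_darts_potential τ p]
  congr 1
  exact List.map_congr_left fun d _ => h _ _ d.adj

lemma pairInd_swap (a b x y : ℤ × ℤ) : pairInd b a x y = pairInd a b x y := by
  simp only [pairInd, and_comm, or_comm]

lemma triLattice_cases {P : ℤ × ℤ → ℤ × ℤ → Prop} (hs : ∀ x y, P x y → P y x)
    (h1 : ∀ i j, P (i, j) (i + 1, j)) (h2 : ∀ i j, P (i, j) (i, j + 1))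
    (h3 : ∀ i j, P (i, j) (i + 1, j + 1)) {x y : ℤ × ℤ} (h : triLattice.Adj x y) : P x y := by
  have key : ∀ x y : ℤ × ℤ, x ≠ y → x.1 ≤ y.1 ∧ y.1 ≤ x.1 + 1 ∧ x.2 ≤ y.2 ∧ y.2 ≤ x.2 + 1 →
      P x y := by
    rintro ⟨a, b⟩ ⟨c, d⟩ hne h
    simp only [ne_eq, Prod.mk.injEq] at h hne
    have : (c = a + 1 ∧ d = b) ∨ (c = a ∧ d = b + 1) ∨ (c = a + 1 ∧ d = b + 1) := by omega
    rcases this with ⟨rfl, rfl⟩ | ⟨rfl, rfl⟩ | ⟨rfl, rfl⟩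
    · exact h1 _ _
    · exact h2 _ _
    · exact h3 _ _
  rcases h.2 with h' | h'
  · exact key _ _ h.1 h'
  · exact hs _ _ (key _ _ h.1.symm h')

set_option maxHeartbeats 1000000 in
open Classical in
/-- A closed walk of the triangular lattice is the boundary of a set of faces. -/
lemma exists_isFilling_edgeCount {u : ℤ × ℤ} (p : triLattice.Walk u u) :
    ∃ s, IsFilling (edgeCount p) s := by
  let c : TriFace → ℤ × ℤ → ℤ × ℤ → ZMod 2 := fun f x y => if f.CrossesRay x y then 1 else 0
  have hc : ∀ f x y, c f x y = c f y x := fun f x y => by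
    simp only [c, TriFace.CrossesRay, or_comm]
  have key : ∀ (f g : TriFace) (a b : ℤ × ℤ) (τ : ℤ × ℤ → ZMod 2),
      (∀ x y, triLattice.Adj x y → c f x y + (c g x y + pairInd x y a b) = τ x + τ y) →
      (p.darts.map fun d => c f d.fst d.snd).sum =
        (p.darts.map fun d => c g d.fst d.snd).sum + edgeCount p a b := by
    intro f g a b τ h
    have := sum_darts_eq_zero τ (fun x y => c f x y + (c g x y + pairInd x y a b)) h p
    simp only [List.sum_map_add] at this
    exact CharTwo.add_eq_zero.1 this
  refine ⟨fun f => (p.darts.map fun d => c f d.fst d.snd).sum, fun i j => ⟨?_, ?_, ?_⟩⟩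
  · refine key _ _ _ _ (fun x => if x.2 = j ∧ x.1 ≤ i then 1 else 0) fun x y h => ?_
    refine triLattice_cases (P := fun x y => c ((i, j), false) x y + (c ((i, j - 1), true) x y +
      pairInd x y (i, j) (i + 1, j)) = (if x.2 = j ∧ x.1 ≤ i then 1 else 0) +
      if y.2 = j ∧ y.1 ≤ i then 1 else 0) (fun x y h => ?_) ?_ ?_ ?_ h
    · rw [hc, hc _ y x, pairInd_swap, h, add_comm]
    all_goals
      intro x1 x2
      simp only [c, TriFace.CrossesRay, pairInd, Prod.mk.injEq, if_true,
        Bool.false_eq_true, if_false]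
      split_ifs <;> first | rfl | (exfalso; omega)
  · refine key _ _ _ _ (fun _ => 0) fun x y h => ?_
    refine triLattice_cases (P := fun x y => c ((i, j), true) x y + (c ((i - 1, j), false) x y +
      pairInd x y (i, j) (i, j + 1)) = 0 + 0) (fun x y h => ?_) ?_ ?_ ?_ h
    · rw [hc, hc _ y x, pairInd_swap, h]
    all_goals
      intro x1 x2
      simp only [c, TriFace.CrossesRay, pairInd, Prod.mk.injEq, if_true,
        Bool.false_eq_true, if_false]
      split_ifs <;> first | rfl | (exfalso; omega)
  · refine key _ _ _ _ (fun _ => 0) fun x y h => ?_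
    refine triLattice_cases (P := fun x y => c ((i, j), true) x y + (c ((i, j), false) x y +
      pairInd x y (i, j) (i + 1, j + 1)) = 0 + 0) (fun x y h => ?_) ?_ ?_ ?_ h
    · rw [hc, hc _ y x, pairInd_swap, h]
    all_goals
      intro x1 x2
      simp only [c, TriFace.CrossesRay, pairInd, Prod.mk.injEq, if_true,
        Bool.false_eq_true, if_false]
      split_ifs <;> first | rfl | (exfalso; omega)

lemma IsFilling.add {z z' : ℤ × ℤ → ℤ × ℤ → ZMod 2} {s s' : TriFace → ZMod 2}
    (h : IsFilling z s) (h' : IsFilling z' s') :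
    IsFilling (fun x y => z x y + z' x y) (fun f => s f + s' f) := by
  intro i j
  obtain ⟨a, b, c⟩ := h i j
  obtain ⟨a', b', c'⟩ := h' i j
  simp only [a, a']
  refine ⟨by ring, ?_, ?_⟩
  · rw [b, b']; ring
  · rw [c, c', a, a']; ring

lemma IsFilling.add_const {z : ℤ × ℤ → ℤ × ℤ → ZMod 2} {s : TriFace → ZMod 2}
    (h : IsFilling z s) (c : ZMod 2) : IsFilling z (fun f => s f + c) := by
  intro i j
  obtain ⟨h1, h2, h3⟩ := h i j
  refine ⟨?_, ?_, ?_⟩ <;> simp only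
  · rw [h1]; ring
  · rw [h2]; ring
  · rw [h3]; ring

lemma IsFilling.eq_of_zero {z : ℤ × ℤ → ℤ × ℤ → ZMod 2} {s : TriFace → ZMod 2}
    (h : IsFilling z s) (hz : ∀ x y, z x y = 0) (f g : TriFace) : s f = s g := by
  simp only [IsFilling, hz, add_zero] at h
  have h1 : ∀ i j b, s ((i, j), b) = s ((i, j), true) := by
    rintro i j (_ | _)
    · exact (h i j).2.2.symm
    · rfl
  have h2 : ∀ i j, s ((i + 1, j), true) = s ((i, j), true) := fun i j => by
    have := (h (i + 1) j).2.1
    rw [add_sub_cancel_right] at this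
    exact this.trans (h1 i j false)
  have h3 : ∀ i j, s ((i, j + 1), true) = s ((i, j), true) := fun i j => by
    have := (h i (j + 1)).1
    rw [add_sub_cancel_right] at this
    exact (h1 i (j + 1) false).symm.trans this
  have h4 : ∀ i j, s ((i, j), true) = s ((0, j), true) := fun i j => by
    induction i using Int.induction_on with
    | zero => rfl
    | succ i ih => rw [h2, ih]
    | pred i ih => rw [← ih, ← h2, sub_add_cancel]
  have h5 : ∀ j, s ((0, j), true) = s ((0, 0), true) := fun j => by
    induction j using Int.induction_on with
    | zero => rfl
    | succ i ih => rw [h3, ih]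
    | pred i ih => rw [← ih, ← h3, sub_add_cancel]
  obtain ⟨⟨i, j⟩, b⟩ := f
  obtain ⟨⟨i', j'⟩, b'⟩ := g
  rw [h1, h1 i', h4, h4 i', h5, h5 j']

lemma IsFilling.eq_at_vertex {z : ℤ × ℤ → ℤ × ℤ → ZMod 2} {s : TriFace → ZMod 2}
    (h : IsFilling z s) (v : ℤ × ℤ) (hz : ∀ w, z v w = 0 ∧ z w v = 0) (f g : TriFace)
    (hf : f.HasVertex v) (hg : g.HasVertex v) : s f = s g := by
  have key : ∀ f : TriFace, f.HasVertex v → s f = s (v, true) := by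
    obtain ⟨i, j⟩ := v
    have e1 := (h i j).2.2
    have e2 := (h i j).2.1
    have e3 := (h (i - 1) j).1
    have e4 := (h (i - 1) (j - 1)).2.2
    have e5 := (h i (j - 1)).2.1
    simp only [sub_add_cancel] at e3 e4 e5
    rw [(hz _).1, add_zero] at e1 e2
    rw [(hz _).2, add_zero] at e3 e4 e5
    rintro ⟨⟨a, b⟩, c⟩ (e | e | ⟨rfl, e⟩ | ⟨rfl, e⟩) <;>
    simp only [Prod.mk.injEq] at e <;> obtain ⟨rfl, rfl⟩ := e <;>
    try simp only [add_sub_cancel_right] at e1 e2 e3 e4 e5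
    · cases c
      · exact e1.symm
      · rfl
    · cases c
      · rw [e2, e3, e4]
      · rw [e2, e3]
    · rw [e2, e3, e4, e5]
    · rw [e2, e3, e4]
  rw [key f hf, key g hg]

lemma exists_face_of_adj {x y : ℤ × ℤ} (h : triLattice.Adj x y) :
    ∃ f : TriFace, f.HasVertex x ∧ f.HasVertex y := by
  have key : ∀ x y : ℤ × ℤ, x.1 ≤ y.1 ∧ y.1 ≤ x.1 + 1 ∧ x.2 ≤ y.2 ∧ y.2 ≤ x.2 + 1 →
      ∃ f : TriFace, f.HasVertex x ∧ f.HasVertex y := by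
    rintro ⟨a, b⟩ ⟨c, d⟩ h
    simp only at h
    by_cases e : d = b
    · refine ⟨((a, b), false), Or.inl rfl, ?_⟩
      simp only [TriFace.HasVertex, Prod.mk.injEq, true_and, Bool.false_eq_true, false_and]
      omega
    · refine ⟨((a, b), true), Or.inl rfl, ?_⟩
      simp only [TriFace.HasVertex, Prod.mk.injEq, true_and, Bool.true_eq_false, false_and]
      omega
  rcases h.2 with h | h
  · exact key _ _ h
  · obtain ⟨f, h1, h2⟩ := key _ _ h
    exact ⟨f, h2, h1⟩

lemma TriFace.adj_of_hasVertex {f : TriFace} {x y : ℤ × ℤ} (hx : f.HasVertex x)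
    (hy : f.HasVertex y) (hne : x ≠ y) : triLattice.Adj x y := by
  refine ⟨hne, ?_⟩
  obtain ⟨⟨k, l⟩, t⟩ := f
  obtain ⟨x1, x2⟩ := x
  obtain ⟨y1, y2⟩ := y
  simp only [HasVertex, Prod.mk.injEq] at hx hy
  cases t <;> simp only [true_and, false_and, Bool.true_eq_false, Bool.false_eq_true,
    or_false, false_or] at hx hy <;> simp only <;> omega

/-- The faces at the vertices of a connected set avoiding the edges `z` lie on the same side. -/
lemma IsFilling.eq_of_connIn {z : ℤ × ℤ → ℤ × ℤ → ZMod 2} {s : TriFace → ZMod 2}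
    (h : IsFilling z s) {D : Set (ℤ × ℤ)} (hD : triLattice.ConnIn D)
    (hz : ∀ v ∈ D, ∀ w, z v w = 0 ∧ z w v = 0) {f g : TriFace} {x y : ℤ × ℤ} (hx : x ∈ D)
    (hy : y ∈ D) (hf : f.HasVertex x) (hg : g.HasVertex y) : s f = s g := by
  obtain ⟨p, hp⟩ := hD x hx y hy
  clear hx hy
  induction p generalizing f with
  | nil => exact h.eq_at_vertex _ (hz _ (hp _ (by simp))) f g hf hg
  | @cons u v w ha p ih =>
    obtain ⟨k, hk1, hk2⟩ := exists_face_of_adj ha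
    rw [h.eq_at_vertex _ (hz _ (hp _ (by simp))) f k hf hk1]
    exact ih hk2 hg fun z hz => hp z (by simp [hz])

lemma TriFace.hasVertex_iff {f : TriFace} {a b c : ℤ × ℤ} (ha : f.HasVertex a)
    (hb : f.HasVertex b) (hc : f.HasVertex c) (hab : a ≠ b) (hbc : b ≠ c) (hca : c ≠ a)
    (x : ℤ × ℤ) : f.HasVertex x ↔ x = a ∨ x = b ∨ x = c := by
  constructor
  · obtain ⟨⟨k, l⟩, t⟩ := f
    simp only [HasVertex] at ha hb hc ⊢
    cases t <;> simp only [true_and, false_and, Bool.true_eq_false, Bool.false_eq_true,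
      or_false, false_or] at ha hb hc ⊢ <;> grind
  · rintro (rfl | rfl | rfl) <;> assumption

open Classical in
lemma TriFace.pairInd_add {f : TriFace} {a b c : ℤ × ℤ} (ha : f.HasVertex a) (hb : f.HasVertex b)
    (hc : f.HasVertex c) (hab : a ≠ b) (hbc : b ≠ c) (hca : c ≠ a) (x y : ℤ × ℤ) :
    pairInd a b x y + (pairInd b c x y + pairInd c a x y) =
      if x ≠ y ∧ f.HasVertex x ∧ f.HasVertex y then 1 else 0 := by
  have key := hasVertex_iff ha hb hc hab hbc hca
  simp only [key, pairInd]
  by_cases h1 : x = a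
  · subst h1
    by_cases h2 : y = b
    · subst h2; simp [hab, hbc.symm, hca.symm, hab.symm, hbc, hca]
    · by_cases h3 : y = c
      · subst h3; simp [hab, hbc.symm, hca.symm, hab.symm, hbc, hca]
      · grind
  · by_cases h2 : x = b
    · subst h2
      by_cases h2 : y = a
      · subst h2; simp [hab, hbc.symm, hca.symm, hab.symm, hbc, hca]
      · by_cases h3 : y = c
        · subst h3; simp [hab, hbc.symm, hca.symm, hab.symm, hbc, hca]
        · grind
    · by_cases h3 : x = c
      · subst h3
        by_cases h2 : y = a
        · subst h2; simp [hab, hbc.symm, hca.symm, hab.symm, hbc, hca]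
        · by_cases h3 : y = b
          · subst h3; simp [hab, hbc.symm, hca.symm, hab.symm, hbc, hca]
          · grind
      · grind

/-- The boundary of a single face. -/
lemma TriFace.isFilling_pairInd {f : TriFace} {a b c : ℤ × ℤ} (ha : f.HasVertex a)
    (hb : f.HasVertex b) (hc : f.HasVertex c) (hab : a ≠ b) (hbc : b ≠ c) (hca : c ≠ a) :
    IsFilling (fun x y => pairInd a b x y + (pairInd b c x y + pairInd c a x y))
      (fun g => if g = f then 1 else 0) := by
  intro i j
  simp only [pairInd_add ha hb hc hab hbc hca]
  obtain ⟨⟨k, l⟩, t⟩ := f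
  simp only [HasVertex, Prod.mk.injEq, ne_eq]
  clear ha hb hc
  cases t <;> simp only [true_and, false_and, Bool.true_eq_false, Bool.false_eq_true, and_true,
    and_false, or_false, false_or, if_false, false_and] <;> refine ⟨?_, ?_, ?_⟩ <;>
    split_ifs <;> first | rfl | (exfalso; omega)

/-- The sum of an edge function over the boundary of a face. -/
def TriFace.bdrySum (α : ℤ × ℤ → ℤ × ℤ → ZMod 2) (f : TriFace) : ZMod 2 :=
  if f.2 then α (f.1.1, f.1.2 + 1) (f.1.1 + 1, f.1.2 + 1) + α f.1 (f.1.1, f.1.2 + 1) +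
    α f.1 (f.1.1 + 1, f.1.2 + 1)
  else α f.1 (f.1.1 + 1, f.1.2) + α (f.1.1 + 1, f.1.2) (f.1.1 + 1, f.1.2 + 1) +
    α f.1 (f.1.1 + 1, f.1.2 + 1)

lemma finsum_pairInd {α : ℤ × ℤ → ℤ × ℤ → ZMod 2} (hs : ∀ x y, α x y = α y x) {x y : ℤ × ℤ}
    (h : triLattice.Adj x y) :
    (∑ᶠ e : ℤ × ℤ, pairInd x y e (e.1 + 1, e.2) * α e (e.1 + 1, e.2)) +
    (∑ᶠ e : ℤ × ℤ, pairInd x y e (e.1, e.2 + 1) * α e (e.1, e.2 + 1)) +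
    (∑ᶠ e : ℤ × ℤ, pairInd x y e (e.1 + 1, e.2 + 1) * α e (e.1 + 1, e.2 + 1)) = α x y := by
  have h0 : ∀ (g β : ℤ × ℤ → ZMod 2), (∀ e, g e = 0) → ∑ᶠ e, g e * β e = 0 := fun g β hg => by
    simp [hg]
  have h1 : ∀ (g β : ℤ × ℤ → ZMod 2) (a : ℤ × ℤ), (∀ e, e ≠ a → g e = 0) → g a = 1 →
      ∑ᶠ e, g e * β e = β a := fun g β a hg ha => by
    rw [finsum_eq_single _ a fun e he => by rw [hg e he, zero_mul], ha, one_mul]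
  refine triLattice_cases (P := fun x y =>
    (∑ᶠ e : ℤ × ℤ, pairInd x y e (e.1 + 1, e.2) * α e (e.1 + 1, e.2)) +
    (∑ᶠ e : ℤ × ℤ, pairInd x y e (e.1, e.2 + 1) * α e (e.1, e.2 + 1)) +
    (∑ᶠ e : ℤ × ℤ, pairInd x y e (e.1 + 1, e.2 + 1) * α e (e.1 + 1, e.2 + 1)) = α x y)
    (fun x y h => ?_) (fun i j => ?_) (fun i j => ?_) (fun i j => ?_) h
  · simp only [pairInd_swap x y]
    rw [h, hs]
  · rw [h1 _ _ (i, j), h0, h0, add_zero, add_zero]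
    all_goals
      first | rintro ⟨e1, e2⟩ he | rintro ⟨e1, e2⟩ | skip
      simp only [pairInd, Prod.mk.injEq, ne_eq] at *
      split_ifs <;> first | rfl | (exfalso; omega) | simp_all
  · rw [h0, h1 _ _ (i, j), h0, zero_add, add_zero]
    all_goals
      first | rintro ⟨e1, e2⟩ he | rintro ⟨e1, e2⟩ | skip
      simp only [pairInd, Prod.mk.injEq, ne_eq] at *
      split_ifs <;> first | rfl | (exfalso; omega) | simp_all
  · rw [h0, h0, h1 _ _ (i, j), zero_add, zero_add]
    all_goals
      first | rintro ⟨e1, e2⟩ he | rintro ⟨e1, e2⟩ | skip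
      simp only [pairInd, Prod.mk.injEq, ne_eq] at *
      split_ifs <;> first | rfl | (exfalso; omega) | simp_all

lemma Function.HasFiniteSupport.const_mul {ι : Type*} {g : ι → ZMod 2} (hg : g.HasFiniteSupport)
    (c : ι → ZMod 2) : Function.HasFiniteSupport fun x => c x * g x :=
  Set.Finite.subset hg fun _ hx => right_ne_zero_of_mul hx

lemma finsum_edgeCount (r : ℤ × ℤ → ℤ × ℤ) {g : ℤ × ℤ → ZMod 2} (hg : g.HasFiniteSupport)
    {u v : ℤ × ℤ} (p : triLattice.Walk u v) :
    ∑ᶠ e, edgeCount p e (r e) * g e =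
      (p.darts.map fun d => ∑ᶠ e, pairInd d.fst d.snd e (r e) * g e).sum := by
  unfold edgeCount
  induction p.darts with
  | nil => simp
  | cons d l ih =>
    simp only [List.map_cons, List.sum_cons, add_mul]
    rw [finsum_add_distrib (hg.const_mul _) (hg.const_mul _), ih]

lemma IsFilling.sum_darts {α : ℤ × ℤ → ℤ × ℤ → ZMod 2} (hs : ∀ x y, α x y = α y x)
    (f1 : Function.HasFiniteSupport fun e : ℤ × ℤ => α e (e.1 + 1, e.2))
    (f2 : Function.HasFiniteSupport fun e : ℤ × ℤ => α e (e.1, e.2 + 1))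
    (f3 : Function.HasFiniteSupport fun e : ℤ × ℤ => α e (e.1 + 1, e.2 + 1))
    {u : ℤ × ℤ} {p : triLattice.Walk u u} {s : TriFace → ZMod 2} (h : IsFilling (edgeCount p) s) :
    (p.darts.map fun d => α d.fst d.snd).sum =
      ∑ᶠ e : ℤ × ℤ, (s (e, true) * TriFace.bdrySum α (e, true) +
        s (e, false) * TriFace.bdrySum α (e, false)) := by
  have e0 : (p.darts.map fun d => α d.fst d.snd).sum =
      ∑ᶠ e : ℤ × ℤ, edgeCount p e (e.1 + 1, e.2) * α e (e.1 + 1, e.2) +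
      ∑ᶠ e : ℤ × ℤ, edgeCount p e (e.1, e.2 + 1) * α e (e.1, e.2 + 1) +
      ∑ᶠ e : ℤ × ℤ, edgeCount p e (e.1 + 1, e.2 + 1) * α e (e.1 + 1, e.2 + 1) := by
    rw [finsum_edgeCount (fun e => (e.1 + 1, e.2)) f1, finsum_edgeCount (fun e => (e.1, e.2 + 1)) f2,
      finsum_edgeCount (fun e => (e.1 + 1, e.2 + 1)) f3, ← List.sum_map_add, ← List.sum_map_add]
    congr 1
    exact List.map_congr_left fun d _ => (finsum_pairInd hs d.adj).symm
  let up : ℤ × ℤ ≃ ℤ × ℤ := (Equiv.refl ℤ).prodCongr (Equiv.addRight 1)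
  let right : ℤ × ℤ ≃ ℤ × ℤ := (Equiv.addRight 1).prodCongr (Equiv.refl ℤ)
  have g1 : Function.HasFiniteSupport fun e : ℤ × ℤ => α (e.1, e.2 + 1) (e.1 + 1, e.2 + 1) :=
    f1.comp_of_injective up.injective
  have g2 : Function.HasFiniteSupport fun e : ℤ × ℤ => α (e.1 + 1, e.2) (e.1 + 1, e.2 + 1) :=
    f2.comp_of_injective right.injective
  have e1 : ∀ i j : ℤ, edgeCount p (i, j) (i + 1, j) = s ((i, j), false) + s ((i, j - 1), true) :=
    fun i j => by
      rw [(h i j).1]; linear_combination - zmod_two_add_self (s ((i, j - 1), true))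
  have e2 : ∀ i j : ℤ, edgeCount p (i, j) (i, j + 1) = s ((i, j), true) + s ((i - 1, j), false) :=
    fun i j => by
      rw [(h i j).2.1]; linear_combination - zmod_two_add_self (s ((i - 1, j), false))
  have e3 : ∀ i j : ℤ, edgeCount p (i, j) (i + 1, j + 1) = s ((i, j), true) + s ((i, j), false) :=
    fun i j => by
      rw [(h i j).2.2]; linear_combination - zmod_two_add_self (s ((i, j), false))
  have k1 : ∑ᶠ e : ℤ × ℤ, s (e, true) * α (e.1, e.2 + 1) (e.1 + 1, e.2 + 1) =
      ∑ᶠ e : ℤ × ℤ, s ((e.1, e.2 - 1), true) * α e (e.1 + 1, e.2) := by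
    refine Eq.trans (finsum_congr fun e => ?_) (finsum_comp_equiv up)
    simp [up, Prod.map]
  have k2 : ∑ᶠ e : ℤ × ℤ, s (e, false) * α (e.1 + 1, e.2) (e.1 + 1, e.2 + 1) =
      ∑ᶠ e : ℤ × ℤ, s ((e.1 - 1, e.2), false) * α e (e.1, e.2 + 1) := by
    refine Eq.trans (finsum_congr fun e => ?_) (finsum_comp_equiv right)
    simp [right, Prod.map]
  have A := fun (c : ℤ × ℤ → ZMod 2) => f1.const_mul c
  have B := fun (c : ℤ × ℤ → ZMod 2) => f2.const_mul c
  have C := fun (c : ℤ × ℤ → ZMod 2) => f3.const_mul c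
  have A' := fun (c : ℤ × ℤ → ZMod 2) => g1.const_mul c
  have B' := fun (c : ℤ × ℤ → ZMod 2) => g2.const_mul c
  have key : ∀ {a b c d e f : ℤ × ℤ → ZMod 2}, a.HasFiniteSupport → b.HasFiniteSupport →
      c.HasFiniteSupport → d.HasFiniteSupport → e.HasFiniteSupport → f.HasFiniteSupport →
      ∑ᶠ x, (a x + b x + c x + (d x + e x + f x)) =
        ∑ᶠ x, a x + ∑ᶠ x, b x + ∑ᶠ x, c x + (∑ᶠ x, d x + ∑ᶠ x, e x + ∑ᶠ x, f x) := by
    intro a b c d e f ha hb hc hd he hf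
    refine (finsum_add_distrib ((ha.add hb).add hc) ((hd.add he).add hf)).trans ?_
    refine congrArg₂ (· + ·) ((finsum_add_distrib (ha.add hb) hc).trans ?_)
      ((finsum_add_distrib (hd.add he) hf).trans ?_)
    · exact congrArg (· + _) (finsum_add_distrib ha hb)
    · exact congrArg (· + _) (finsum_add_distrib hd he)
  rw [e0]
  simp only [TriFace.bdrySum, if_true, Bool.false_eq_true, if_false, mul_add, e1, e2, e3, add_mul]
  refine Eq.trans (congrArg₂ (· + ·) (congrArg₂ (· + ·) (finsum_add_distrib (A _) (A _))
    (finsum_add_distrib (B _) (B _))) (finsum_add_distrib (C _) (C _)))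
    (Eq.trans ?_ (key (A' _) (B _) (C _) (A _) (B' _) (C _)).symm)
  rw [k1, k2]
  ring

open Classical in
/-- Indicator of the edges between `A` and `B`. -/
noncomputable def setInd (A B : Set (ℤ × ℤ)) (x y : ℤ × ℤ) : ZMod 2 :=
  if (x ∈ A ∧ y ∈ B) ∨ (x ∈ B ∧ y ∈ A) then 1 else 0

lemma setInd_comm (A B : Set (ℤ × ℤ)) (x y : ℤ × ℤ) : setInd A B x y = setInd A B y x := by
  unfold setInd
  congr 1
  exact propext (by tauto)

lemma hasFiniteSupport_setInd {A B : Set (ℤ × ℤ)} (hA : A.Finite) {r : ℤ × ℤ → ℤ × ℤ}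
    (hr : r.Injective) : Function.HasFiniteSupport fun e => setInd A B e (r e) := by
  refine Set.Finite.subset (hA.union (hA.preimage hr.injOn)) fun e he => ?_
  simp only [setInd, Function.mem_support, ne_eq, ite_eq_right_iff, not_forall] at he
  obtain ⟨(h | h), -⟩ := he
  · exact Or.inl h.1
  · exact Or.inr h.2

lemma TriFace.exists_of_bdrySum_ne_zero {A B : Set (ℤ × ℤ)} (hAB : Disjoint A B) {f : TriFace}
    (h : f.bdrySum (setInd A B) ≠ 0) : ∃ a ∈ A, ∃ b ∈ B, ∃ c, c ∉ A ∧ c ∉ B ∧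
      f.HasVertex a ∧ f.HasVertex b ∧ f.HasVertex c := by
  have key : ∀ x y z, setInd A B x y + setInd A B y z + setInd A B x z ≠ 0 → f.HasVertex x →
      f.HasVertex y → f.HasVertex z → ∃ a ∈ A, ∃ b ∈ B, ∃ c, c ∉ A ∧ c ∉ B ∧
      f.HasVertex a ∧ f.HasVertex b ∧ f.HasVertex c := by
    intro x y z h hx hy hz
    have hd := Set.disjoint_left.1 hAB
    have t : (1 : ZMod 2) + 1 = 0 := rfl
    simp only [setInd] at h
    by_cases xA : x ∈ A <;> by_cases yA : y ∈ A <;> by_cases zA : z ∈ A <;>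
    by_cases xB : x ∈ B <;> by_cases yB : y ∈ B <;> by_cases zB : z ∈ B <;>
    first
    | exact absurd xB (hd xA)
    | exact absurd yB (hd yA)
    | exact absurd zB (hd zA)
    | (exfalso; simp [xA, yA, zA, xB, yB, zB, t] at h; done)
    | grind
  obtain ⟨⟨i, j⟩, t⟩ := f
  cases t
  · refine key (i, j) (i + 1, j) (i + 1, j + 1) ?_ ?_ ?_ ?_
    · simpa [bdrySum] using h
    all_goals simp [HasVertex]
  · refine key (i, j) (i, j + 1) (i + 1, j + 1) ?_ ?_ ?_ ?_
    · simp only [bdrySum, if_true] at h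
      rwa [add_comm (setInd A B (i, j) _)]
    all_goals simp [HasVertex]

lemma IsFilling.exists_face {A B : Set (ℤ × ℤ)} (hA : A.Finite) (hAB : Disjoint A B)
    {u : ℤ × ℤ} {p : triLattice.Walk u u} {s : TriFace → ZMod 2} (h : IsFilling (edgeCount p) s)
    (hp : (p.darts.map fun d => setInd A B d.fst d.snd).sum ≠ 0) :
    ∃ f, s f ≠ 0 ∧ ∃ a ∈ A, ∃ b ∈ B, ∃ c, c ∉ A ∧ c ∉ B ∧
      f.HasVertex a ∧ f.HasVertex b ∧ f.HasVertex c := by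
  rw [h.sum_darts (setInd_comm A B)] at hp
  · obtain ⟨e, he⟩ : ∃ e : ℤ × ℤ, s (e, true) * TriFace.bdrySum (setInd A B) (e, true) +
        s (e, false) * TriFace.bdrySum (setInd A B) (e, false) ≠ 0 := by
      by_contra! h0
      exact hp (by simp [h0])
    by_cases h1 : s (e, true) * TriFace.bdrySum (setInd A B) (e, true) = 0
    · rw [h1, zero_add] at he
      exact ⟨_, left_ne_zero_of_mul he, TriFace.exists_of_bdrySum_ne_zero hAB
        (right_ne_zero_of_mul he)⟩
    · exact ⟨_, left_ne_zero_of_mul h1, TriFace.exists_of_bdrySum_ne_zero hAB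
        (right_ne_zero_of_mul h1)⟩
  all_goals
    refine hasFiniteSupport_setInd hA fun x y hxy => ?_
    simpa [Prod.ext_iff] using hxy

namespace SimpleGraph

variable {V : Type*} {G : SimpleGraph V} {s t : Set V}

lemma SetAdj.symm (h : G.SetAdj s t) : G.SetAdj t s := by
  obtain ⟨x, hx, y, hy, h⟩ := h
  exact ⟨y, hy, x, hx, h.symm⟩

lemma SetAdj.mono {s' t' : Set V} (h : G.SetAdj s t) (hs : s ⊆ s') (ht : t ⊆ t') :
    G.SetAdj s' t' := by
  obtain ⟨x, hx, y, hy, h⟩ := h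
  exact ⟨x, hs hx, y, ht hy, h⟩

lemma ConnIn.singleton (x : V) : G.ConnIn {x} := by
  rintro _ rfl _ rfl
  exact ⟨.nil, by simp⟩

lemma ConnIn.of_center {c : V} (h : ∀ x ∈ s, ∃ p : G.Walk x c, ∀ z ∈ p.support, z ∈ s) :
    G.ConnIn s := by
  intro x hx y hy
  obtain ⟨p, hp⟩ := h x hx
  obtain ⟨q, hq⟩ := h y hy
  refine ⟨p.append q.reverse, fun z hz => ?_⟩
  rw [Walk.mem_support_append_iff, Walk.support_reverse, List.mem_reverse] at hz
  exact hz.elim (hp z) (hq z)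

lemma ConnIn.union_of_mem (hs : G.ConnIn s) (ht : G.ConnIn t) {c : V} (hcs : c ∈ s)
    (hct : c ∈ t) : G.ConnIn (s ∪ t) := by
  refine .of_center (c := c) ?_
  rintro x (hx | hx)
  · obtain ⟨p, hp⟩ := hs x hx c hcs
    exact ⟨p, fun z hz => Or.inl (hp z hz)⟩
  · obtain ⟨p, hp⟩ := ht x hx c hct
    exact ⟨p, fun z hz => Or.inr (hp z hz)⟩

lemma ConnIn.pair {x y : V} (h : G.Adj x y) : G.ConnIn {x, y} := by
  refine .of_center (c := y) ?_
  rintro z (rfl | rfl)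
  · exact ⟨.cons h .nil, by simp⟩
  · exact ⟨.nil, by simp⟩

lemma ConnIn.union (hs : G.ConnIn s) (ht : G.ConnIn t) (h : G.SetAdj s t) :
    G.ConnIn (s ∪ t) := by
  obtain ⟨x, hx, y, hy, h⟩ := h
  have h1 := (hs.union_of_mem (ConnIn.pair h) hx (by simp)).union_of_mem ht (c := y) (by simp) hy
  convert h1 using 1
  ext z
  simp only [Set.mem_union, Set.mem_insert_iff, Set.mem_singleton_iff]
  constructor
  · tauto
  · rintro ((h | rfl | rfl) | h) <;> tauto

end SimpleGraph

lemma edgeCount_cons {u v w : ℤ × ℤ} (h : triLattice.Adj u v) (p : triLattice.Walk v w)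
    (x y : ℤ × ℤ) : edgeCount (.cons h p) x y = pairInd u v x y + edgeCount p x y := by
  simp [edgeCount]

lemma edgeCount_append {u v w : ℤ × ℤ} (p : triLattice.Walk u v) (q : triLattice.Walk v w)
    (x y : ℤ × ℤ) : edgeCount (p.append q) x y = edgeCount p x y + edgeCount q x y := by
  simp [edgeCount]

lemma edgeCount_reverse {u v : ℤ × ℤ} (p : triLattice.Walk u v) (x y : ℤ × ℤ) :
    edgeCount p.reverse x y = edgeCount p x y := by
  simp only [edgeCount, SimpleGraph.Walk.darts_reverse, List.map_reverse, List.sum_reverse,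
    List.map_map]
  congr 1
  refine List.map_congr_left fun d _ => ?_
  simp [pairInd_swap]

lemma edgeCount_eq_zero {u v w x : ℤ × ℤ} {p : triLattice.Walk u v} (h : w ∉ p.support) :
    edgeCount p w x = 0 ∧ edgeCount p x w = 0 := by
  constructor <;>
  · refine List.sum_eq_zero fun z hz => ?_
    obtain ⟨d, hd, rfl⟩ := List.mem_map.1 hz
    have h1 : d.fst ≠ w := fun e => h (e ▸ p.dart_fst_mem_support_of_mem_darts hd)
    have h2 : d.snd ≠ w := fun e => h (e ▸ p.dart_snd_mem_support_of_mem_darts hd)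
    simp [pairInd, h1, h2]

lemma exists_hasVertex (v : ℤ × ℤ) : ∃ f : TriFace, f.HasVertex v := ⟨(v, true), Or.inl rfl⟩

/-- At most one face has its corners in three given connected sets, if each of them is joined
to a set disjoint from them. -/
lemma TriFace.eq_of_corners {A B C D : Set (ℤ × ℤ)} (hA : triLattice.ConnIn A)
    (hB : triLattice.ConnIn B) (hC : triLattice.ConnIn C) (hAB : Disjoint A B)
    (hBC : Disjoint B C) (hCA : Disjoint C A) (hAD : Disjoint A D) (hBD : Disjoint B D)
    (hCD : Disjoint C D) (cA : triLattice.ConnIn (A ∪ D)) (cB : triLattice.ConnIn (B ∪ D))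
    (cC : triLattice.ConnIn (C ∪ D)) (hD : D.Nonempty) {f g : TriFace} {a a' b b' c c' : ℤ × ℤ}
    (ha : a ∈ A) (ha' : a' ∈ A) (hb : b ∈ B) (hb' : b' ∈ B) (hc : c ∈ C) (hc' : c' ∈ C)
    (fa : f.HasVertex a) (fb : f.HasVertex b) (fc : f.HasVertex c)
    (ga : g.HasVertex a') (gb : g.HasVertex b') (gc : g.HasVertex c') : f = g := by
  by_contra hfg
  have ne : ∀ {X Y : Set (ℤ × ℤ)} {x y : ℤ × ℤ}, Disjoint X Y → x ∈ X → y ∈ Y → x ≠ y :=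
    fun h hx hy e => Set.disjoint_left.1 h hx (e ▸ hy)
  obtain ⟨v, hv⟩ := hD
  obtain ⟨k, kv⟩ := exists_hasVertex v
  obtain ⟨P, hP⟩ := hA a ha a' ha'
  obtain ⟨Q, hQ⟩ := hB b hb b' hb'
  obtain ⟨R, hR⟩ := hC c hc c' hc'
  have key : ∀ {X Y Z : Set (ℤ × ℤ)} {x x' y y' z : ℤ × ℤ} (U : triLattice.Walk x x')
      (W : triLattice.Walk y y'), (∀ w ∈ U.support, w ∈ X) → (∀ w ∈ W.support, w ∈ Y) →
      Disjoint X Y → Disjoint X Z → Disjoint Y Z → Disjoint X D → Disjoint Y D →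
      triLattice.ConnIn (Z ∪ D) → z ∈ Z → f.HasVertex x → f.HasVertex y → f.HasVertex z →
      g.HasVertex x' → g.HasVertex y' →
      ∃ s, IsFilling (fun p q => pairInd x y p q + pairInd y' x' p q + edgeCount U p q +
        edgeCount W p q) s ∧ s k = 0 ∧ s f = 0 := by
    intro X Y Z x x' y y' z U W hU hW dXY dXZ dYZ dXD dYD cZ hz fx fy fz gx gy
    have h1 := adj_of_hasVertex fx fy (ne dXY (hU _ U.start_mem_support) (hW _ W.start_mem_support))
    have h2 := adj_of_hasVertex gy gx
      (ne dXY (hU _ U.end_mem_support) (hW _ W.end_mem_support)).symm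
    obtain ⟨s, hs⟩ := exists_isFilling_edgeCount
      (.cons h1 (W.append (.cons h2 U.reverse)) : triLattice.Walk x x)
    have hz0 : ∀ w ∈ Z ∪ D, ∀ r,
        edgeCount (.cons h1 (W.append (.cons h2 U.reverse)) : triLattice.Walk x x) w r = 0 ∧
        edgeCount (.cons h1 (W.append (.cons h2 U.reverse)) : triLattice.Walk x x) r w = 0 := by
      intro w hw r
      refine edgeCount_eq_zero fun hm => ?_
      have : w ∈ X ∪ Y := by
        simp only [SimpleGraph.Walk.support_cons, List.mem_cons,
          SimpleGraph.Walk.mem_support_append_iff, SimpleGraph.Walk.support_reverse,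
          List.mem_reverse] at hm
        rcases hm with rfl | h | rfl | h
        · exact Or.inl (hU _ U.start_mem_support)
        · exact Or.inr (hW _ h)
        · exact Or.inr (hW _ W.end_mem_support)
        · exact Or.inl (hU _ h)
      rcases this with h | h <;> rcases hw with h' | h'
      · exact ne dXZ h h' rfl
      · exact ne dXD h h' rfl
      · exact ne dYZ h h' rfl
      · exact ne dYD h h' rfl
    have e := hs.eq_of_connIn cZ hz0 (f := f) (g := k) (Or.inl hz) (Or.inr hv) fz kv
    refine ⟨fun q => s q + s k, ?_, zmod_two_add_self _, ?_⟩
    · convert hs.add_const (s k) using 3 with p q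
      rw [edgeCount_cons, edgeCount_append, edgeCount_cons, edgeCount_reverse]
      ring
    · simp only [e]
      exact zmod_two_add_self _
  obtain ⟨s1, h1, h1k, h1f⟩ := key P Q hP hQ hAB hCA.symm hBC hAD hBD cC hc fa fb fc ga gb
  obtain ⟨s2, h2, h2k, h2f⟩ := key Q R hQ hR hBC hAB.symm hCA hBD hCD cA ha fb fc fa gb gc
  obtain ⟨s3, h3, h3k, h3f⟩ := key R P hR hP hCA hBC.symm hAB hCD hAD cB hb fc fa fb gc ga
  have hf := isFilling_pairInd fa fb fc (ne hAB ha hb) (ne hBC hb hc) (ne hCA hc ha)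
  have hg := isFilling_pairInd ga gb gc (ne hAB ha' hb') (ne hBC hb' hc') (ne hCA hc' ha')
  have kf : k ≠ f := by
    rintro rfl
    rcases (hasVertex_iff fa fb fc (ne hAB ha hb) (ne hBC hb hc) (ne hCA hc ha) v).1 kv with
      rfl | rfl | rfl
    · exact ne hAD ha hv rfl
    · exact ne hBD hb hv rfl
    · exact ne hCD hc hv rfl
  have kg : k ≠ g := by
    rintro rfl
    rcases (hasVertex_iff ga gb gc (ne hAB ha' hb') (ne hBC hb' hc') (ne hCA hc' ha') v).1 kv with
      rfl | rfl | rfl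
    · exact ne hAD ha' hv rfl
    · exact ne hBD hb' hv rfl
    · exact ne hCD hc' hv rfl
  have := ((((h1.add h2).add h3).add hf).add hg).eq_of_zero (fun p q => by
    rw [pairInd_swap a' b', pairInd_swap b' c', pairInd_swap c' a']
    have t := fun x : ZMod 2 => zmod_two_add_self x
    linear_combination t (pairInd a b p q) + t (pairInd b c p q) + t (pairInd c a p q) +
      t (pairInd a' b' p q) + t (pairInd b' c' p q) + t (pairInd c' a' p q) +
      t (edgeCount P p q) + t (edgeCount Q p q) + t (edgeCount R p q)) f k
  simp [h1k, h1f, h2k, h2f, h3k, h3f, hfg, kf, kg] at this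

lemma sum_darts_setInd_eq_zero {A B X : Set (ℤ × ℤ)} (h : Disjoint X A ∨ Disjoint X B)
    {u v : ℤ × ℤ} (p : triLattice.Walk u v) (hp : ∀ w ∈ p.support, w ∈ X) :
    (p.darts.map fun d => setInd A B d.fst d.snd).sum = 0 := by
  refine List.sum_eq_zero fun z hz => ?_
  obtain ⟨d, hd, rfl⟩ := List.mem_map.1 hz
  have h1 := hp _ (p.dart_fst_mem_support_of_mem_darts hd)
  have h2 := hp _ (p.dart_snd_mem_support_of_mem_darts hd)
  rcases h with h | h
  · simp [setInd, Set.disjoint_left.1 h h1, Set.disjoint_left.1 h h2]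
  · simp [setInd, Set.disjoint_left.1 h h1, Set.disjoint_left.1 h h2]

lemma setInd_eq_zero {A B C : Set (ℤ × ℤ)} (hBC : Disjoint B C) (hCA : Disjoint C A)
    {x y : ℤ × ℤ} (h : x ∈ C ∨ y ∈ C) : setInd A B x y = 0 := by
  have h1 := fun z (hz : z ∈ C) => Set.disjoint_left.1 hCA hz
  have h2 := fun z (hz : z ∈ C) => Set.disjoint_right.1 hBC hz
  rcases h with h | h <;> simp [setInd, h1 _ h, h2 _ h]

/-- A cyclic triple of connected sets contains a closed walk with exactly one edge between the
first two sets. -/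
lemma exists_walk_setInd {A B C : Set (ℤ × ℤ)} (hA : triLattice.ConnIn A)
    (hB : triLattice.ConnIn B) (hC : triLattice.ConnIn C) (hAB : Disjoint A B)
    (hBC : Disjoint B C) (hCA : Disjoint C A) (aAB : triLattice.SetAdj A B)
    (aBC : triLattice.SetAdj B C) (aCA : triLattice.SetAdj C A) :
    ∃ (u : ℤ × ℤ) (p : triLattice.Walk u u), (∀ w ∈ p.support, w ∈ A ∪ B ∪ C) ∧
      (p.darts.map fun d => setInd A B d.fst d.snd).sum ≠ 0 := by
  obtain ⟨a, ha, b, hb, h1⟩ := aAB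
  obtain ⟨b', hb', c, hc, h2⟩ := aBC
  obtain ⟨c', hc', a', ha', h3⟩ := aCA
  obtain ⟨P, hP⟩ := hA a' ha' a ha
  obtain ⟨Q, hQ⟩ := hB b hb b' hb'
  obtain ⟨R, hR⟩ := hC c hc c' hc'
  refine ⟨a, .cons h1 (Q.append (.cons h2 (R.append (.cons h3 P)))), ?_, ?_⟩
  · intro w hw
    simp only [SimpleGraph.Walk.support_cons, List.mem_cons,
      SimpleGraph.Walk.mem_support_append_iff] at hw
    rcases hw with rfl | h | rfl | h | rfl | h
    · exact Or.inl (Or.inl ha)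
    · exact Or.inl (Or.inr (hQ _ h))
    · exact Or.inl (Or.inr hb')
    · exact Or.inr (hR _ h)
    · exact Or.inr hc'
    · exact Or.inl (Or.inl (hP _ h))
  · have e1 : setInd A B a b = 1 := by simp [setInd, ha, hb]
    simp only [SimpleGraph.Walk.darts_cons, SimpleGraph.Walk.darts_append, List.map_cons,
      List.map_append, List.sum_cons, List.sum_append]
    rw [sum_darts_setInd_eq_zero (Or.inr hAB) P hP, sum_darts_setInd_eq_zero (Or.inl hAB.symm) Q hQ,
      sum_darts_setInd_eq_zero (Or.inl hCA) R hR, setInd_eq_zero hBC hCA (Or.inr hc),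
      setInd_eq_zero hBC hCA (Or.inl hc'), e1]
    decide

/-- The face has its corners in the three sets. -/
def TriFace.Meets (f : TriFace) (A B C : Set (ℤ × ℤ)) : Prop :=
  ∃ a ∈ A, ∃ b ∈ B, ∃ c ∈ C, f.HasVertex a ∧ f.HasVertex b ∧ f.HasVertex c

lemma TriFace.exists_meets {A B C : Set (ℤ × ℤ)} (hA : triLattice.ConnIn A)
    (hB : triLattice.ConnIn B) (hC : triLattice.ConnIn C) (hAB : Disjoint A B)
    (hBC : Disjoint B C) (hCA : Disjoint C A) (aAB : triLattice.SetAdj A B)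
    (aBC : triLattice.SetAdj B C) (aCA : triLattice.SetAdj C A) (hfin : A.Finite)
    (hD : triLattice.ConnIn (A ∪ B ∪ C)ᶜ) : ∃ f : TriFace, f.Meets A B C := by
  obtain ⟨u, p, hp, hsum⟩ := exists_walk_setInd hA hB hC hAB hBC hCA aAB aBC aCA
  obtain ⟨s, hs⟩ := exists_isFilling_edgeCount p
  by_cases hne : (A ∪ B ∪ C)ᶜ.Nonempty
  · obtain ⟨v, hv⟩ := hne
    obtain ⟨k, kv⟩ := exists_hasVertex v
    obtain ⟨f, hf, a, ha, b, hb, c, hcA, hcB, fa, fb, fc⟩ :=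
      (hs.add_const (s k)).exists_face hfin hAB hsum
    refine ⟨f, a, ha, b, hb, c, ?_, fa, fb, fc⟩
    by_contra hcC
    refine hf ?_
    rw [hs.eq_of_connIn hD (fun w hw _ => edgeCount_eq_zero fun hm => hw (hp w hm)) (x := c) (y := v)
      (f := f) (g := k) (by simp [hcA, hcB, hcC]) hv fc kv]
    exact zmod_two_add_self _
  · obtain ⟨f, hf, a, ha, b, hb, c, hcA, hcB, fa, fb, fc⟩ := hs.exists_face hfin hAB hsum
    refine ⟨f, a, ha, b, hb, c, ?_, fa, fb, fc⟩
    by_contra hcC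
    exact hne ⟨c, by simp [hcA, hcB, hcC]⟩

/-- If three connected sets cover the lattice, then two distinct faces have corners in them. -/
lemma TriFace.exists_meets_pair {A B C : Set (ℤ × ℤ)} (hA : triLattice.ConnIn A)
    (hB : triLattice.ConnIn B) (hC : triLattice.ConnIn C) (hAB : Disjoint A B)
    (hBC : Disjoint B C) (hCA : Disjoint C A) (aAB : triLattice.SetAdj A B)
    (aBC : triLattice.SetAdj B C) (aCA : triLattice.SetAdj C A) (hfin : A.Finite)
    (hD : ∀ x, x ∈ A ∨ x ∈ B ∨ x ∈ C) :
    ∃ f g : TriFace, f ≠ g ∧ f.Meets A B C ∧ g.Meets A B C := by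
  obtain ⟨u, p, hp, hsum⟩ := exists_walk_setInd hA hB hC hAB hBC hCA aAB aBC aCA
  obtain ⟨s, hs⟩ := exists_isFilling_edgeCount p
  obtain ⟨f, hf, a, ha, b, hb, c, hcA, hcB, fa, fb, fc⟩ := hs.exists_face hfin hAB hsum
  obtain ⟨g, hg, a', ha', b', hb', c', hcA', hcB', ga, gb, gc⟩ :=
    (hs.add_const 1).exists_face hfin hAB hsum
  refine ⟨f, g, ?_, ⟨a, ha, b, hb, c, by have := hD c; tauto, fa, fb, fc⟩,
    ⟨a', ha', b', hb', c', by have := hD c'; tauto, ga, gb, gc⟩⟩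
  rintro rfl
  revert hf hg
  generalize s f = x
  revert x
  decide

/-- In a connected graph, disjoint connected sets extend to a partition into connected sets. -/
lemma SimpleGraph.exists_extension {V N : Type*} {G : SimpleGraph V} (hG : ∀ x y, G.Reachable x y)
    (B : N → Set V) (hd : ∀ a b x, x ∈ B a → x ∈ B b → a = b) (hc : ∀ a, G.ConnIn (B a))
    (hne : ∃ a, (B a).Nonempty) :
    ∃ q : V → N, (∀ a, ∀ x ∈ B a, q x = a) ∧ ∀ a, G.ConnIn (q ⁻¹' {a}) := by
  classical
  have h0 : ∀ x, ∃ n, ∃ (a : N) (b : V) (p : G.Walk x b), b ∈ B a ∧ p.length = n := by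
    intro x
    obtain ⟨a, b, hb⟩ := hne
    obtain ⟨p⟩ := hG x b
    exact ⟨_, a, b, p, hb, rfl⟩
  let d : V → ℕ := fun x => Nat.find (h0 x)
  have hd0 : ∀ x, d x = 0 → ∃ a, x ∈ B a := by
    intro x hx
    obtain ⟨a, b, p, hb, hp⟩ := Nat.find_spec (h0 x)
    rw [show Nat.find (h0 x) = 0 from hx] at hp
    obtain rfl := SimpleGraph.Walk.eq_of_length_eq_zero hp
    exact ⟨a, hb⟩
  have hdB : ∀ a, ∀ x ∈ B a, d x = 0 := fun a x hx =>
    (Nat.find_eq_zero (h0 x)).2 ⟨a, x, .nil, hx, rfl⟩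
  have hnext : ∀ x, ∃ y, d x ≠ 0 → G.Adj x y ∧ d y + 1 = d x := by
    intro x
    by_cases hx : d x = 0
    · exact ⟨x, fun h => (h hx).elim⟩
    obtain ⟨a, b, p, hb, hp⟩ := Nat.find_spec (h0 x)
    cases p with
    | nil => exact absurd hp.symm hx
    | @cons _ y _ h p =>
      refine ⟨y, fun _ => ⟨h, ?_⟩⟩
      have h1 : d y ≤ p.length := Nat.find_le ⟨a, b, p, hb, rfl⟩
      obtain ⟨a', b', p', hb', hp'⟩ := Nat.find_spec (h0 y)
      have h2 : d x ≤ (SimpleGraph.Walk.cons h p').length := Nat.find_le ⟨a', b', _, hb', rfl⟩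
      rw [SimpleGraph.Walk.length_cons] at h2 hp
      have h3 : d x = Nat.find (h0 x) := rfl
      have h4 : d y = Nat.find (h0 y) := rfl
      omega
  choose next hnext using hnext
  have hend : ∀ n x, d x = n → ∃ a, next^[n] x ∈ B a := by
    intro n
    induction n with
    | zero => exact fun x hx => hd0 x hx
    | succ n ih =>
      intro x hx
      have := (hnext x (by omega)).2
      exact ih (next x) (by omega)
  choose lab hlab using fun x => hend (d x) x rfl
  have hlabB : ∀ a, ∀ x ∈ B a, lab x = a := by
    intro a x hx
    have := hlab x
    rw [hdB a x hx] at this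
    exact hd _ _ x this hx
  have hlabn : ∀ x, d x ≠ 0 → lab (next x) = lab x := by
    intro x hx
    have h1 := hlab x
    have h2 := hlab (next x)
    rw [← (hnext x hx).2, Function.iterate_succ_apply] at h1
    exact hd _ _ _ h2 h1
  refine ⟨lab, hlabB, fun a => ?_⟩
  have hwalk : ∀ n x, d x = n → lab x = a → ∃ y ∈ B a, ∃ p : G.Walk x y,
      ∀ z ∈ p.support, lab z = a := by
    intro n
    induction n with
    | zero =>
      intro x hx hl
      obtain ⟨b, hb⟩ := hd0 x hx
      obtain rfl : b = a := (hlabB b x hb).symm.trans hl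
      exact ⟨x, hb, .nil, by simpa using hl⟩
    | succ n ih =>
      intro x hx hl
      have h1 := hnext x (by omega)
      obtain ⟨y, hy, p, hp⟩ := ih (next x) (by omega) (by rw [hlabn x (by omega), hl])
      refine ⟨y, hy, .cons h1.1 p, fun z hz => ?_⟩
      rw [SimpleGraph.Walk.support_cons, List.mem_cons] at hz
      rcases hz with rfl | hz
      · exact hl
      · exact hp z hz
  by_cases hBa : (B a).Nonempty
  · obtain ⟨c, hc'⟩ := hBa
    refine .of_center (c := c) fun x hx => ?_
    obtain ⟨y, hy, p, hp⟩ := hwalk _ x rfl hx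
    obtain ⟨r, hr⟩ := hc a y hy c hc'
    refine ⟨p.append r, fun z hz => ?_⟩
    rw [SimpleGraph.Walk.mem_support_append_iff] at hz
    exact hz.elim (hp z) fun h => hlabB a z (hr z h)
  · intro x hx
    obtain ⟨y, hy, -⟩ := hwalk _ x rfl hx
    exact (hBa ⟨y, hy⟩).elim

/-- The map `q` contracts the triangular lattice to a finite graph: its fibres are connected,
and finite with the exception of the fibre of `r`. -/
structure IsLatticeQuotient {N : Type*} (q : ℤ × ℤ → N) (r : N) : Prop where
  surjective : q.Surjective
  connIn : ∀ a, triLattice.ConnIn (q ⁻¹' {a})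
  finite : ∀ a, a ≠ r → (q ⁻¹' {a}).Finite

/-- The graph obtained from the triangular lattice by contracting the fibres of `q`. -/
def latticeQuotient {N : Type*} (q : ℤ × ℤ → N) : SimpleGraph N where
  Adj a b := a ≠ b ∧ ∃ x y, triLattice.Adj x y ∧ q x = a ∧ q y = b
  symm := ⟨fun _ _ ⟨h, x, y, h1, h2, h3⟩ => ⟨h.symm, y, x, h1.symm, h3, h2⟩⟩
  loopless := ⟨fun _ h => h.1 rfl⟩

lemma triLattice_reachable (x y : ℤ × ℤ) : triLattice.Reachable x y := by
  have h1 : ∀ i j : ℤ, triLattice.Reachable (i, j) (0, j) := fun i j => by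
    induction i using Int.induction_on with
    | zero => rfl
    | succ i ih =>
      refine SimpleGraph.Reachable.trans (SimpleGraph.Adj.reachable ?_) ih
      simp [triLattice]
    | pred i ih =>
      refine SimpleGraph.Reachable.trans (SimpleGraph.Adj.reachable ?_) ih
      simp [triLattice]
  have h2 : ∀ j : ℤ, triLattice.Reachable (0, j) (0, 0) := fun j => by
    induction j using Int.induction_on with
    | zero => rfl
    | succ i ih =>
      refine SimpleGraph.Reachable.trans (SimpleGraph.Adj.reachable ?_) ih
      simp [triLattice]
    | pred i ih =>
      refine SimpleGraph.Reachable.trans (SimpleGraph.Adj.reachable ?_) ih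
      simp [triLattice]
  exact ((h1 x.1 x.2).trans (h2 _)).trans ((h1 y.1 y.2).trans (h2 _)).symm

namespace IsLatticeQuotient

variable {N : Type*} {q : ℤ × ℤ → N} {r : N}

lemma connIn_preimage (hq : IsLatticeQuotient q r) {s : Set N}
    (hs : (latticeQuotient q).ConnIn s) : triLattice.ConnIn (q ⁻¹' s) := by
  have key : ∀ (a b : N) (p : (latticeQuotient q).Walk a b), (∀ z ∈ p.support, z ∈ s) →
      ∀ x y, q x = a → q y = b → ∃ p : triLattice.Walk x y, ∀ z ∈ p.support, q z ∈ s := by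
    intro a b p
    induction p with
    | @nil a =>
      intro hs' x y hx hy
      obtain ⟨p, hp'⟩ := hq.connIn a x hx y hy
      refine ⟨p, fun z hz => ?_⟩
      rw [show q z = a from hp' z hz]
      exact hs' a (by simp)
    | @cons a b c h p ih =>
      intro hs' x y hx hy
      have h' := h
      obtain ⟨-, x', y', hadj, hx', hy'⟩ := h'
      obtain ⟨p1, hp1⟩ := hq.connIn a x hx x' hx'
      obtain ⟨p2, hp2⟩ := ih (fun z hz => hs' z (by simp [hz])) y' y hy' hy
      refine ⟨p1.append (.cons hadj p2), fun z hz => ?_⟩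
      simp only [SimpleGraph.Walk.mem_support_append_iff, SimpleGraph.Walk.support_cons,
        List.mem_cons] at hz
      rcases hz with h | rfl | h
      · rw [show q z = a from hp1 z h]
        exact hs' a (by simp)
      · rw [hx']
        exact hs' a (by simp)
      · exact hp2 z h
  intro x hx y hy
  obtain ⟨p, hp⟩ := hs _ hx _ hy
  exact key _ _ p hp x y rfl rfl

lemma setAdj_preimage {s t : Set N} (h : (latticeQuotient q).SetAdj s t) :
    triLattice.SetAdj (q ⁻¹' s) (q ⁻¹' t) := by
  obtain ⟨a, ha, b, hb, -, x, y, hxy, rfl, rfl⟩ := h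
  exact ⟨x, ha, y, hb, hxy⟩

lemma finite_preimage [Finite N] (hq : IsLatticeQuotient q r) {s : Set N} (hs : r ∉ s) :
    (q ⁻¹' s).Finite := by
  have : q ⁻¹' s = ⋃ a ∈ s, q ⁻¹' {a} := by ext; simp
  rw [this]
  exact (Set.toFinite s).biUnion fun a ha => hq.finite a fun e => hs (e ▸ ha)

lemma reachable (hq : IsLatticeQuotient q r) (a b : N) : (latticeQuotient q).Reachable a b := by
  obtain ⟨x, rfl⟩ := hq.surjective a
  obtain ⟨y, rfl⟩ := hq.surjective b
  obtain ⟨p⟩ := triLattice_reachable x y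
  induction p with
  | nil => rfl
  | @cons x y z h p ih =>
    by_cases e : q x = q y
    · rwa [e]
    · exact SimpleGraph.Reachable.trans (SimpleGraph.Adj.reachable ⟨e, x, y, h, rfl, rfl⟩) ih

end IsLatticeQuotient

/-- The triangular lattice has no partition into five connected pairwise adjacent sets. -/
lemma triLattice_no_five {A B C D E : Set (ℤ × ℤ)} (hA : triLattice.ConnIn A)
    (hB : triLattice.ConnIn B) (hC : triLattice.ConnIn C) (hD : triLattice.ConnIn D)
    (hE : triLattice.ConnIn E) (dAB : Disjoint A B) (dAC : Disjoint A C) (dAD : Disjoint A D)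
    (dAE : Disjoint A E) (dBC : Disjoint B C) (dBD : Disjoint B D) (dBE : Disjoint B E)
    (dCD : Disjoint C D) (dCE : Disjoint C E) (dDE : Disjoint D E)
    (aAB : triLattice.SetAdj A B) (aAC : triLattice.SetAdj A C) (aAD : triLattice.SetAdj A D)
    (aAE : triLattice.SetAdj A E) (aBC : triLattice.SetAdj B C) (aBD : triLattice.SetAdj B D)
    (aBE : triLattice.SetAdj B E) (aCD : triLattice.SetAdj C D) (aCE : triLattice.SetAdj C E)
    (aDE : triLattice.SetAdj D E) (hfin : A.Finite)
    (hcov : ∀ x, x ∈ A ∨ x ∈ B ∨ x ∈ C ∨ x ∈ D ∨ x ∈ E) : False := by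
  have e1 : (A ∪ B ∪ C)ᶜ = D ∪ E := by
    ext x
    have := hcov x
    have h1 : x ∈ A → x ∉ D := fun h => Set.disjoint_left.1 dAD h
    have h2 : x ∈ A → x ∉ E := fun h => Set.disjoint_left.1 dAE h
    have h3 : x ∈ B → x ∉ D := fun h => Set.disjoint_left.1 dBD h
    have h4 : x ∈ B → x ∉ E := fun h => Set.disjoint_left.1 dBE h
    have h5 : x ∈ C → x ∉ D := fun h => Set.disjoint_left.1 dCD h
    have h6 : x ∈ C → x ∉ E := fun h => Set.disjoint_left.1 dCE h
    simp only [Set.mem_compl_iff, Set.mem_union]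
    grind
  have e2 : (A ∪ B ∪ D)ᶜ = C ∪ E := by
    ext x
    have := hcov x
    have h1 : x ∈ A → x ∉ C := fun h => Set.disjoint_left.1 dAC h
    have h2 : x ∈ A → x ∉ E := fun h => Set.disjoint_left.1 dAE h
    have h3 : x ∈ B → x ∉ C := fun h => Set.disjoint_left.1 dBC h
    have h4 : x ∈ B → x ∉ E := fun h => Set.disjoint_left.1 dBE h
    have h5 : x ∈ C → x ∉ D := fun h => Set.disjoint_left.1 dCD h
    have h6 : x ∈ D → x ∉ E := fun h => Set.disjoint_left.1 dDE h
    simp only [Set.mem_compl_iff, Set.mem_union]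
    grind
  obtain ⟨f, a, ha, b, hb, c, hc, fa, fb, fc⟩ := TriFace.exists_meets hA hB hC dAB dBC dAC.symm
    aAB aBC aAC.symm hfin (e1 ▸ hD.union hE aDE)
  obtain ⟨g, a', ha', b', hb', d, hd, ga, gb, gd⟩ := TriFace.exists_meets hA hB hD dAB dBD
    dAD.symm aAB aBD aAD.symm hfin (e2 ▸ hC.union hE aCE)
  obtain rfl : f = g := TriFace.eq_of_corners (C := C ∪ D) (D := E) hA hB (hC.union hD aCD) dAB
    (Set.disjoint_union_right.2 ⟨dBC, dBD⟩) (Set.disjoint_union_left.2 ⟨dAC.symm, dAD.symm⟩)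
    dAE dBE (Set.disjoint_union_left.2 ⟨dCE, dDE⟩) (hA.union hE aAE) (hB.union hE aBE)
    ((hC.union hD aCD).union hE (aDE.mono Set.subset_union_right subset_rfl))
    (by obtain ⟨_, _, y, hy, _⟩ := aAE; exact ⟨y, hy⟩) ha ha' hb hb' (Or.inl hc) (Or.inr hd)
    fa fb fc ga gb gd
  have ne : ∀ {X Y : Set (ℤ × ℤ)} {x y : ℤ × ℤ}, Disjoint X Y → x ∈ X → y ∈ Y → x ≠ y :=
    fun h hx hy e => Set.disjoint_left.1 h hx (e ▸ hy)
  rcases (TriFace.hasVertex_iff fa fb fc (ne dAB ha hb) (ne dBC hb hc) (ne dAC ha hc).symm d).1 gd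
    with rfl | rfl | rfl
  · exact ne dAD ha hd rfl
  · exact ne dBD hb hd rfl
  · exact ne dCD hc hd rfl

/-- A contraction of the triangular lattice has no five pairwise adjacent disjoint connected
sets. -/
lemma IsLatticeQuotient.no_five {N : Type*} [Finite N] {q : ℤ × ℤ → N} {r : N}
    (hq : IsLatticeQuotient q r) (S : Fin 5 → Set N) (hc : ∀ i, (latticeQuotient q).ConnIn (S i))
    (hd : ∀ i j, i ≠ j → Disjoint (S i) (S j))
    (ha : ∀ i j, i ≠ j → (latticeQuotient q).SetAdj (S i) (S j)) : False := by
  obtain ⟨e, he, hec⟩ := SimpleGraph.exists_extension hq.reachable S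
    (fun i j x hi hj => by_contra fun h => Set.disjoint_left.1 (hd i j h) hi hj) hc
    ⟨0, by obtain ⟨x, hx, -⟩ := ha 0 1 (by decide); exact ⟨x, hx⟩⟩
  let T : Fin 5 → Set (ℤ × ℤ) := fun i => q ⁻¹' (e ⁻¹' {i})
  have hT : ∀ i, triLattice.ConnIn (T i) := fun i => hq.connIn_preimage (hec i)
  have dT : ∀ i j, i ≠ j → Disjoint (T i) (T j) := fun i j h =>
    Set.disjoint_left.2 fun x hi hj => h (hi.symm.trans hj)
  have aT : ∀ i j, i ≠ j → triLattice.SetAdj (T i) (T j) := fun i j h =>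
    setAdj_preimage ((ha i j h).mono (he i) (he j))
  have fT : ∀ i, i ≠ e r → (T i).Finite := fun i h => hq.finite_preimage fun h' => h h'.symm
  have cT : ∀ x, ∃ i, x ∈ T i := fun x => ⟨e (q x), rfl⟩
  have key : ∀ a b c d f : Fin 5, [a, b, c, d, f].Nodup → a ≠ e r → False := by
    intro a b c d f hn ha
    simp only [List.nodup_cons, List.mem_cons, List.not_mem_nil, or_false, not_or,
      not_false_eq_true, List.nodup_nil, and_true] at hn
    obtain ⟨⟨h1, h2, h3, h4⟩, ⟨h5, h6, h7⟩, ⟨h8, h9⟩, h10⟩ := hn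
    refine triLattice_no_five (hT a) (hT b) (hT c) (hT d) (hT f) (dT _ _ h1) (dT _ _ h2)
      (dT _ _ h3) (dT _ _ h4) (dT _ _ h5) (dT _ _ h6) (dT _ _ h7) (dT _ _ h8) (dT _ _ h9)
      (dT _ _ h10) (aT _ _ h1) (aT _ _ h2) (aT _ _ h3) (aT _ _ h4) (aT _ _ h5) (aT _ _ h6)
      (aT _ _ h7) (aT _ _ h8) (aT _ _ h9) (aT _ _ h10) (fT a ha) fun x => ?_
    obtain ⟨i, hi⟩ := cT x
    have : i = a ∨ i = b ∨ i = c ∨ i = d ∨ i = f := by omega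
    rcases this with rfl | rfl | rfl | rfl | rfl <;> tauto
  by_cases h : e r = 0
  · exact key 1 0 2 3 4 (by decide) (by rw [h]; decide)
  · exact key 0 1 2 3 4 (by decide) fun e' => h e'.symm

lemma TriFace.exists_meets_pair_fin {S : Fin 3 → Set (ℤ × ℤ)} (hc : ∀ i, triLattice.ConnIn (S i))
    (hd : ∀ i j, i ≠ j → Disjoint (S i) (S j)) (ha : ∀ i j, i ≠ j → triLattice.SetAdj (S i) (S j))
    (hcov : ∀ x, ∃ i, x ∈ S i) {i : Fin 3} (hfin : (S i).Finite) :
    ∃ f g : TriFace, f ≠ g ∧ (∀ i, ∃ x ∈ S i, f.HasVertex x) ∧ ∀ i, ∃ x ∈ S i, g.HasVertex x := by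
  have n1 : i ≠ i + 1 := by clear hfin; revert i; decide
  have n2 : i + 1 ≠ i + 2 := by clear hfin n1; revert i; decide
  have n3 : i + 2 ≠ i := by clear hfin n1 n2; revert i; decide
  have hi : ∀ j, j = i ∨ j = i + 1 ∨ j = i + 2 := by
    clear hfin n1 n2 n3; revert i; decide
  obtain ⟨f, g, hfg, ⟨a, ha, b, hb, c, hc, fa, fb, fc⟩, ⟨a', ha', b', hb', c', hc', ga, gb, gc⟩⟩ :=
    exists_meets_pair (hc i) (hc (i + 1)) (hc (i + 2)) (hd _ _ n1) (hd _ _ n2) (hd _ _ n3)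
    (ha _ _ n1) (ha _ _ n2) (ha _ _ n3) hfin fun x => by
      obtain ⟨j, hj⟩ := hcov x
      rcases hi j with rfl | rfl | rfl <;> tauto
  refine ⟨f, g, hfg, fun j => ?_, fun j => ?_⟩
  · rcases hi j with rfl | rfl | rfl
    exacts [⟨a, ha, fa⟩, ⟨b, hb, fb⟩, ⟨c, hc, fc⟩]
  · rcases hi j with rfl | rfl | rfl
    exacts [⟨a', ha', ga⟩, ⟨b', hb', gb⟩, ⟨c', hc', gc⟩]

/-- A Sperner-type lemma: if a connected set `U` is surrounded by three pairwise adjacent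
connected sets, which are extended to connected sets covering `U`, then there is a triangle with
one vertex in each of the extended sets and at least one vertex in `U`. -/
lemma IsLatticeQuotient.exists_triangle {N : Type*} [Finite N] {q : ℤ × ℤ → N} {r : N}
    (hq : IsLatticeQuotient q r) {U : Set N} {P Q : Fin 3 → Set N}
    (hU : (latticeQuotient q).ConnIn U) (hP : ∀ i, (latticeQuotient q).ConnIn (P i))
    (hQ : ∀ i, (latticeQuotient q).ConnIn (Q i)) (dP : ∀ i j, i ≠ j → Disjoint (P i) (P j))
    (dQ : ∀ i j, i ≠ j → Disjoint (Q i) (Q j)) (dPU : ∀ i, Disjoint (P i) U)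
    (aP : ∀ i j, i ≠ j → (latticeQuotient q).SetAdj (P i) (P j))
    (aPU : ∀ i, (latticeQuotient q).SetAdj (P i) U)
    (hbd : ∀ u ∈ U, ∀ v, (latticeQuotient q).Adj u v → v ∈ U ∨ ∃ i, v ∈ P i)
    (hPQ : ∀ i, P i ⊆ Q i) (hQU : ∀ i, Q i ⊆ P i ∪ U) (hcov : ∀ u ∈ U, ∃ i, u ∈ Q i) :
    ∃ x : Fin 3 → N, (∀ i, x i ∈ Q i) ∧ (∀ i j, i ≠ j → (latticeQuotient q).Adj (x i) (x j)) ∧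
      ∃ i, x i ∈ U := by
  obtain ⟨e, he, hec⟩ := SimpleGraph.exists_extension hq.reachable
    (fun o : Option (Fin 3) => o.elim U P) (fun i j x hi hj => by
      rcases i with _ | i <;> rcases j with _ | j
      · rfl
      · exact (Set.disjoint_left.1 (dPU j) hj hi).elim
      · exact (Set.disjoint_left.1 (dPU i) hi hj).elim
      · exact congrArg some (by_contra fun h => Set.disjoint_left.1 (dP i j h) hi hj))
    (fun i => by rcases i with _ | i; exacts [hU, hP i])
    ⟨none, by obtain ⟨_, _, x, hx, -⟩ := aPU 0; exact ⟨x, hx⟩⟩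
  have heU : ∀ x, e x = none ↔ x ∈ U := by
    intro x
    refine ⟨fun hx => ?_, he none x⟩
    obtain ⟨_, _, u, hu, -⟩ := aPU 0
    obtain ⟨p, hp⟩ := hec none u (he none u hu) x hx
    clear hx
    induction p with
    | nil => exact hu
    | @cons u v w h p ih =>
      refine ih ?_ fun z hz => hp z (by simp [hz])
      rcases hbd u hu v h with h' | ⟨i, h'⟩
      · exact h'
      · have h1 : e v = none := hp v (by simp)
        rw [he (some i) v h'] at h1
        simp at h1
  have heP : ∀ i, ∀ x ∈ P i, e x = some i := fun i => he (some i)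
  let R : Fin 3 → Set N := fun i => e ⁻¹' {some i}
  have hPR : ∀ i, P i ⊆ R i := heP
  have dR : ∀ i j, i ≠ j → Disjoint (R i) (R j) := fun i j h =>
    Set.disjoint_left.2 fun x hi hj => h (Option.some.inj (hi.symm.trans hj))
  have dRU : ∀ i, Disjoint (R i) U := fun i => Set.disjoint_left.2 fun x hi hx => by
    have h1 : e x = some i := hi
    rw [(heU x).2 hx] at h1
    simp at h1
  let S : Fin 3 → Set N := fun i => R i ∪ Q i
  have hS : ∀ i, (latticeQuotient q).ConnIn (S i) := fun i => by
    obtain ⟨x, hx, -⟩ := aPU i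
    exact (hec (some i)).union_of_mem (hQ i) (hPR i hx) (hPQ i hx)
  have dS : ∀ i j, i ≠ j → Disjoint (S i) (S j) := by
    intro i j h
    refine Set.disjoint_left.2 fun x hi hj => ?_
    rcases hi with hi | hi <;> rcases hj with hj | hj
    · exact Set.disjoint_left.1 (dR i j h) hi hj
    · rcases hQU j hj with h' | h'
      · exact Set.disjoint_left.1 (dR i j h) hi (hPR j h')
      · exact Set.disjoint_left.1 (dRU i) hi h'
    · rcases hQU i hi with h' | h'
      · exact Set.disjoint_left.1 (dR j i h.symm) hj (hPR i h')
      · exact Set.disjoint_left.1 (dRU j) hj h'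
    · exact Set.disjoint_left.1 (dQ i j h) hi hj
  have cS : ∀ x, ∃ i, x ∈ S i := by
    intro x
    rcases h : e x with _ | i
    · obtain ⟨i, hi⟩ := hcov x ((heU x).1 h)
      exact ⟨i, Or.inr hi⟩
    · exact ⟨i, Or.inl h⟩
  obtain ⟨i₀, hi₀⟩ : ∃ i, r ∉ S i := by
    by_contra! h
    exact Set.disjoint_left.1 (dS 0 1 (by decide)) (h 0) (h 1)
  obtain ⟨f, g, hfg, hf, hg⟩ := TriFace.exists_meets_pair_fin (S := fun i => q ⁻¹' S i)
    (fun i => hq.connIn_preimage (hS i)) (fun i j h => (dS i j h).preimage q)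
    (fun i j h => setAdj_preimage ((aP i j h).mono ((hPR i).trans Set.subset_union_left)
      ((hPR j).trans Set.subset_union_left))) (fun x => cS (q x)) (hq.finite_preimage hi₀)
  choose x hx fx using hf
  choose y hy gy using hg
  have key : ∀ (k : TriFace) (z : Fin 3 → ℤ × ℤ), (∀ i, z i ∈ q ⁻¹' S i) →
      (∀ i, k.HasVertex (z i)) → ∀ i₁, q (z i₁) ∈ U →
      ∃ x : Fin 3 → N, (∀ i, x i ∈ Q i) ∧ (∀ i j, i ≠ j → (latticeQuotient q).Adj (x i) (x j)) ∧
      ∃ i, x i ∈ U := by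
    intro k z hz kz i₁ hi₁
    have hne : ∀ i j, i ≠ j → q (z i) ≠ q (z j) := fun i j h e' =>
      Set.disjoint_left.1 (dS i j h) (hz i) (by rw [e']; exact hz j)
    have hadj : ∀ i j, i ≠ j → (latticeQuotient q).Adj (q (z i)) (q (z j)) := fun i j h =>
      ⟨hne i j h, z i, z j, TriFace.adj_of_hasVertex (kz i) (kz j)
        fun e' => hne i j h (congrArg q e'), rfl, rfl⟩
    refine ⟨fun i => q (z i), fun i => ?_, hadj, i₁, hi₁⟩
    rcases hz i with h | h
    · have h' : q (z i) ∈ U ∨ ∃ j, q (z i) ∈ P j := by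
        by_cases e' : i = i₁
        · rw [e']
          exact Or.inl hi₁
        · exact hbd _ hi₁ _ (hadj i₁ i (Ne.symm e'))
      rcases h' with h' | ⟨j, h'⟩
      · exact (Set.disjoint_left.1 (dRU i) h h').elim
      · obtain rfl : i = j := by_contra fun e' => Set.disjoint_left.1 (dR i j e') h (hPR j h')
        exact hPQ i h'
    · exact h
  by_cases h1 : ∃ i, q (x i) ∈ U
  · exact key f x hx fx h1.choose h1.choose_spec
  by_cases h2 : ∃ i, q (y i) ∈ U
  · exact key g y hy gy h2.choose h2.choose_spec
  push Not at h1 h2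
  have hSR : ∀ i z, z ∈ S i → z ∉ U → z ∈ R i := by
    rintro i z (h | h) hz
    · exact h
    · exact (hQU i h).elim (fun h => hPR i h) fun h => (hz h).elim
  have cRU : ∀ i, triLattice.ConnIn (q ⁻¹' R i ∪ q ⁻¹' U) := fun i =>
    (hq.connIn_preimage (hec (some i))).union (hq.connIn_preimage hU)
      (setAdj_preimage ((aPU i).mono (hPR i) subset_rfl))
  refine (hfg (TriFace.eq_of_corners (hq.connIn_preimage (hec (some 0)))
    (hq.connIn_preimage (hec (some 1))) (hq.connIn_preimage (hec (some 2)))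
    ((dR 0 1 (by decide)).preimage q) ((dR 1 2 (by decide)).preimage q)
    ((dR 2 0 (by decide)).preimage q) ((dRU 0).preimage q) ((dRU 1).preimage q)
    ((dRU 2).preimage q) (cRU 0) (cRU 1) (cRU 2) ?_ (hSR 0 _ (hx 0) (h1 0)) (hSR 0 _ (hy 0) (h2 0))
    (hSR 1 _ (hx 1) (h1 1)) (hSR 1 _ (hy 1) (h2 1)) (hSR 2 _ (hx 2) (h1 2)) (hSR 2 _ (hy 2) (h2 2))
    (fx 0) (fx 1) (fx 2) (gy 0) (gy 1) (gy 2))).elim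
  obtain ⟨_, _, u, hu, -⟩ := aPU 0
  obtain ⟨w, rfl⟩ := hq.surjective u
  exact ⟨w, hu⟩

namespace SimpleGraph

variable {N : Type*} {K : SimpleGraph N} {d : N → ℕ} {par : N → N} {r : N}

lemma exists_bfs (hK : ∀ a b, K.Reachable a b) (r : N) :
    ∃ (d : N → ℕ) (par : N → N), (∀ v, v ≠ r → K.Adj v (par v) ∧ d (par v) + 1 = d v) ∧
      ∀ u v, K.Adj u v → d u ≤ d v + 1 := by
  have hd : ∀ u v, K.Adj u v → K.dist r u ≤ K.dist r v + 1 := fun u v h => by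
    obtain ⟨p, hp⟩ := (hK r v).exists_walk_length_eq_dist
    have := K.dist_le (p.append (.cons h.symm .nil))
    simpa [hp] using this
  have h : ∀ v, ∃ w, v ≠ r → K.Adj v w ∧ K.dist r w + 1 = K.dist r v := by
    intro v
    by_cases hv : v = r
    · exact ⟨v, fun h => (h hv).elim⟩
    obtain ⟨p, hp⟩ := (hK v r).exists_walk_length_eq_dist
    cases p with
    | nil => exact (hv rfl).elim
    | @cons _ w _ h p =>
      refine ⟨w, fun _ => ⟨h, le_antisymm ?_ (hd _ _ h)⟩⟩
      have h1 := K.dist_le p.reverse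
      rw [dist_comm (u := v)] at hp
      simp only [Walk.length_cons, Walk.length_reverse] at hp h1
      omega
  choose par hpar using h
  exact ⟨K.dist r, par, hpar, hd⟩

/-- Every vertex of `U` is joined to the complement of `U` by a vertical path; these paths can be
chosen consistently. -/
lemma exists_chains (hpar : ∀ v, v ≠ r → K.Adj v (par v) ∧ d (par v) + 1 = d v) {U : Set N}
    (hr : r ∉ U) (part : N → ℕ) :
    ∃ (col : N → ℕ) (C : N → Set N), ∀ u ∈ U, C u ⊆ U ∧ u ∈ C u ∧ K.ConnIn (C u) ∧
      (∃ x ∉ U, part x = col u ∧ ∃ y ∈ C u, K.Adj x y) ∧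
      (∀ x ∈ C u, ∀ y ∈ C u, d x = d y → x = y) ∧ ∀ w ∈ C u, col w = col u := by
  classical
  have hex : ∀ u, ∃ m, par^[m] u ∉ U := by
    intro u
    induction hn : d u using Nat.strong_induction_on generalizing u with
    | _ n ih =>
      by_cases hu : u = r
      · exact ⟨0, by simpa [hu] using hr⟩
      · obtain ⟨m, hm⟩ := ih (d (par u)) (by have := (hpar u hu).2; omega) (par u) rfl
        exact ⟨m + 1, hm⟩
  let col : N → ℕ := fun u => part (par^[Nat.find (hex u)] u)
  have hcol0 : ∀ u ∉ U, col u = part u := fun u hu => by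
    have : Nat.find (hex u) = 0 := (Nat.find_eq_zero _).2 hu
    simp [col, this]
  have hcol1 : ∀ u ∈ U, col u = col (par u) := fun u hu => by
    have h : Nat.find (hex u) = Nat.find (hex (par u)) + 1 :=
      Nat.find_comp_succ (hex u) (hex (par u)) (by simpa using hu)
    simp only [col, h, Function.iterate_succ_apply]
  have key : ∀ u, ∃ C : Set N, u ∈ U → C ⊆ U ∧ u ∈ C ∧ K.ConnIn C ∧
      (∃ x ∉ U, part x = col u ∧ ∃ y ∈ C, K.Adj x y) ∧
      (∀ x ∈ C, ∀ y ∈ C, d x = d y → x = y) ∧ (∀ w ∈ C, col w = col u) ∧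
      ∀ w ∈ C, d w ≤ d u := by
    intro u
    induction hn : d u using Nat.strong_induction_on generalizing u with
    | _ n ih =>
      subst hn
      by_cases hu : u ∈ U
      swap
      · exact ⟨∅, fun h => (hu h).elim⟩
      obtain ⟨h1, h2⟩ := hpar u fun e => hr (e ▸ hu)
      by_cases hp : par u ∈ U
      · obtain ⟨C, hC⟩ := ih (d (par u)) (by omega) (par u) rfl
        obtain ⟨c1, c2, c3, ⟨x, c4, c5, y, c6, c7⟩, c8, c9, c10⟩ := hC hp
        refine ⟨{u} ∪ C, fun _ => ⟨Set.union_subset (by simpa using hu) c1, Or.inl rfl,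
          (ConnIn.singleton u).union c3 ⟨u, rfl, par u, c2, h1⟩,
          ⟨x, c4, c5.trans (hcol1 u hu).symm, y, Or.inr c6, c7⟩, ?_, ?_, ?_⟩⟩
        · rintro x (rfl | hx) y (rfl | hy) hxy
          · rfl
          · have := c10 y hy
            omega
          · have := c10 x hx
            omega
          · exact c8 x hx y hy hxy
        · rintro w (rfl | hw)
          · rfl
          · exact (c9 w hw).trans (hcol1 u hu).symm
        · rintro w (rfl | hw)
          · rfl
          · have := c10 w hw
            omega
      · refine ⟨{u}, fun _ => ⟨by simpa using hu, rfl, ConnIn.singleton u,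
          ⟨par u, hp, by rw [hcol1 u hu, hcol0 _ hp], u, rfl, h1.symm⟩, ?_, ?_, ?_⟩⟩
        · rintro x rfl y rfl -
          rfl
        · rintro x rfl
          rfl
        · rintro x rfl
          rfl
  choose C hC using key
  refine ⟨col, C, fun u hu => ?_⟩
  obtain ⟨h1, h2, h3, h4, h5, h6, -⟩ := hC u hu
  exact ⟨h1, h2, h3, h4, h5, h6⟩

/-- The parts numbered less than `n` which are attached to `T` form a clique of size at most
three. -/
def CliqueAttached (K : SimpleGraph N) (part : N → ℕ) (T : Set N) (n : ℕ) : Prop :=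
  (∃ s : Finset ℕ, s.card ≤ 3 ∧ ∀ i < n, K.SetAdj (part ⁻¹' {i}) T → i ∈ s) ∧
    ∀ i < n, ∀ i' < n, K.SetAdj (part ⁻¹' {i}) T → K.SetAdj (part ⁻¹' {i'}) T → i ≠ i' →
      K.SetAdj (part ⁻¹' {i}) (part ⁻¹' {i'})

lemma CliqueAttached.mono {part : N → ℕ} {S T : Set N} {n : ℕ} (h : K.CliqueAttached part T n)
    (hST : S ⊆ T) : K.CliqueAttached part S n := by
  obtain ⟨⟨s, hs, h1⟩, h2⟩ := h
  exact ⟨⟨s, hs, fun i hi ha => h1 i hi (ha.mono subset_rfl hST)⟩, fun i hi i' hi' ha ha' =>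
    h2 i hi i' hi' (ha.mono subset_rfl hST) (ha'.mono subset_rfl hST)⟩

lemma CliqueAttached.congr {part part' : N → ℕ} {T : Set N} {n : ℕ}
    (h : K.CliqueAttached part T n) (hp : ∀ i < n, part' ⁻¹' {i} = part ⁻¹' {i}) :
    K.CliqueAttached part' T n := by
  obtain ⟨⟨s, hs, h1⟩, h2⟩ := h
  refine ⟨⟨s, hs, fun i hi ha => h1 i hi (hp i hi ▸ ha)⟩, fun i hi i' hi' ha ha' hne => ?_⟩
  rw [hp i hi] at ha ⊢
  rw [hp i' hi'] at ha' ⊢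
  exact h2 i hi i' hi' ha ha' hne

/-- A partial decomposition into parts `0, …, n - 1`, each consisting of at most three vertical
paths; the vertices with `part v = n` remain to be assigned. -/
structure IsTripodDecomposition (K : SimpleGraph N) (d : N → ℕ) (r : N) (n : ℕ) (part : N → ℕ)
    (idx : N → Fin 3) : Prop where
  le : ∀ v, part v ≤ n
  root : part r < n
  connIn : ∀ i < n, K.ConnIn (part ⁻¹' {i})
  inj : ∀ u v, part u < n → part u = part v → d u = d v → idx u = idx v → u = v
  part_attached : ∀ j < n, K.CliqueAttached part (part ⁻¹' {j}) j
  attached : ∀ U, K.ConnIn U → U ⊆ part ⁻¹' {n} → K.CliqueAttached part U n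

open Classical in
lemma isTripodDecomposition_root (K : SimpleGraph N) (d : N → ℕ) (r : N) :
    K.IsTripodDecomposition d r 1 (fun v => if v = r then 0 else 1) fun _ => 0 where
  le v := by split_ifs <;> omega
  root := by simp
  connIn i hi := by
    convert ConnIn.singleton r
    ext v
    simp only [Set.mem_preimage, Set.mem_singleton_iff]
    split_ifs with h <;> simp [h] <;> omega
  inj u v hu huv _ _ := by
    split_ifs at hu huv with h1 h2 h2
    · rw [h1, h2]
    all_goals omega
  part_attached j hj := by
    refine ⟨⟨∅, by simp, fun i hi => ?_⟩, fun i hi => ?_⟩ <;> omega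
  attached U _ _ := by
    refine ⟨⟨{0}, by simp, fun i hi _ => ?_⟩, fun i hi i' hi' => ?_⟩
    · simpa using hi
    · omega

/-- The component of `v` in the subgraph induced by `s`. -/
lemma exists_component (K : SimpleGraph N) (s : Set N) {v : N} (hv : v ∈ s) :
    ∃ U ⊆ s, v ∈ U ∧ K.ConnIn U ∧ ∀ T ⊆ s, K.ConnIn T → (∃ x ∈ U, x ∈ T ∨ ∃ y ∈ T, K.Adj x y) →
      T ⊆ U := by
  classical
  let U : Set N := {w | ∃ p : K.Walk w v, ∀ z ∈ p.support, z ∈ s}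
  have hU : ∀ w ∈ U, ∀ x (q : K.Walk x w), (∀ z ∈ q.support, z ∈ s) → x ∈ U := by
    rintro w ⟨p, hp⟩ x q hq
    refine ⟨q.append p, fun z hz => ?_⟩
    rw [Walk.mem_support_append_iff] at hz
    exact hz.elim (hq z) (hp z)
  have hvU : v ∈ U := ⟨.nil, by simpa using hv⟩
  have hUs : U ⊆ s := fun w ⟨p, hp⟩ => hp w (by simp)
  refine ⟨U, hUs, hvU, .of_center (c := v) ?_, ?_⟩
  · rintro x ⟨p, hp⟩
    refine ⟨p, fun z hz => ⟨p.dropUntil z hz, fun y hy => hp y ?_⟩⟩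
    exact p.support_dropUntil_subset_support hz hy
  · rintro T hT hc ⟨x, hx, h⟩ z hz
    obtain ⟨y, hy, hyU⟩ : ∃ y ∈ T, y ∈ U := by
      rcases h with h | ⟨y, hy, h⟩
      · exact ⟨x, h, hx⟩
      · refine ⟨y, hy, hU x hx y (.cons h.symm .nil) ?_⟩
        simp [hUs hx, hT hy]
    obtain ⟨q, hq⟩ := hc z hz y hy
    exact hU y hyU z q fun w hw => hT (hq w hw)

end SimpleGraph

namespace IsLatticeQuotient

variable {N : Type*} [Finite N] {q : ℤ × ℤ → N} {r : N}

/-- If at most three disjoint connected sets are attached to the connected set `U`, and `U` is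
shared out among them so that the extended sets are connected, then some clique meets all extended
sets and `U`. -/
lemma exists_clique (hq : IsLatticeQuotient q r) {ι : Type*} {U : Set N} {P Q : ι → Set N}
    {s : Finset ι} (hs0 : s.Nonempty) (hs : s.card ≤ 3) (hU : (latticeQuotient q).ConnIn U)
    (hne : U.Nonempty)
    (hP : ∀ i ∈ s, (latticeQuotient q).ConnIn (P i))
    (hQ : ∀ i ∈ s, (latticeQuotient q).ConnIn (Q i)) (dP : ∀ i j, i ≠ j → Disjoint (P i) (P j))
    (dQ : ∀ i j, i ≠ j → Disjoint (Q i) (Q j)) (dPU : ∀ i ∈ s, Disjoint (P i) U)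
    (aP : ∀ i ∈ s, ∀ j ∈ s, i ≠ j → (latticeQuotient q).SetAdj (P i) (P j))
    (aPU : ∀ i ∈ s, (latticeQuotient q).SetAdj (P i) U)
    (hbd : ∀ u ∈ U, ∀ v, (latticeQuotient q).Adj u v → v ∈ U ∨ ∃ i ∈ s, v ∈ P i)
    (hPQ : ∀ i, P i ⊆ Q i) (hQU : ∀ i, Q i ⊆ P i ∪ U) (hcov : ∀ u ∈ U, ∃ i ∈ s, u ∈ Q i) :
    ∃ x : Fin 3 → N, (∃ k, x k ∈ U) ∧ (∀ k l, (latticeQuotient q).LazyAdj (x k) (x l)) ∧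
      ∀ i ∈ s, ∃ k, x k ∈ Q i := by
  classical
  obtain ⟨u₀, hu₀⟩ := hne
  have hpair : ∀ a b : ι, s = {a, b} → ∀ u v, (latticeQuotient q).Adj u v → u ∈ Q a → v ∈ Q b →
      (u ∈ U ∨ v ∈ U) → ∃ x : Fin 3 → N, (∃ k, x k ∈ U) ∧
      (∀ k l, (latticeQuotient q).LazyAdj (x k) (x l)) ∧ ∀ i ∈ s, ∃ k, x k ∈ Q i := by
    intro a b hab u v huv ha hb hU'
    refine ⟨![u, v, v], ?_, ?_, ?_⟩
    · rcases hU' with h | h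
      exacts [⟨0, h⟩, ⟨1, h⟩]
    · intro k l
      fin_cases k <;> fin_cases l <;> simp [SimpleGraph.LazyAdj, huv, huv.symm]
    · intro i hi
      rw [hab, Finset.mem_insert, Finset.mem_singleton] at hi
      rcases hi with rfl | rfl
      exacts [⟨0, ha⟩, ⟨1, hb⟩]
  have h123 : s.card = 1 ∨ s.card = 2 ∨ s.card = 3 := by
    have := hs0.card_pos
    omega
  rcases h123 with h | h | h
  · obtain ⟨a, rfl⟩ := Finset.card_eq_one.1 h
    refine ⟨fun _ => u₀, ⟨0, hu₀⟩, fun _ _ => Or.inl rfl, fun i hi => ⟨0, ?_⟩⟩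
    obtain ⟨j, hj, hu⟩ := hcov u₀ hu₀
    rw [Finset.mem_singleton] at hi hj
    rwa [hi, ← hj]
  · obtain ⟨a, b, hab, rfl⟩ := Finset.card_eq_two.1 h
    have hcov' : ∀ u ∈ U, u ∈ Q a ∨ u ∈ Q b := by simpa using hcov
    obtain ⟨v, hv, u, hu, huv⟩ := aPU a (by simp)
    rcases hcov' u hu with hua | hub
    swap
    · exact hpair a b rfl v u huv (hPQ a hv) hub (Or.inr hu)
    obtain ⟨v', hv', u', hu', huv'⟩ := aPU b (by simp)
    rcases hcov' u' hu' with hua' | hub'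
    · exact hpair a b rfl u' v' huv'.symm hua' (hPQ b hv') (Or.inl hu')
    obtain ⟨p, hp⟩ := hU u hu u' hu'
    obtain ⟨e, he, h1, h2⟩ := p.exists_boundary_dart (Q a) hua
      fun h => Set.disjoint_left.1 (dQ a b hab) h hub'
    have hfst : e.fst ∈ U := hp _ (p.dart_fst_mem_support_of_mem_darts he)
    have hsnd : e.snd ∈ U := hp _ (p.dart_snd_mem_support_of_mem_darts he)
    exact hpair a b rfl e.fst e.snd e.adj h1 ((hcov' _ hsnd).resolve_left h2) (Or.inl hfst)
  · let a : Fin 3 → ι := fun k => (s.equivFinOfCardEq h).symm k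
    have has : ∀ k, a k ∈ s := fun k => Subtype.coe_prop _
    have hinj : ∀ k l, k ≠ l → a k ≠ a l := fun k l hkl e =>
      hkl ((s.equivFinOfCardEq h).symm.injective (Subtype.ext e))
    have hsurj : ∀ i ∈ s, ∃ k, a k = i := fun i hi =>
      ⟨s.equivFinOfCardEq h ⟨i, hi⟩, by simp [a]⟩
    obtain ⟨x, h1, h2, h3⟩ := hq.exists_triangle (P := fun k => P (a k)) (Q := fun k => Q (a k)) hU
      (fun k => hP _ (has k)) (fun k => hQ _ (has k)) (fun k l h => dP _ _ (hinj k l h))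
      (fun k l h => dQ _ _ (hinj k l h)) (fun k => dPU _ (has k))
      (fun k l h => aP _ (has k) _ (has l) (hinj k l h)) (fun k => aPU _ (has k))
      (fun u hu v huv => (hbd u hu v huv).imp_right fun ⟨i, hi, hv⟩ => by
        obtain ⟨k, rfl⟩ := hsurj i hi
        exact ⟨k, hv⟩) (fun k => hPQ _) (fun k => hQU _) (fun u hu => by
        obtain ⟨i, hi, hv⟩ := hcov u hu
        obtain ⟨k, rfl⟩ := hsurj i hi
        exact ⟨k, hv⟩)
    refine ⟨x, h3, fun k l => ?_, fun i hi => ?_⟩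
    · by_cases e : k = l
      · exact Or.inl (congrArg x e)
      · exact Or.inr (h2 k l e)
    · obtain ⟨k, rfl⟩ := hsurj i hi
      exact ⟨k, h1 k⟩

/-- An unassigned component contains a union of at most three vertical paths which is attached to
all parts attached to the component. -/
lemma exists_tripod (hq : IsLatticeQuotient q r) {d : N → ℕ} {par : N → N}
    (hpar : ∀ v, v ≠ r → (latticeQuotient q).Adj v (par v) ∧ d (par v) + 1 = d v) {n : ℕ}
    {part : N → ℕ} {idx : N → Fin 3}
    (hT : (latticeQuotient q).IsTripodDecomposition d r n part idx) {U : Set N}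
    (hUn : U ⊆ part ⁻¹' {n}) (hne : U.Nonempty) (hU : (latticeQuotient q).ConnIn U)
    (hbd : ∀ u ∈ U, ∀ v, (latticeQuotient q).Adj u v → v ∈ U ∨ part v < n) :
    ∃ (Y : Set N) (ix : N → Fin 3), Y ⊆ U ∧ Y.Nonempty ∧ (latticeQuotient q).ConnIn Y ∧
      (∀ x ∈ Y, ∀ y ∈ Y, d x = d y → ix x = ix y → x = y) ∧
      ∀ i < n, (latticeQuotient q).SetAdj (part ⁻¹' {i}) U →
        (latticeQuotient q).SetAdj (part ⁻¹' {i}) Y := by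
  classical
  obtain ⟨⟨s, hs, hsU⟩, hclique⟩ := hT.attached U hU hUn
  have hpU : ∀ u ∈ U, part u = n := fun u hu => hUn hu
  obtain ⟨col, C, hC⟩ := SimpleGraph.exists_chains hpar
    (fun h => hT.root.ne (hpU r h)) part
  let I := s.filter fun i => i < n ∧ (latticeQuotient q).SetAdj (part ⁻¹' {i}) U
  have hI : ∀ i, i ∈ I ↔ i < n ∧ (latticeQuotient q).SetAdj (part ⁻¹' {i}) U := fun i => by
    simp only [I, Finset.mem_filter, and_iff_right_iff_imp]
    exact fun h => hsU i h.1 h.2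
  have hcol : ∀ u ∈ U, col u ∈ I := by
    intro u hu
    obtain ⟨h1, -, -, ⟨x, hx, hxu, y, hy, hxy⟩, -⟩ := hC u hu
    rw [hI, ← hxu]
    exact ⟨(hbd y (h1 hy) x hxy.symm).resolve_left hx, x, rfl, y, h1 hy, hxy⟩
  have hdisj : ∀ i < n, ∀ x ∈ U, part x ≠ i := fun i hi x hx => by
    rw [hpU x hx]
    exact hi.ne'
  let Q : ℕ → Set N := fun i => {v | (part v = i ∧ v ∉ U) ∨ v ∈ U ∧ col v = i}
  let P : ℕ → Set N := fun i => {v | part v = i ∧ v ∉ U}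
  have hPi : ∀ i < n, P i = part ⁻¹' {i} := fun i hi => by
    ext v
    exact ⟨fun h => h.1, fun h => ⟨h, fun hv => hdisj i hi v hv h⟩⟩
  have hconn : ∀ i ∈ I, (latticeQuotient q).ConnIn (Q i) := by
    intro i hi
    obtain ⟨hin, a, ha, -⟩ := (hI i).1 hi
    have hsub : part ⁻¹' {i} ⊆ Q i := by
      rw [← hPi i hin]
      exact fun x hx => Or.inl hx
    refine .of_center (c := a) fun x hx => ?_
    rcases hx with ⟨hx, -⟩ | ⟨hx, hxi⟩
    · obtain ⟨p, hp⟩ := hT.connIn i hin x hx a ha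
      exact ⟨p, fun z hz => hsub (hp z hz)⟩
    · obtain ⟨h1, h2, h3, ⟨y, hy, hyx, z, hz, hyz⟩, -, h5⟩ := hC x hx
      obtain ⟨p, hp⟩ := ((hT.connIn i hin).union h3 ⟨y, hyx.trans hxi, z, hz, hyz⟩) x (Or.inr h2)
        a (Or.inl ha)
      exact ⟨p, fun z hz => (hp z hz).elim (fun h => hsub h)
        fun h => Or.inr ⟨h1 h, (h5 z h).trans hxi⟩⟩
  obtain ⟨x, ⟨k₀, hk₀⟩, hx, hxQ⟩ := hq.exists_clique (P := P) (Q := Q) (s := I)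
    (by obtain ⟨u, hu⟩ := hne; exact ⟨_, hcol u hu⟩) ((Finset.card_filter_le _ _).trans hs) hU hne
    (fun i hi => by rw [hPi i ((hI i).1 hi).1]; exact hT.connIn i ((hI i).1 hi).1) hconn
    (fun i j h => Set.disjoint_left.2 fun x hi hj => h (hi.1.symm.trans hj.1))
    (fun i j h => Set.disjoint_left.2 fun x hi hj => by
      rcases hi with hi | hi <;> rcases hj with hj | hj
      · exact h (hi.1.symm.trans hj.1)
      · exact hi.2 hj.1
      · exact hj.2 hi.1
      · exact h (hi.2.symm.trans hj.2))
    (fun i hi => Set.disjoint_left.2 fun x hx => hx.2)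
    (fun i hi j hj h => by
      rw [hI] at hi hj
      rw [hPi i hi.1, hPi j hj.1]
      exact hclique i hi.1 j hj.1 hi.2 hj.2 h)
    (fun i hi => by
      rw [hI] at hi
      rw [hPi i hi.1]
      exact hi.2)
    (fun u hu v huv => by
      by_cases hv : v ∈ U
      · exact Or.inl hv
      · have h1 := (hbd u hu v huv).resolve_left hv
        exact Or.inr ⟨part v, (hI _).2 ⟨h1, v, rfl, u, hu, huv.symm⟩, rfl, hv⟩)
    (fun i v => Or.inl) (fun i v h => h.imp id And.left)
    (fun u hu => ⟨col u, hcol u hu, Or.inr ⟨hu, rfl⟩⟩)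
  let Y : Set N := {v | ∃ k, x k ∈ U ∧ v ∈ C (x k)}
  have hYC : ∀ k, x k ∈ U → C (x k) ⊆ Y := fun k hk v hv => ⟨k, hk, hv⟩
  have hix : ∀ v, ∃ k, v ∈ Y → x k ∈ U ∧ v ∈ C (x k) := fun v => by
    by_cases hv : v ∈ Y
    · obtain ⟨k, hk⟩ := hv
      exact ⟨k, fun _ => hk⟩
    · exact ⟨0, fun h => (hv h).elim⟩
  choose ix hix using hix
  refine ⟨Y, ix, ?_, ⟨x k₀, k₀, hk₀, (hC _ hk₀).2.1⟩, ?_, ?_, ?_⟩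
  · rintro v ⟨k, hk, hv⟩
    exact (hC _ hk).1 hv
  · refine .of_center (c := x k₀) ?_
    rintro v ⟨k, hk, hv⟩
    obtain ⟨p, hp⟩ := (hC _ hk).2.2.1 v hv _ (hC _ hk).2.1
    have hx0 : x k₀ ∈ Y := hYC _ hk₀ (hC _ hk₀).2.1
    obtain ⟨p', hp'⟩ : ∃ p' : (latticeQuotient q).Walk (x k) (x k₀), ∀ z ∈ p'.support, z ∈ Y := by
      rcases hx k k₀ with h | h
      · rw [h]
        exact ⟨.nil, by simpa using hx0⟩
      · exact ⟨.cons h .nil, by simpa using ⟨hYC _ hk (hC _ hk).2.1, hx0⟩⟩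
    refine ⟨p.append p', fun z hz => ?_⟩
    rw [SimpleGraph.Walk.mem_support_append_iff] at hz
    exact hz.elim (fun h => hYC _ hk (hp z h)) (hp' z)
  · intro u hu v hv hd hi
    obtain ⟨h1, h2⟩ := hix u hu
    obtain ⟨-, h3⟩ := hix v hv
    rw [← hi] at h3
    exact (hC _ h1).2.2.2.2.1 u h2 v h3 hd
  · intro i hi hiU
    obtain ⟨k, hk⟩ := hxQ i ((hI i).2 ⟨hi, hiU⟩)
    rcases hk with ⟨hk, hkU⟩ | ⟨hk, hki⟩
    · rcases hx k k₀ with h | h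
      · exact (hkU (h ▸ hk₀)).elim
      · exact ⟨x k, hk, x k₀, hYC _ hk₀ (hC _ hk₀).2.1, h⟩
    · obtain ⟨y, -, hy, z, hz, hyz⟩ := (hC _ hk).2.2.2.1
      exact ⟨y, hy.trans hki, z, hYC _ hk hz, hyz⟩

end IsLatticeQuotient

namespace IsLatticeQuotient

variable {N : Type*} [Finite N] {q : ℤ × ℤ → N} {r : N}

/-- The sets attached to two adjacent disjoint connected sets do not contain a triangle. -/
lemma card_attached_le (hq : IsLatticeQuotient q r) {part : N → ℕ} {n : ℕ} {Y T : Set N}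
    {s : Finset ℕ} (hs : s.card ≤ 3) (hsn : ∀ i ∈ s, i < n)
    (hc : ∀ i < n, (latticeQuotient q).ConnIn (part ⁻¹' {i}))
    (hY : (latticeQuotient q).ConnIn Y) (hT : (latticeQuotient q).ConnIn T) (hd : Disjoint Y T)
    (hYn : ∀ x ∈ Y, n ≤ part x) (hTn : ∀ x ∈ T, n ≤ part x)
    (ha : (latticeQuotient q).SetAdj Y T)
    (haY : ∀ i ∈ s, (latticeQuotient q).SetAdj (part ⁻¹' {i}) Y)
    (haT : ∀ i ∈ s, (latticeQuotient q).SetAdj (part ⁻¹' {i}) T)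
    (hss : ∀ i ∈ s, ∀ j ∈ s, i ≠ j →
      (latticeQuotient q).SetAdj (part ⁻¹' {i}) (part ⁻¹' {j})) : s.card ≤ 2 := by
  by_contra hcard
  obtain ⟨a, b, c, hab, hac, hbc, rfl⟩ := Finset.card_eq_three.1 (show s.card = 3 by omega)
  have hdP : ∀ i ∈ ({a, b, c} : Finset ℕ), ∀ Z : Set N, (∀ x ∈ Z, n ≤ part x) →
      Disjoint (part ⁻¹' {i}) Z := fun i hi Z hZ => Set.disjoint_left.2 fun x hx hx' => by
    have h1 := hZ x hx'
    have h2 := hsn i hi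
    rw [show part x = i from hx] at h1
    omega
  have hdd : ∀ i j : ℕ, i ≠ j → Disjoint (part ⁻¹' {i}) (part ⁻¹' {j}) := fun i j h =>
    Set.disjoint_left.2 fun x hx hx' => h (hx.symm.trans hx')
  have ma : a ∈ ({a, b, c} : Finset ℕ) := by simp
  have mb : b ∈ ({a, b, c} : Finset ℕ) := by simp
  have mc : c ∈ ({a, b, c} : Finset ℕ) := by simp
  let S : Fin 5 → Set N := ![part ⁻¹' {a}, part ⁻¹' {b}, part ⁻¹' {c}, Y, T]
  have hlt : ∀ i j : Fin 5, i < j →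
      Disjoint (S i) (S j) ∧ (latticeQuotient q).SetAdj (S i) (S j) := by
    intro i j hij
    fin_cases i <;> fin_cases j <;> first | exact absurd hij (by decide) | skip
    · exact ⟨hdd a b hab, hss a ma b mb hab⟩
    · exact ⟨hdd a c hac, hss a ma c mc hac⟩
    · exact ⟨hdP a ma Y hYn, haY a ma⟩
    · exact ⟨hdP a ma T hTn, haT a ma⟩
    · exact ⟨hdd b c hbc, hss b mb c mc hbc⟩
    · exact ⟨hdP b mb Y hYn, haY b mb⟩
    · exact ⟨hdP b mb T hTn, haT b mb⟩
    · exact ⟨hdP c mc Y hYn, haY c mc⟩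
    · exact ⟨hdP c mc T hTn, haT c mc⟩
    · exact ⟨hd, ha⟩
  refine hq.no_five S (fun i => ?_) (fun i j h => ?_) fun i j h => ?_
  · fin_cases i
    exacts [hc a (hsn a ma), hc b (hsn b mb), hc c (hsn c mc), hY, hT]
  · rcases h.lt_or_gt with h | h
    exacts [(hlt i j h).1, (hlt j i h).1.symm]
  · rcases h.lt_or_gt with h | h
    exacts [(hlt i j h).2, (hlt j i h).2.symm]

lemma exists_next (hq : IsLatticeQuotient q r) {d : N → ℕ} {par : N → N}
    (hpar : ∀ v, v ≠ r → (latticeQuotient q).Adj v (par v) ∧ d (par v) + 1 = d v) {n : ℕ}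
    {part : N → ℕ} {idx : N → Fin 3}
    (hT : (latticeQuotient q).IsTripodDecomposition d r n part idx) {v₀ : N} (hv₀ : part v₀ = n) :
    ∃ (part' : N → ℕ) (idx' : N → Fin 3),
      (latticeQuotient q).IsTripodDecomposition d r (n + 1) part' idx' ∧
      part' ⁻¹' {n + 1} ⊂ part ⁻¹' {n} := by
  classical
  obtain ⟨U, hUn, hvU, hU, hUmax⟩ :=
    (latticeQuotient q).exists_component (part ⁻¹' {n}) (v := v₀) hv₀
  have hbd : ∀ u ∈ U, ∀ v, (latticeQuotient q).Adj u v → v ∈ U ∨ part v < n := by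
    intro u hu v huv
    rcases (hT.le v).lt_or_eq with h | h
    · exact Or.inr h
    · refine Or.inl (hUmax {v} (by simpa using h) (SimpleGraph.ConnIn.singleton v)
        ⟨u, hu, Or.inr ⟨v, rfl, huv⟩⟩ rfl)
  obtain ⟨Y, ix, hYU, ⟨y₀, hy₀⟩, hY, hinj, hYatt⟩ :=
    hq.exists_tripod hpar hT hUn ⟨_, hvU⟩ hU hbd
  have hYn : ∀ v ∈ Y, part v = n := fun v hv => hUn (hYU hv)
  let part' : N → ℕ := fun v => if v ∈ Y then n else if part v = n then n + 1 else part v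
  let idx' : N → Fin 3 := fun v => if v ∈ Y then ix v else idx v
  have p1 : ∀ v ∈ Y, part' v = n := fun v hv => if_pos hv
  have p2 : ∀ v ∉ Y, part v = n → part' v = n + 1 := fun v hv h => by simp [part', hv, h]
  have p3 : ∀ v, part v ≠ n → part' v = part v := fun v h => by
    simp [part', mt (hYn v) h, h]
  have hlt : ∀ i < n, part' ⁻¹' {i} = part ⁻¹' {i} := by
    intro i hi
    ext v
    simp only [Set.mem_preimage, Set.mem_singleton_iff]
    by_cases h1 : part v = n
    · by_cases h2 : v ∈ Y
      · rw [p1 v h2, h1]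
      · rw [p2 v h2 h1, h1]
        omega
    · rw [p3 v h1]
  have hn : part' ⁻¹' {n} = Y := by
    ext v
    refine ⟨fun h => ?_, p1 v⟩
    have h : part' v = n := h
    by_contra hv
    by_cases h1 : part v = n
    · have := p2 v hv h1
      omega
    · exact h1 ((p3 v h1).symm.trans h)
  have hn1 : ∀ v, part' v = n + 1 → part v = n ∧ v ∉ Y := by
    intro v hv
    by_cases h2 : v ∈ Y
    · have := p1 v h2
      omega
    · refine ⟨by_contra fun h1 => ?_, h2⟩
      have := p3 v h1
      have := hT.le v
      omega
  refine ⟨part', idx', ⟨fun v => ?_, ?_, fun i hi => ?_, ?_, fun j hj => ?_, fun T hc hTn => ?_⟩, ?_⟩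
  · by_cases h1 : part v = n
    · by_cases h2 : v ∈ Y
      · rw [p1 v h2]
        omega
      · rw [p2 v h2 h1]
    · rw [p3 v h1]
      exact (hT.le v).trans (Nat.le_succ n)
  · rw [p3 r hT.root.ne]
    exact hT.root.trans (Nat.lt_succ_self n)
  · rcases (Nat.lt_succ_iff_lt_or_eq.1 hi) with hi | rfl
    · rw [hlt i hi]
      exact hT.connIn i hi
    · rwa [hn]
  · intro u v hu huv hd hi
    by_cases hun : part' u = n
    · have hu' : u ∈ Y := hn ▸ hun
      have hv' : v ∈ Y := hn ▸ (huv.symm.trans hun)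
      exact hinj u hu' v hv' hd (by simpa [idx', hu', hv'] using hi)
    · have hu' : part' u < n := by omega
      have h1 : ∀ w, part' w < n → part w = part' w ∧ idx' w = idx w := by
        intro w hw
        have hw1 : w ∉ Y := fun h => by
          rw [p1 w h] at hw
          omega
        refine ⟨(p3 w fun h => ?_).symm, if_neg hw1⟩
        rw [p2 w hw1 h] at hw
        omega
      obtain ⟨a1, a2⟩ := h1 u hu'
      obtain ⟨b1, b2⟩ := h1 v (huv ▸ hu')
      exact hT.inj u v (a1 ▸ hu') (by rw [a1, b1, huv]) hd (by rw [← a2, ← b2, hi])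
  · rcases (Nat.lt_succ_iff_lt_or_eq.1 hj) with hj | rfl
    · rw [hlt j hj]
      exact (hT.part_attached j hj).congr fun i hi => hlt i (hi.trans hj)
    · rw [hn]
      exact ((hT.attached U hU hUn).mono hYU).congr hlt
  · have hTn' : T ⊆ part ⁻¹' {n} := fun v hv => (hn1 v (hTn hv)).1
    have hTY : Disjoint Y T := Set.disjoint_right.2 fun v hv => (hn1 v (hTn hv)).2
    obtain ⟨⟨s, hs, h1⟩, h2⟩ := (hT.attached T hc hTn').congr hlt
    by_cases ha : (latticeQuotient q).SetAdj Y T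
    · have hTU : T ⊆ U := by
        obtain ⟨x, hx, y, hy, hxy⟩ := ha
        exact hUmax T hTn' hc ⟨x, hYU hx, Or.inr ⟨y, hy, hxy⟩⟩
      have hY' : ∀ i < n, (latticeQuotient q).SetAdj (part' ⁻¹' {i}) T →
          (latticeQuotient q).SetAdj (part' ⁻¹' {i}) Y := fun i hi h => by
        rw [hlt i hi] at h ⊢
        exact hYatt i hi (h.mono subset_rfl hTU)
      refine ⟨⟨insert n (s.filter fun i => i < n ∧ (latticeQuotient q).SetAdj (part' ⁻¹' {i}) T),
        (Finset.card_insert_le _ _).trans (Nat.succ_le_succ ?_), fun i hi hi' => ?_⟩, ?_⟩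
      · refine hq.card_attached_le (part := part') (n := n) ((Finset.card_filter_le _ _).trans hs)
          (fun i hi => (Finset.mem_filter.1 hi).2.1) (fun i hi => by
            rw [hlt i hi]
            exact hT.connIn i hi) hY hc hTY (fun x hx => (p1 x hx).ge)
          (fun x hx => by have : part' x = n + 1 := hTn hx; omega) ha
          (fun i hi => ?_) (fun i hi => (Finset.mem_filter.1 hi).2.2) fun i hi j hj hij => ?_
        · obtain ⟨-, h3, h4⟩ := Finset.mem_filter.1 hi
          exact hY' i h3 h4
        · obtain ⟨-, h3, h4⟩ := Finset.mem_filter.1 hi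
          obtain ⟨-, h5, h6⟩ := Finset.mem_filter.1 hj
          exact h2 i h3 j h5 h4 h6 hij
      · rw [Finset.mem_insert, Finset.mem_filter]
        rcases (Nat.lt_succ_iff_lt_or_eq.1 hi) with hi | rfl
        · exact Or.inr ⟨h1 i hi hi', hi, hi'⟩
        · exact Or.inl rfl
      · intro i hi j hj hi' hj' hij
        rcases (Nat.lt_succ_iff_lt_or_eq.1 hi) with hi | rfl <;>
          rcases (Nat.lt_succ_iff_lt_or_eq.1 hj) with hj | rfl
        · exact h2 i hi j hj hi' hj' hij
        · rw [hn]
          exact hY' i hi hi'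
        · rw [hn]
          exact (hY' j hj hj').symm
        · exact (hij rfl).elim
    · have hlt' : ∀ i < n + 1, (latticeQuotient q).SetAdj (part' ⁻¹' {i}) T → i < n := by
        intro i hi hi'
        refine (Nat.lt_succ_iff_lt_or_eq.1 hi).resolve_right fun e => ha ?_
        rwa [e, hn] at hi'
      exact ⟨⟨s, hs, fun i hi hi' => h1 i (hlt' i hi hi') hi'⟩, fun i hi j hj hi' hj' hij =>
        h2 i (hlt' i hi hi') j (hlt' j hj hj') hi' hj' hij⟩
  · refine ⟨fun v hv => (hn1 v hv).1, fun h => ?_⟩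
    exact (hn1 y₀ (h (hYn y₀ hy₀))).2 hy₀

lemma exists_isTripodDecomposition (hq : IsLatticeQuotient q r) {d : N → ℕ} {par : N → N}
    (hpar : ∀ v, v ≠ r → (latticeQuotient q).Adj v (par v) ∧ d (par v) + 1 = d v) :
    ∃ (n : ℕ) (part : N → ℕ) (idx : N → Fin 3),
      (latticeQuotient q).IsTripodDecomposition d r n part idx ∧ ∀ v, part v < n := by
  have key : ∀ (m n : ℕ) (part : N → ℕ) (idx : N → Fin 3),
      (latticeQuotient q).IsTripodDecomposition d r n part idx → (part ⁻¹' {n}).ncard = m →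
      ∃ (n : ℕ) (part : N → ℕ) (idx : N → Fin 3),
        (latticeQuotient q).IsTripodDecomposition d r n part idx ∧ ∀ v, part v < n := by
    intro m
    induction m using Nat.strong_induction_on with
    | _ m ih =>
      intro n part idx hT hm
      by_cases h : ∃ v, part v = n
      · obtain ⟨v, hv⟩ := h
        obtain ⟨part', idx', hT', hss⟩ := hq.exists_next hpar hT hv
        exact ih _ (hm ▸ Set.ncard_lt_ncard hss (Set.toFinite _)) _ part' idx' hT' rfl
      · exact ⟨n, part, idx, hT, fun v => (hT.le v).lt_of_ne fun e => h ⟨v, e⟩⟩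
  exact key _ _ _ _ (SimpleGraph.isTripodDecomposition_root _ d r) rfl

end IsLatticeQuotient

/-- The graph on `ℕ` obtained by contracting the parts of a partition. -/
def SimpleGraph.partGraph {N : Type*} (K : SimpleGraph N) (part : N → ℕ) : SimpleGraph ℕ where
  Adj i j := i ≠ j ∧ K.SetAdj (part ⁻¹' {i}) (part ⁻¹' {j})
  symm := ⟨fun _ _ h => ⟨h.1.symm, h.2.symm⟩⟩
  loopless := ⟨fun _ h => h.1 rfl⟩

lemma SimpleGraph.IsTripodDecomposition.isElimination_partGraph {N : Type*} {K : SimpleGraph N}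
    {d : N → ℕ} {r : N} {n : ℕ} {part : N → ℕ} {idx : N → Fin 3}
    (h : K.IsTripodDecomposition d r n part idx) (hn : ∀ v, part v < n) :
    (K.partGraph part).IsElimination 3 := by
  intro j
  by_cases hj : j < n
  · obtain ⟨⟨s, hs, h1⟩, h2⟩ := h.part_attached j hj
    exact ⟨⟨s, hs, fun i hi ha => h1 i hi ha.2⟩, fun i hi i' hi' ha ha' hne =>
      ⟨hne, h2 i hi i' hi' ha.2 ha'.2 hne⟩⟩
  · have hno : ∀ i, ¬ (K.partGraph part).Adj i j := by
      rintro i ⟨-, -, -, v, hv, -⟩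
      exact hj ((show part v = j from hv) ▸ hn v)
    exact ⟨⟨∅, by simp, fun i _ ha => (hno i ha).elim⟩, fun i _ _ _ ha => (hno i ha).elim⟩

lemma IsLatticeQuotient.exists_stronglyNonrepetitive {N : Type*} [Finite N] {q : ℤ × ℤ → N}
    {r : N} (hq : IsLatticeQuotient q r) :
    ∃ φ : N → Fin 768, (latticeQuotient q).IsStronglyNonrepetitive φ := by
  obtain ⟨d, par, hpar, hd⟩ := SimpleGraph.exists_bfs hq.reachable r
  obtain ⟨n, part, idx, hT, hn⟩ := hq.exists_isTripodDecomposition hpar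
  obtain ⟨ψ, hψ⟩ := (hT.isElimination_partGraph hn).exists_stronglyNonrepetitive
  let e : (Fin (4 ^ 3) × Fin 4) × Fin 3 ≃ Fin 768 :=
    (Equiv.prodCongr finProdFinEquiv (Equiv.refl _)).trans finProdFinEquiv
  refine ⟨fun v => e ((ψ (part v), pathColour (d v)), idx v), fun z hz hc hφ => ?_⟩
  have hcol : ∀ p ∈ z, (ψ (part p.1) = ψ (part p.2) ∧ pathColour (d p.1) = pathColour (d p.2)) ∧
      idx p.1 = idx p.2 := fun p hp => by
    simpa only [Prod.mk.injEq] using e.injective (hφ p hp)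
  have hmap : ∀ f : N → ℕ, (z.map Prod.fst ++ z.map Prod.snd).map f =
      (z.map fun p => (f p.1, f p.2)).map Prod.fst ++
        (z.map fun p => (f p.1, f p.2)).map Prod.snd := fun f => by
    simp [Function.comp_def]
  have hdepth : ∀ p ∈ z, d p.1 = d p.2 := by
    have := pathSeq_boring_list (z.map fun p => (d p.1, d p.2)) (by
      rw [← hmap, List.isChain_map]
      refine hc.imp fun a b hab => ?_
      rcases hab with rfl | h
      · omega
      · exact ⟨hd a b h, hd b a h.symm⟩) (by
      intro p hp
      obtain ⟨p, hpz, rfl⟩ := List.mem_map.1 hp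
      exact pathSeq_eq_of_pathColour_eq (hcol p hpz).1.2)
    exact fun p hp => this _ (List.mem_map_of_mem hp)
  obtain ⟨p, hp, hpart⟩ := hψ (z.map fun p => (part p.1, part p.2)) (by simpa using hz) (by
    rw [← hmap, List.isChain_map]
    refine hc.imp fun a b hab => ?_
    by_cases h : part a = part b
    · exact Or.inl h
    · rcases hab with rfl | hab
      · exact (h rfl).elim
      · exact Or.inr ⟨h, a, rfl, b, rfl, hab⟩) (by
    intro p hp
    obtain ⟨p, hpz, rfl⟩ := List.mem_map.1 hp
    exact (hcol p hpz).1.1)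
  obtain ⟨p, hpz, rfl⟩ := List.mem_map.1 hp
  exact ⟨p, hpz, hT.inj _ _ (hn _) hpart (hdepth p hpz) (hcol p hpz).2⟩

lemma SimpleGraph.IsStronglyNonrepetitive.comp_isNonrepetitiveColouring {V N α : Type*}
    {G : SimpleGraph V} {K : SimpleGraph N} {φ : N → α} (hφ : K.IsStronglyNonrepetitive φ)
    {i : V → N} (hi : i.Injective) (hadj : ∀ u v, G.Adj u v → K.Adj (i u) (i v)) :
    G.IsNonrepetitiveColouring (φ ∘ i) := by
  intro u v p hp k hk heq
  set l := p.support with hl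
  let z := ((l.take k).zip (l.drop k)).map fun p => (i p.1, i p.2)
  have hlen : (l.take k).length = (l.drop k).length := by
    simp only [List.length_take, List.length_drop]
    omega
  have hz1 : z.map Prod.fst = (l.take k).map i := by
    simp only [z, List.map_map]
    rw [← List.map_fst_zip (l₁ := l.take k) (l₂ := l.drop k) hlen.le, List.map_map]
    simp [Function.comp_def, List.map_fst_zip hlen.le]
  have hz2 : z.map Prod.snd = (l.drop k).map i := by
    simp only [z, List.map_map]
    conv_rhs => rw [← List.map_snd_zip (l₁ := l.take k) (l₂ := l.drop k) hlen.ge, List.map_map]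
    rfl
  have hk0 : 0 < k := by
    have : 0 < l.length := List.length_pos_of_ne_nil p.support_ne_nil
    omega
  have hzlen : z.length = k := by
    simp only [z, List.length_map, List.length_zip, List.length_take, List.length_drop]
    omega
  obtain ⟨x, hx, hxx⟩ := hφ z (by rintro h; simp [h] at hzlen; omega) (by
    rw [hz1, hz2, ← List.map_append, List.take_append_drop, List.isChain_map]
    exact p.isChain_adj_support.imp fun a b h => Or.inr (hadj a b h)) (by
    have h1 : (z.map Prod.fst).map φ = (z.map Prod.snd).map φ := by
      rw [hz1, hz2, List.map_map, List.map_map, List.map_take, List.map_drop]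
      exact heq
    rw [List.map_map (l := z), List.map_map (l := z)] at h1
    exact List.map_inj_left.1 h1)
  obtain ⟨⟨a, b⟩, hab, rfl⟩ := List.mem_map.1 hx
  obtain rfl : a = b := hi hxx
  obtain ⟨ha, hb⟩ := List.of_mem_zip hab
  have hnd : (l.take k ++ l.drop k).Nodup := by
    rw [List.take_append_drop]
    exact hp.support_nodup
  exact List.disjoint_of_nodup_append hnd ha hb

lemma SimpleGraph.nonrepChromNum_le {V : Type*} [Finite V] {G : SimpleGraph V}
    {q : ℤ × ℤ → Option V} (hq : IsLatticeQuotient q none)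
    (h : ∀ u v, G.Adj u v → (latticeQuotient q).Adj (some u) (some v)) :
    G.nonrepChromNum ≤ 768 := by
  obtain ⟨φ, hφ⟩ := hq.exists_stronglyNonrepetitive
  exact Nat.sInf_le ⟨_, hφ.comp_isNonrepetitiveColouring (Option.some_injective V) h⟩

/-- The cell containing `x` in the decomposition of the plane into squares of side length `δ`. -/
noncomputable def planeCell (δ : ℝ) (x : ℝ × ℝ) : ℤ × ℤ := (⌊x.1 / δ⌋, ⌊x.2 / δ⌋)

lemma dist_lt_of_planeCell_eq {δ : ℝ} (hδ : 0 < δ) {x y : ℝ × ℝ}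
    (h : planeCell δ x = planeCell δ y) : dist x y < δ := by
  have key : ∀ a b : ℝ, ⌊a / δ⌋ = ⌊b / δ⌋ → dist a b < δ := by
    intro a b hab
    have := Int.abs_sub_lt_one_of_floor_eq_floor hab
    rwa [← sub_div, abs_div, abs_of_pos hδ, div_lt_one hδ] at this
  simp only [planeCell, Prod.mk.injEq] at h
  rw [Prod.dist_eq, max_lt_iff]
  exact ⟨key _ _ h.1, key _ _ h.2⟩

lemma eventually_planeCell (δ : ℝ) (x : ℝ × ℝ) :
    ∀ᶠ y in nhds x, triLattice.LazyAdj (planeCell δ x) (planeCell δ y) := by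
  have key : ∀ a : ℝ, ∀ᶠ b in nhds a, ⌊b / δ⌋ ≤ ⌊a / δ⌋ ∧ ⌊a / δ⌋ ≤ ⌊b / δ⌋ + 1 := by
    intro a
    have hc : Filter.Tendsto (fun b : ℝ => b / δ) (nhds a) (nhds (a / δ)) :=
      (continuous_id.div_const δ).tendsto a
    have h1 := hc.eventually (Iio_mem_nhds (Int.lt_floor_add_one (a / δ)))
    have h2 := hc.eventually (Ioi_mem_nhds ((sub_one_lt _).trans_le (Int.floor_le (a / δ))))
    filter_upwards [h1, h2] with b hb1 hb2
    constructor
    · rw [← Int.lt_add_one_iff, Int.floor_lt]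
      push_cast
      exact hb1
    · rw [← sub_le_iff_le_add, Int.le_floor]
      push_cast
      exact (show (⌊a / δ⌋ : ℝ) - 1 < b / δ from hb2).le
  filter_upwards [(continuous_fst.tendsto x).eventually (key x.1),
    (continuous_snd.tendsto x).eventually (key x.2)] with y h1 h2
  by_cases h : planeCell δ x = planeCell δ y
  · exact Or.inl h
  · exact Or.inr ⟨h, Or.inr ⟨h1.1, h1.2, h2.1, h2.2⟩⟩

lemma connIn_planeCell (δ : ℝ) {S : Set (ℝ × ℝ)} (hS : IsPreconnected S) :
    triLattice.ConnIn (planeCell δ '' S) := by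
  rintro _ ⟨x, hx, rfl⟩ _ ⟨y, hy, rfl⟩
  refine hS.induction₂' (fun x y => ∃ p : triLattice.Walk (planeCell δ x) (planeCell δ y),
    ∀ z ∈ p.support, z ∈ planeCell δ '' S) (fun x hx => ?_) ?_ hx hy
  · filter_upwards [nhdsWithin_le_nhds (eventually_planeCell δ x), self_mem_nhdsWithin] with y h hy
    have hx' := Set.mem_image_of_mem (planeCell δ) hx
    have hy' := Set.mem_image_of_mem (planeCell δ) hy
    rcases h with h | h
    · rw [h]
      exact ⟨⟨.nil, by simpa using hy'⟩, ⟨.nil, by simpa using hy'⟩⟩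
    · have hsub : ({planeCell δ x, planeCell δ y} : Set (ℤ × ℤ)) ⊆ planeCell δ '' S :=
        Set.insert_subset hx' (Set.singleton_subset_iff.2 hy')
      obtain ⟨p, hp⟩ := SimpleGraph.ConnIn.pair h _ (Or.inl rfl) _ (Or.inr rfl)
      exact ⟨⟨p, fun z hz => hsub (hp z hz)⟩,
        ⟨p.reverse, fun z hz => hsub (hp z (by simpa using hz))⟩⟩
  · rintro x y z - - - ⟨p, hp⟩ ⟨p', hp'⟩
    refine ⟨p.append p', fun w hw => ?_⟩
    rw [SimpleGraph.Walk.mem_support_append_iff] at hw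
    exact hw.elim (hp w) (hp' w)

/-- The outside of a large square is connected in the triangular lattice. -/
lemma connIn_compl_square (R : ℤ) : triLattice.ConnIn {x : ℤ × ℤ | R ≤ |x.1| ∨ R ≤ |x.2|} := by
  have hcol : ∀ i : ℤ, triLattice.ConnIn {x : ℤ × ℤ | x.1 = i} := fun i => by
    convert connIn_planeCell 1 ((isPreconnected_singleton (x := (i : ℝ))).prod
      (isPreconnected_univ (α := ℝ))) using 1
    ext ⟨a, b⟩
    constructor
    · rintro rfl
      exact ⟨(a, b), by simp, by simp [planeCell]⟩
    · rintro ⟨⟨c, d⟩, ⟨h, -⟩, h'⟩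
      obtain rfl : c = i := h
      simp only [planeCell, Prod.mk.injEq, div_one, Int.floor_intCast] at h'
      exact h'.1.symm
  have hrow : ∀ i : ℤ, triLattice.ConnIn {x : ℤ × ℤ | x.2 = i} := fun i => by
    convert connIn_planeCell 1 ((isPreconnected_univ (α := ℝ)).prod
      (isPreconnected_singleton (x := (i : ℝ)))) using 1
    ext ⟨a, b⟩
    constructor
    · rintro rfl
      exact ⟨(a, b), by simp, by simp [planeCell]⟩
    · rintro ⟨⟨c, d⟩, ⟨-, h⟩, h'⟩
      obtain rfl : d = i := h
      simp only [planeCell, Prod.mk.injEq, div_one, Int.floor_intCast] at h'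
      exact h'.2.symm
  have hR : R ≤ |R| := le_abs_self R
  refine .of_center (c := (R, R)) fun x hx => ?_
  rcases hx with hx | hx
  · obtain ⟨p, hp⟩ := ((hcol x.1).union_of_mem (hrow R) (c := (x.1, R)) rfl rfl) x (Or.inl rfl)
      (R, R) (Or.inr rfl)
    refine ⟨p, fun z hz => ?_⟩
    rcases hp z hz with h | h
    · exact Or.inl (by rwa [show z.1 = x.1 from h])
    · exact Or.inr (by rwa [show z.2 = R from h])
  · obtain ⟨p, hp⟩ := ((hrow x.2).union_of_mem (hcol R) (c := (R, x.2)) rfl rfl) x (Or.inl rfl)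
      (R, R) (Or.inr rfl)
    refine ⟨p, fun z hz => ?_⟩
    rcases hp z hz with h | h
    · exact Or.inr (by rwa [show z.2 = x.2 from h])
    · exact Or.inl (by rwa [show z.1 = R from h])

lemma exists_pos_forall_le_dist {ι X : Type*} [Finite ι] [MetricSpace X] (S : ι → Set X)
    (hS : ∀ i, IsCompact (S i)) :
    ∃ δ > 0, ∀ i j, Disjoint (S i) (S j) → ∀ x ∈ S i, ∀ y ∈ S j, δ ≤ dist x y := by
  have h : ∀ i j, ∀ᶠ δ in nhdsWithin (0 : ℝ) (Set.Ioi 0),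
      Disjoint (S i) (S j) → ∀ x ∈ S i, ∀ y ∈ S j, δ ≤ dist x y := by
    intro i j
    by_cases hd : Disjoint (S i) (S j)
    · obtain ⟨r, hr, h⟩ := Metric.exists_pos_forall_lt_edist (hS i) (hS j).isClosed hd
      filter_upwards [Ioo_mem_nhdsGT (NNReal.coe_pos.2 hr)] with δ hδ _ x hx y hy
      have h1 := h x hx y hy
      rw [edist_nndist, ENNReal.coe_lt_coe] at h1
      exact hδ.2.le.trans (NNReal.coe_le_coe.2 h1.le)
    · exact .of_forall fun δ h => (hd h).elim
  obtain ⟨δ, h, hδ⟩ := ((Filter.eventually_all.2 fun i => Filter.eventually_all.2 (h i)).and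
    self_mem_nhdsWithin).exists
  exact ⟨δ, hδ, h⟩

lemma exists_planeCell_bound {δ : ℝ} (hδ : 0 < δ) {S : Set (ℝ × ℝ)} (hS : IsCompact S) :
    ∃ R : ℤ, ∀ x ∈ S, |(planeCell δ x).1| < R ∧ |(planeCell δ x).2| < R := by
  obtain ⟨M, hM⟩ := hS.isBounded.exists_norm_le
  have key : ∀ a : ℝ, |a| ≤ M → |⌊a / δ⌋| < ⌈M / δ⌉ + 2 := by
    intro a ha
    obtain ⟨h1, h2⟩ := abs_le.1 ha
    have h3 : a / δ ≤ M / δ := by gcongr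
    have h4 : -(M / δ) ≤ a / δ := by
      rw [← neg_div]
      gcongr
    have h5 := Int.le_ceil (M / δ)
    have h6 := Int.floor_le (a / δ)
    have h7 := Int.lt_floor_add_one (a / δ)
    rw [abs_lt]
    constructor <;> rify <;> linarith
  refine ⟨⌈M / δ⌉ + 2, fun x hx => ?_⟩
  have h := hM x hx
  rw [Prod.norm_def, max_le_iff] at h
  exact ⟨key _ h.1, key _ h.2⟩

namespace SimpleGraph

variable {V : Type*} {G : SimpleGraph V} {f : V → ℝ × ℝ} {g : V → V → ℝ → ℝ × ℝ}

/-- A drawing of `G` in the plane, with the edges parametrised compatibly in both directions. -/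
structure IsPlaneDrawing (G : SimpleGraph V) (f : V → ℝ × ℝ) (g : V → V → ℝ → ℝ × ℝ) : Prop where
  injective : f.Injective
  continuous : ∀ u v, G.Adj u v → Continuous (g u v)
  zero : ∀ u v, G.Adj u v → g u v 0 = f u
  symm : ∀ u v, G.Adj u v → ∀ t, g v u t = g u v (1 - t)
  injOn : ∀ u v, G.Adj u v → Set.InjOn (g u v) (Set.Icc 0 1)
  vertex : ∀ u v, G.Adj u v → ∀ t ∈ Set.Icc (0 : ℝ) 1, ∀ w, g u v t = f w → w = u ∨ w = v
  inter : ∀ u v, G.Adj u v → ∀ u' v', G.Adj u' v' → s(u, v) ≠ s(u', v') →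
    ∀ t ∈ Set.Icc (0 : ℝ) 1, ∀ t' ∈ Set.Icc (0 : ℝ) 1, g u v t = g u' v' t' →
      ∃ w, g u v t = f w

lemma IsPlanar.exists_isPlaneDrawing [LinearOrder V] (hG : G.IsPlanar) :
    ∃ f g, G.IsPlaneDrawing f g := by
  classical
  obtain ⟨f, γ, hf, hγ, hsymm, hvert, hinter⟩ := hG
  let g : V → V → ℝ → ℝ × ℝ := fun u v t => if h : G.Adj u v then
    if u < v then (γ h).extend t else (γ h.symm).extend (1 - t) else f u
  have hlt : ∀ u v (h : G.Adj u v), u < v → g u v = (γ h).extend := fun u v h huv => by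
    ext1 t
    simp [g, h, huv]
  have hgt : ∀ u v (h : G.Adj u v), v < u → g u v = fun t => (γ h.symm).extend (1 - t) :=
    fun u v h huv => by
      ext1 t
      simp [g, h, huv.not_gt]
  have hsub : ∀ t ∈ Set.Icc (0 : ℝ) 1, 1 - t ∈ Set.Icc (0 : ℝ) 1 := fun t ht =>
    ⟨by linarith [ht.2], by linarith [ht.1]⟩
  have hinj : ∀ u v (h : G.Adj u v), Set.InjOn (γ h).extend (Set.Icc 0 1) := by
    intro u v h s hs t ht hst
    rw [Path.extend_apply _ hs, Path.extend_apply _ ht] at hst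
    exact congrArg Subtype.val (hγ h hst)
  have hrange : ∀ u v (h : G.Adj u v), ∀ t ∈ Set.Icc (0 : ℝ) 1, g u v t ∈ Set.range (γ h) := by
    intro u v h t ht
    rcases h.ne.lt_or_gt with huv | huv
    · rw [hlt u v h huv, ← Path.extend_range]
      exact ⟨t, rfl⟩
    · rw [hgt u v h huv, hsymm, ← Path.extend_range]
      exact ⟨1 - t, rfl⟩
  refine ⟨f, g, hf, fun u v h => ?_, fun u v h => ?_, fun u v h t => ?_, fun u v h => ?_,
    fun u v h t ht w hw => ?_, fun u v h u' v' h' hne t ht t' ht' heq => ?_⟩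
  · rcases h.ne.lt_or_gt with huv | huv
    · rw [hlt u v h huv]
      exact (γ h).continuous_extend
    · rw [hgt u v h huv]
      exact (γ h.symm).continuous_extend.comp (continuous_const.sub continuous_id)
  · rcases h.ne.lt_or_gt with huv | huv
    · rw [hlt u v h huv, Path.extend_zero]
    · rw [hgt u v h huv]
      simp
  · rcases h.ne.lt_or_gt with huv | huv
    · rw [hlt u v h huv, hgt v u h.symm huv]
    · rw [hgt u v h huv, hlt v u h.symm huv]
      simp
  · rcases h.ne.lt_or_gt with huv | huv
    · rw [hlt u v h huv]
      exact hinj u v h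
    · rw [hgt u v h huv]
      intro s hs t ht hst
      have := hinj v u h.symm (hsub s hs) (hsub t ht) hst
      linarith
  · exact hvert h w (hw ▸ hrange u v h t ht)
  · obtain ⟨w, -, hw⟩ := hinter h h' hne ⟨hrange u v h t ht, heq ▸ hrange u' v' h' t' ht'⟩
    exact ⟨w, hw.symm⟩

namespace IsPlaneDrawing

lemma one (hg : G.IsPlaneDrawing f g) {u v : V} (h : G.Adj u v) : g u v 1 = f v := by
  rw [hg.symm v u h.symm, sub_self, hg.zero v u h.symm]

lemma eq_vertex (hg : G.IsPlaneDrawing f g) {u v w : V} (h : G.Adj u v) {t : ℝ}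
    (ht : t ∈ Set.Icc (0 : ℝ) 1) (hw : g u v t = f w) : (w = u ∧ t = 0) ∨ (w = v ∧ t = 1) := by
  rcases hg.vertex u v h t ht w hw with rfl | rfl
  · exact Or.inl ⟨rfl, hg.injOn w v h ht (by simp) (hw.trans (hg.zero w v h).symm)⟩
  · exact Or.inr ⟨rfl, hg.injOn u w h ht (by simp) (hw.trans (hg.one h).symm)⟩

/-- The star formed by `f u` and the initial thirds of the edges at `u`. -/
def star (G : SimpleGraph V) (f : V → ℝ × ℝ) (g : V → V → ℝ → ℝ × ℝ) (u : V) : Set (ℝ × ℝ) :=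
  {f u} ∪ ⋃ v, ⋃ _ : G.Adj u v, g u v '' Set.Icc 0 (1 / 3)

/-- The middle third of the edge `uv`. -/
def middle (g : V → V → ℝ → ℝ × ℝ) (u v : V) : Set (ℝ × ℝ) := g u v '' Set.Icc (1 / 3) (2 / 3)

lemma mem_star {u : V} {x : ℝ × ℝ} :
    x ∈ star G f g u ↔ x = f u ∨ ∃ v, G.Adj u v ∧ ∃ t ∈ Set.Icc (0 : ℝ) (1 / 3), g u v t = x := by
  simp [star]

lemma isCompact_star [Finite V] (hg : G.IsPlaneDrawing f g) (u : V) : IsCompact (star G f g u) :=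
  isCompact_singleton.union <| isCompact_iUnion fun v => isCompact_iUnion fun h =>
    isCompact_Icc.image (hg.continuous u v h)

lemma isCompact_middle (hg : G.IsPlaneDrawing f g) {u v : V} (h : G.Adj u v) :
    IsCompact (middle g u v) :=
  isCompact_Icc.image (hg.continuous u v h)

lemma isPreconnected_middle (hg : G.IsPlaneDrawing f g) {u v : V} (h : G.Adj u v) :
    IsPreconnected (middle g u v) :=
  isPreconnected_Icc.image _ (hg.continuous u v h).continuousOn

lemma isPreconnected_star (hg : G.IsPlaneDrawing f g) (u : V) :
    IsPreconnected (star G f g u) := by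
  refine isPreconnected_of_forall (f u) fun x hx => ?_
  rcases mem_star.1 hx with rfl | ⟨v, h, t, ht, rfl⟩
  · exact ⟨{f u}, by simp [star], rfl, rfl, isPreconnected_singleton⟩
  · refine ⟨g u v '' Set.Icc 0 (1 / 3), ?_, ⟨0, by norm_num, hg.zero u v h⟩, ⟨t, ht, rfl⟩,
      isPreconnected_Icc.image _ (hg.continuous u v h).continuousOn⟩
    rintro _ ⟨s, hs, rfl⟩
    exact mem_star.2 (Or.inr ⟨v, h, s, hs, rfl⟩)

lemma disjoint_star (hg : G.IsPlaneDrawing f g) {u v : V} (huv : u ≠ v) :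
    Disjoint (star G f g u) (star G f g v) := by
  have hsub : ∀ t ∈ Set.Icc (0 : ℝ) (1 / 3), t ∈ Set.Icc (0 : ℝ) 1 := fun t ht =>
    ⟨ht.1, by linarith [ht.2]⟩
  have h0 : ∀ a b w, G.Adj a b → ∀ t ∈ Set.Icc (0 : ℝ) (1 / 3), g a b t = f w → w = a := by
    intro a b w h t ht hw
    rcases hg.eq_vertex h (hsub t ht) hw with ⟨h, -⟩ | ⟨-, h⟩
    · exact h
    · linarith [ht.2]
  refine Set.disjoint_left.2 fun x hx hx' => ?_
  rcases mem_star.1 hx with rfl | ⟨a, h, t, ht, rfl⟩ <;>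
    rcases mem_star.1 hx' with hx' | ⟨b, h', s, hs, hx'⟩
  · exact huv (hg.injective hx')
  · exact huv (h0 v b u h' s hs hx')
  · exact huv (h0 u a v h t ht hx').symm
  · by_cases he : s(u, a) = s(v, b)
    · rcases Sym2.eq_iff.1 he with ⟨h1, -⟩ | ⟨rfl, rfl⟩
      · exact huv h1
      · rw [hg.symm _ _ h] at hx'
        have := hg.injOn _ _ h ⟨by linarith [hs.2], by linarith [hs.1]⟩ (hsub t ht) hx'
        linarith [ht.2, hs.2]
    · obtain ⟨w, hw⟩ := hg.inter u a h v b h' he t (hsub t ht) s (hsub s hs) hx'.symm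
      exact huv ((h0 u a w h t ht hw).symm.trans (h0 v b w h' s hs (hx'.trans hw)))

lemma middle_ne_vertex (hg : G.IsPlaneDrawing f g) {u v w : V} (h : G.Adj u v) {t : ℝ}
    (ht : t ∈ Set.Icc (1 / 3 : ℝ) (2 / 3)) : g u v t ≠ f w := fun hw => by
  rcases hg.eq_vertex h ⟨by linarith [ht.1], by linarith [ht.2]⟩ hw with ⟨-, h⟩ | ⟨-, h⟩
  · linarith [ht.1]
  · linarith [ht.2]

lemma disjoint_middle_star (hg : G.IsPlaneDrawing f g) {u v w : V} (h : G.Adj u v) (hu : w ≠ u)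
    (hv : w ≠ v) : Disjoint (middle g u v) (star G f g w) := by
  refine Set.disjoint_left.2 ?_
  rintro _ ⟨t, ht, rfl⟩ hx
  rcases mem_star.1 hx with hx | ⟨b, h', s, hs, hx⟩
  · exact hg.middle_ne_vertex h ht hx
  · obtain ⟨x, hx⟩ := hg.inter u v h w b h' (fun e => by
      rcases Sym2.eq_iff.1 e with ⟨h, -⟩ | ⟨-, h⟩
      exacts [hu h.symm, hv h.symm]) t ⟨by linarith [ht.1], by linarith [ht.2]⟩ s
      ⟨hs.1, by linarith [hs.2]⟩ hx.symm
    exact hg.middle_ne_vertex h ht hx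

lemma disjoint_middle (hg : G.IsPlaneDrawing f g) {u v u' v' : V} (h : G.Adj u v)
    (h' : G.Adj u' v') (hne : s(u, v) ≠ s(u', v')) : Disjoint (middle g u v) (middle g u' v') := by
  refine Set.disjoint_left.2 ?_
  rintro _ ⟨t, ht, rfl⟩ ⟨s, hs, hx⟩
  obtain ⟨x, hx⟩ := hg.inter u v h u' v' h' hne t ⟨by linarith [ht.1], by linarith [ht.2]⟩ s
    ⟨by linarith [hs.1], by linarith [hs.2]⟩ hx.symm
  exact hg.middle_ne_vertex h ht hx

/-- On a sufficiently fine grid, cells meeting disjoint pieces of the drawing are distinct. -/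
lemma exists_grid [Finite V] (hg : G.IsPlaneDrawing f g) :
    ∃ δ > 0, (∀ u v, u ≠ v →
        Disjoint (planeCell δ '' star G f g u) (planeCell δ '' star G f g v)) ∧
      (∀ u v w, G.Adj u v → w ≠ u → w ≠ v →
        Disjoint (planeCell δ '' middle g u v) (planeCell δ '' star G f g w)) ∧
      ∀ u v u' v', G.Adj u v → G.Adj u' v' → s(u, v) ≠ s(u', v') →
        Disjoint (planeCell δ '' middle g u v) (planeCell δ '' middle g u' v') := by
  obtain ⟨δ, hδ, h⟩ := exists_pos_forall_le_dist
    (fun i : V ⊕ {e : V × V // G.Adj e.1 e.2} =>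
      i.elim (star G f g) fun e => middle g e.1.1 e.1.2)
    (fun i => by
      rcases i with u | ⟨e, he⟩
      exacts [hg.isCompact_star u, hg.isCompact_middle he])
  have key : ∀ i j, Disjoint _ _ → Disjoint (planeCell δ '' _) (planeCell δ '' _) := fun i j hd =>
    Set.disjoint_left.2 fun z ⟨x, hx, hxz⟩ ⟨y, hy, hyz⟩ =>
      (dist_lt_of_planeCell_eq hδ (hxz.trans hyz.symm)).not_ge (h i j hd x hx y hy)
  exact ⟨δ, hδ, fun u v huv => key (.inl u) (.inl v) (hg.disjoint_star huv),
    fun u v w he hu hv => key (.inr ⟨(u, v), he⟩) (.inl w) (hg.disjoint_middle_star he hu hv),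
    fun u v u' v' he he' hne => key (.inr ⟨(u, v), he⟩) (.inr ⟨(u', v'), he'⟩)
      (hg.disjoint_middle he he' hne)⟩

lemma exists_isLatticeQuotient [Finite V] [LinearOrder V] (hg : G.IsPlaneDrawing f g) :
    ∃ q : ℤ × ℤ → Option V, IsLatticeQuotient q none ∧
      ∀ u v, G.Adj u v → (latticeQuotient q).Adj (some u) (some v) := by
  obtain ⟨δ, hδ, hss, hms, hmm⟩ := hg.exists_grid
  obtain ⟨R, hR⟩ := exists_planeCell_bound hδ (S := (⋃ u, star G f g u) ∪
    ⋃ u, ⋃ v, ⋃ _ : G.Adj u v, middle g u v)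
    ((isCompact_iUnion hg.isCompact_star).union <| isCompact_iUnion fun u =>
      isCompact_iUnion fun v => isCompact_iUnion fun h => hg.isCompact_middle h)
  have hstar : ∀ u, ∀ z ∈ planeCell δ '' star G f g u, |z.1| < R ∧ |z.2| < R := by
    rintro u _ ⟨x, hx, rfl⟩
    exact hR x (Or.inl (Set.mem_iUnion_of_mem u hx))
  have hmiddle : ∀ u v, G.Adj u v → ∀ z ∈ planeCell δ '' middle g u v, |z.1| < R ∧ |z.2| < R := by
    rintro u v h _ ⟨x, hx, rfl⟩
    exact hR x (Or.inr (Set.mem_iUnion.2 ⟨u, Set.mem_iUnion.2 ⟨v, Set.mem_iUnion.2 ⟨h, hx⟩⟩⟩))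
  have hW : ∀ u v, ∃ W : Set (ℤ × ℤ), G.Adj u v →
      W ⊆ planeCell δ '' middle g u v \ planeCell δ '' star G f g v ∧
      triLattice.ConnIn W ∧ planeCell δ (g u v (1 / 3)) ∈ W ∧
      triLattice.SetAdj W (planeCell δ '' star G f g v) := by
    intro u v
    by_cases h : G.Adj u v
    swap
    · exact ⟨∅, fun h' => (h h').elim⟩
    have ha : g u v (1 / 3) ∈ middle g u v := ⟨1 / 3, by norm_num, rfl⟩
    have hau : g u v (1 / 3) ∈ star G f g u := mem_star.2 (Or.inr ⟨v, h, 1 / 3, by norm_num, rfl⟩)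
    have hb : g u v (2 / 3) ∈ middle g u v := ⟨2 / 3, by norm_num, rfl⟩
    have hbv : g u v (2 / 3) ∈ star G f g v := mem_star.2 (Or.inr ⟨u, h.symm, 1 / 3, by norm_num, by
      rw [hg.symm u v h]
      norm_num⟩)
    obtain ⟨W, hW, haW, hc, hmax⟩ := triLattice.exists_component
      (planeCell δ '' middle g u v \ planeCell δ '' star G f g v)
      (v := planeCell δ (g u v (1 / 3))) ⟨Set.mem_image_of_mem _ ha, fun h' =>
        Set.disjoint_left.1 (hss u v h.ne) (Set.mem_image_of_mem _ hau) h'⟩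
    refine ⟨W, fun _ => ⟨hW, hc, haW, ?_⟩⟩
    obtain ⟨p, hp⟩ := connIn_planeCell δ (hg.isPreconnected_middle h) _
      (Set.mem_image_of_mem _ ha) _ (Set.mem_image_of_mem _ hb)
    obtain ⟨e, he, h1, h2⟩ := p.exists_boundary_dart W haW
      fun h' => (hW h').2 (Set.mem_image_of_mem _ hbv)
    refine ⟨e.fst, h1, e.snd, ?_, e.adj⟩
    by_contra h3
    exact h2 (hmax {e.snd} (Set.singleton_subset_iff.2
      ⟨hp _ (p.dart_snd_mem_support_of_mem_darts he), h3⟩) (ConnIn.singleton _)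
      ⟨e.fst, h1, Or.inr ⟨e.snd, rfl, e.adj⟩⟩ rfl)
  choose W hW using hW
  let B : V → Set (ℤ × ℤ) := fun u =>
    planeCell δ '' star G f g u ∪ ⋃ v, ⋃ _ : G.Adj u v ∧ u < v, W u v
  have hB : ∀ u z, z ∈ B u → z ∈ planeCell δ '' star G f g u ∨
      ∃ v, G.Adj u v ∧ u < v ∧ z ∈ W u v := by
    intro u z hz
    simpa [B, and_assoc] using hz
  have hBW : ∀ u v, G.Adj u v → u < v → W u v ⊆ B u := fun u v h huv z hz =>
    Or.inr (Set.mem_iUnion.2 ⟨v, Set.mem_iUnion.2 ⟨⟨h, huv⟩, hz⟩⟩)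
  have hBR : ∀ u, ∀ z ∈ B u, |z.1| < R ∧ |z.2| < R := by
    intro u z hz
    rcases hB u z hz with h | ⟨v, h, -, hz⟩
    · exact hstar u z h
    · exact hmiddle u v h z ((hW u v h).1 hz).1
  have hSW : ∀ u v w z, u ≠ v → z ∈ planeCell δ '' star G f g u → G.Adj v w → z ∉ W v w := by
    intro u v w z huv hz h hz'
    obtain ⟨h1, h2⟩ := (hW v w h).1 hz'
    by_cases huw : u = w
    · exact h2 (huw ▸ hz)
    · exact Set.disjoint_left.1 (hms v w u h huv huw) h1 hz
  have hdisj : ∀ u v z, z ∈ B u → z ∈ B v → u = v := by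
    intro u v z hu hv
    by_contra huv
    rcases hB u z hu with hu | ⟨a, ha, hua, hu⟩ <;> rcases hB v z hv with hv | ⟨b, hb, hvb, hv⟩
    · exact Set.disjoint_left.1 (hss u v huv) hu hv
    · exact hSW u v b z huv hu hb hv
    · exact hSW v u a z (Ne.symm huv) hv ha hu
    · refine Set.disjoint_left.1 (hmm u a v b ha hb fun e => ?_) ((hW u a ha).1 hu).1
        ((hW v b hb).1 hv).1
      rcases Sym2.eq_iff.1 e with ⟨h, -⟩ | ⟨rfl, rfl⟩
      · exact huv h
      · exact lt_asymm hua hvb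
  have hconn : ∀ u, triLattice.ConnIn (B u) := by
    intro u
    have hf : planeCell δ (f u) ∈ planeCell δ '' star G f g u :=
      Set.mem_image_of_mem _ (mem_star.2 (Or.inl rfl))
    have hc := connIn_planeCell δ (hg.isPreconnected_star u)
    refine .of_center (c := planeCell δ (f u)) fun z hz => ?_
    rcases hB u z hz with hz | ⟨v, h, huv, hz⟩
    · obtain ⟨p, hp⟩ := hc z hz _ hf
      exact ⟨p, fun y hy => Or.inl (hp y hy)⟩
    · obtain ⟨-, h1, h2, -⟩ := hW u v h
      obtain ⟨p, hp⟩ := h1.union_of_mem hc h2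
        (Set.mem_image_of_mem _ (mem_star.2 (Or.inr ⟨v, h, 1 / 3, by norm_num, rfl⟩))) z
        (Or.inl hz) _ (Or.inr hf)
      exact ⟨p, fun y hy => (hp y hy).elim (fun h' => hBW u v h huv h') Or.inl⟩
  obtain ⟨q, hq, hqc⟩ := exists_extension triLattice_reachable
    (fun a : Option V => a.elim {x : ℤ × ℤ | R ≤ |x.1| ∨ R ≤ |x.2|} B)
    (fun a b z ha hb => by
      rcases a with _ | a <;> rcases b with _ | b
      · rfl
      · have := hBR b z hb
        rcases ha with h | h <;> omega
      · have := hBR a z ha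
        rcases hb with h | h <;> omega
      · exact congrArg some (hdisj a b z ha hb))
    (fun a => by rcases a with _ | a; exacts [connIn_compl_square R, hconn a])
    ⟨none, (R, R), Or.inl (le_abs_self R)⟩
  have hadj : ∀ u v, G.Adj u v → u < v → (latticeQuotient q).Adj (some u) (some v) := by
    intro u v h huv
    obtain ⟨-, -, -, x, hx, y, hy, hxy⟩ := hW u v h
    exact ⟨by simpa using h.ne, x, y, hxy, hq (some u) x (hBW u v h huv hx),
      hq (some v) y (Or.inl hy)⟩
  refine ⟨q, ⟨fun a => ?_, hqc, fun a ha => ?_⟩, fun u v h => ?_⟩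
  · rcases a with _ | a
    · exact ⟨(R, R), hq none _ (Or.inl (le_abs_self R))⟩
    · exact ⟨planeCell δ (f a), hq (some a) _ (Or.inl (Set.mem_image_of_mem _
        (mem_star.2 (Or.inl rfl))))⟩
  · refine ((Set.finite_Icc (-R) R).prod (Set.finite_Icc (-R) R)).subset fun z hz => ?_
    have h : ¬ (R ≤ |z.1| ∨ R ≤ |z.2|) := fun h => ha (hz.symm.trans (hq none z h))
    rw [not_or, not_le, not_le, abs_lt, abs_lt] at h
    exact ⟨⟨h.1.1.le, h.1.2.le⟩, ⟨h.2.1.le, h.2.2.le⟩⟩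
  · rcases h.ne.lt_or_gt with huv | huv
    · exact hadj u v h huv
    · exact (hadj v u h.symm huv).symm

end IsPlaneDrawing

end SimpleGraph

/-- **Theorem 1 (Dujmović–Esperet–Joret–Walczak–Wood).**
Every planar graph `G` satisfies `π(G) ≤ 768`. -/
theorem nonrepChromNum_le_of_isPlanar (V : Type) [Fintype V] (G : SimpleGraph V)
    (hG : G.IsPlanar) : G.nonrepChromNum ≤ 768 := by
  let _ : LinearOrder V := LinearOrder.lift' (Fintype.equivFin V) (Fintype.equivFin V).injective
  obtain ⟨f, g, hg⟩ := hG.exists_isPlaneDrawing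
  obtain ⟨q, hq, h⟩ := hg.exists_isLatticeQuotient
  exact SimpleGraph.nonrepChromNum_le hq h
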